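/- Let θ be a real number such that e^{iθ} is an algebraic number but not a root of unity, and let b be a real algebraic number with |b| > 1. Then the number Σ_{n ≥ 1, cos(nθ) > 0} cos(nθ)/b^n is transcendental. -/

import Mathlib

/-- `SizeLE φ q e H x` says that `x` lies in the image of the number field `K`, that `q ^ e` is a
denominator for it and that all its conjugates are bounded by `H`. -/
def SizeLE {K : Type*} [Field K] (φ : K →+* ℂ) (q e : ℕ) (H : ℝ) (x : ℂ) : Prop :=
  ∃ a : K, φ a = x ∧ IsIntegral ℤ ((q : K) ^ e * a) ∧ ∀ σ : K →+* ℂ, ‖σ a‖ ≤ H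

namespace SizeLE

variable {K : Type*} [Field K] {φ : K →+* ℂ} {q e e' : ℕ} {H H' : ℝ} {x y : ℂ}

theorem nonneg (h : SizeLE φ q e H x) : 0 ≤ H := by
  obtain ⟨a, -, -, h⟩ := h
  exact (norm_nonneg _).trans (h φ)

theorem mono (h : SizeLE φ q e H x) (he : e ≤ e') (hH : H ≤ H') : SizeLE φ q e' H' x := by
  obtain ⟨a, h1, h2, h3⟩ := h
  refine ⟨a, h1, ?_, fun σ => (h3 σ).trans hH⟩
  obtain ⟨k, rfl⟩ := Nat.exists_eq_add_of_le he
  have : (q : K) ^ (e + k) * a = (q : K) ^ k * ((q : K) ^ e * a) := by ring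
  rw [this]
  exact ((isIntegral_natCast _).pow k).mul h2

theorem mul (h : SizeLE φ q e H x) (h' : SizeLE φ q e' H' y) :
    SizeLE φ q (e + e') (H * H') (x * y) := by
  have hH := h.nonneg
  obtain ⟨a, h1, h2, h3⟩ := h
  obtain ⟨b, h1', h2', h3'⟩ := h'
  refine ⟨a * b, by rw [map_mul, h1, h1'], ?_, fun σ => ?_⟩
  · have : (q : K) ^ (e + e') * (a * b) = ((q : K) ^ e * a) * ((q : K) ^ e' * b) := by ring
    rw [this]
    exact h2.mul h2'
  · rw [map_mul, norm_mul]
    exact mul_le_mul (h3 σ) (h3' σ) (norm_nonneg _) hH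

theorem add (h : SizeLE φ q e H x) (h' : SizeLE φ q e H' y) :
    SizeLE φ q e (H + H') (x + y) := by
  obtain ⟨a, h1, h2, h3⟩ := h
  obtain ⟨b, h1', h2', h3'⟩ := h'
  refine ⟨a + b, by rw [map_add, h1, h1'], ?_, fun σ => ?_⟩
  · rw [mul_add]
    exact h2.add h2'
  · rw [map_add]
    exact (norm_add_le _ _).trans (add_le_add (h3 σ) (h3' σ))

theorem neg (h : SizeLE φ q e H x) : SizeLE φ q e H (-x) := by
  obtain ⟨a, h1, h2, h3⟩ := h
  refine ⟨-a, by rw [map_neg, h1], ?_, fun σ => ?_⟩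
  · rw [mul_neg]
    exact h2.neg
  · rw [map_neg, norm_neg]
    exact h3 σ

theorem sub (h : SizeLE φ q e H x) (h' : SizeLE φ q e H' y) :
    SizeLE φ q e (H + H') (x - y) := by
  rw [sub_eq_add_neg]
  exact h.add h'.neg

theorem intCast (k : ℤ) : SizeLE φ q 0 |(k : ℝ)| (k : ℂ) := by
  refine ⟨k, by simp, ?_, fun σ => by simp⟩
  rw [pow_zero, one_mul]
  exact isIntegral_algebraMap (R := ℤ) (x := k)

theorem one : SizeLE φ q 0 1 (1 : ℂ) := by
  simpa using intCast (φ := φ) (q := q) 1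

theorem pow (h : SizeLE φ q e H x) (k : ℕ) : SizeLE φ q (k * e) (H ^ k) (x ^ k) := by
  induction k with
  | zero => simpa using one (φ := φ) (q := q)
  | succ k ih =>
    rw [pow_succ, pow_succ, Nat.succ_mul]
    exact ih.mul h

theorem sum {ι : Type*} (s : Finset ι) {f : ι → ℂ} {g : ι → ℝ}
    (h : ∀ i ∈ s, SizeLE φ q e (g i) (f i)) :
    SizeLE φ q e (∑ i ∈ s, g i) (∑ i ∈ s, f i) := by
  classical
  induction s using Finset.induction_on with
  | empty =>
    have := (intCast (φ := φ) (q := q) 0).mono (Nat.zero_le e) le_rfl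
    simpa using this
  | insert a s ha ih =>
    rw [Finset.sum_insert ha, Finset.sum_insert ha]
    exact (h a (Finset.mem_insert_self _ _)).add
      (ih fun i hi => h i (Finset.mem_insert_of_mem hi))

theorem prod {ι : Type*} (s : Finset ι) {f : ι → ℂ} {g : ι → ℝ} {d : ι → ℕ}
    (h : ∀ i ∈ s, SizeLE φ q (d i) (g i) (f i)) :
    SizeLE φ q (∑ i ∈ s, d i) (∏ i ∈ s, g i) (∏ i ∈ s, f i) := by
  classical
  induction s using Finset.induction_on with
  | empty => simpa using one (φ := φ) (q := q)
  | insert a s ha ih =>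
    rw [Finset.prod_insert ha, Finset.prod_insert ha, Finset.sum_insert ha]
    exact (h a (Finset.mem_insert_self _ _)).mul
      (ih fun i hi => h i (Finset.mem_insert_of_mem hi))

/-- Liouville's inequality. -/
theorem one_le_norm_mul [NumberField K] (h : SizeLE φ q e H x) (hq : 1 ≤ q) (hx : x ≠ 0) :
    1 ≤ ‖x‖ * (((q : ℝ) ^ e) ^ Module.finrank ℚ K * H ^ (Module.finrank ℚ K - 1)) := by
  classical
  obtain ⟨a, rfl, h2, h3⟩ := h
  have ha : a ≠ 0 := by
    rintro rfl
    simp at hx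
  set z : K := (q : K) ^ e * a with hz
  have hq0 : (q : K) ≠ 0 := by
    have : (q : ℕ) ≠ 0 := by omega
    exact_mod_cast this
  have hz0 : z ≠ 0 := mul_ne_zero (pow_ne_zero _ hq0) ha
  have hN : IsIntegral ℤ (Algebra.norm ℚ z) := Algebra.isIntegral_norm ℚ h2
  obtain ⟨k, hk⟩ := IsIntegrallyClosed.isIntegral_iff.mp hN
  have hk0 : k ≠ 0 := by
    rintro rfl
    rw [map_zero] at hk
    exact hz0 (Algebra.norm_eq_zero_iff.mp hk.symm)
  have hprod := Algebra.norm_eq_prod_embeddings ℚ ℂ z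
  have h1 : (1 : ℝ) ≤ ∏ σ : K →ₐ[ℚ] ℂ, ‖σ z‖ := by
    rw [← norm_prod, ← hprod, ← hk]
    have : ‖(algebraMap ℚ ℂ) ((algebraMap ℤ ℚ) k)‖ = |(k : ℝ)| := by simp
    rw [this]
    exact_mod_cast Int.one_le_abs hk0
  let φ' : K →ₐ[ℚ] ℂ := φ.toRatAlgHom
  have hcard : Fintype.card (K →ₐ[ℚ] ℂ) = Module.finrank ℚ K := AlgHom.card ℚ K ℂ
  rw [← Finset.mul_prod_erase Finset.univ _ (Finset.mem_univ φ')] at h1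
  have hnorm : ∀ σ : K →ₐ[ℚ] ℂ, ‖σ z‖ = (q : ℝ) ^ e * ‖σ a‖ := by
    intro σ
    rw [hz, map_mul, map_pow, map_natCast, norm_mul, norm_pow, Complex.norm_natCast]
  have hpos : 0 < Module.finrank ℚ K := Module.finrank_pos
  have h4 : ∏ σ ∈ Finset.univ.erase φ', ‖σ z‖ ≤
      ((q : ℝ) ^ e * H) ^ (Module.finrank ℚ K - 1) := by
    have : (Finset.univ.erase φ').card = Module.finrank ℚ K - 1 := by
      rw [Finset.card_erase_of_mem (Finset.mem_univ _), Finset.card_univ, hcard]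
    rw [← this]
    refine (Finset.prod_le_prod (fun _ _ => norm_nonneg _) (fun σ _ => ?_)).trans
      (Finset.prod_const _).le
    rw [hnorm]
    exact mul_le_mul_of_nonneg_left (h3 σ.toRingHom) (by positivity)
  calc (1 : ℝ) ≤ ‖φ' z‖ * ∏ σ ∈ Finset.univ.erase φ', ‖σ z‖ := h1
    _ ≤ ((q : ℝ) ^ e * ‖φ a‖) * ((q : ℝ) ^ e * H) ^ (Module.finrank ℚ K - 1) := by
        rw [hnorm]
        exact mul_le_mul_of_nonneg_left h4 (by positivity)
    _ = _ := by
        obtain ⟨h, hh⟩ : ∃ h, Module.finrank ℚ K = h + 1 := ⟨_, (Nat.sub_add_cancel hpos).symm⟩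
        rw [hh, Nat.add_sub_cancel]
        ring

end SizeLE

theorem exists_sizeLE_of_isAlgebraic (s : Finset ℂ) (hs : ∀ x ∈ s, IsAlgebraic ℚ x) :
    ∃ K : IntermediateField ℚ ℂ, NumberField K ∧ ∃ (q : ℕ) (H : ℝ), 1 ≤ q ∧ 1 ≤ H ∧
      ∀ x ∈ s, SizeLE (algebraMap K ℂ) q 1 H x := by
  classical
  let K : IntermediateField ℚ ℂ := IntermediateField.adjoin ℚ (s : Set ℂ)
  have hfin : FiniteDimensional ℚ K :=
    IntermediateField.finiteDimensional_adjoin fun x hx => (hs x hx).isIntegral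
  have hK : NumberField K := ⟨⟩
  refine ⟨K, hK, ?_⟩
  have key : ∀ t : Finset ℂ, t ⊆ s → ∃ (q : ℕ) (H : ℝ), 1 ≤ q ∧ 1 ≤ H ∧
      ∀ x ∈ t, SizeLE (algebraMap K ℂ) q 1 H x := by
    intro t
    induction t using Finset.induction_on with
    | empty => exact fun _ => ⟨1, 1, le_rfl, le_rfl, by simp⟩
    | insert x t hx ih =>
      intro hsub
      obtain ⟨q, H, hq, hH, h⟩ := ih fun y hy => hsub (Finset.mem_insert_of_mem hy)
      have hxs : x ∈ s := hsub (Finset.mem_insert_self _ _)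
      let a : K := ⟨x, IntermediateField.subset_adjoin ℚ _ hxs⟩
      have halg : IsAlgebraic ℤ a :=
        (IsFractionRing.isAlgebraic_iff ℤ ℚ K).mpr (Algebra.IsAlgebraic.isAlgebraic a)
      obtain ⟨k, hk0, hk⟩ := halg.exists_integral_multiple
      have hknat : IsIntegral ℤ ((k.natAbs : K) * a) := by
        rcases Int.natAbs_eq k with h' | h'
        · rw [h', Algebra.smul_def] at hk
          simpa using hk
        · rw [h', Algebra.smul_def] at hk
          simpa using hk.neg
      refine ⟨q * k.natAbs, max H (∑ σ : K →+* ℂ, ‖σ a‖), ?_, hH.trans (le_max_left _ _), ?_⟩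
      · exact Nat.mul_pos hq (Int.natAbs_pos.mpr hk0)
      · intro y hy
        rcases Finset.mem_insert.mp hy with rfl | hy
        · refine ⟨a, rfl, ?_, fun σ => le_max_of_le_right ?_⟩
          · have : ((q * k.natAbs : ℕ) : K) ^ 1 * a = (q : K) * ((k.natAbs : K) * a) := by
              push_cast
              ring
            rw [this]
            exact (isIntegral_natCast _).mul hknat
          · exact Finset.single_le_sum (f := fun σ : K →+* ℂ => ‖σ a‖)
              (fun _ _ => norm_nonneg _) (Finset.mem_univ σ)
        · obtain ⟨b, h1, h2, h3⟩ := h y hy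
          refine ⟨b, h1, ?_, fun σ => (h3 σ).trans (le_max_left _ _)⟩
          have : ((q * k.natAbs : ℕ) : K) ^ 1 * b = (k.natAbs : K) * ((q : K) ^ 1 * b) := by
            push_cast
            ring
          rw [this]
          exact (isIntegral_natCast _).mul h2
  exact key s subset_rfl

section

open Real Filter

/-- The indicator sequence of the quarter periods on which the cosine is nonnegative. -/
noncomputable def quarterSign (l : ℕ) : ℝ := if l % 4 = 0 ∨ l % 4 = 3 then 1 else 0

theorem quarterSign_add_four_mul (l k : ℕ) : quarterSign (l + 4 * k) = quarterSign l := by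
  simp [quarterSign]

theorem quarterSign_mul_cos (x : ℝ) (hx : 0 ≤ x) :
    quarterSign ⌊x⌋₊ * cos (π * x / 2) = max (cos (π * x / 2)) 0 := by
  have h1 := Nat.floor_le hx
  have h2 := Nat.lt_floor_add_one x
  set X := ⌊x⌋₊ with hX
  obtain ⟨r, hr⟩ : ∃ r, r = X % 4 := ⟨_, rfl⟩
  obtain ⟨k, hk⟩ : ∃ k, k = X / 4 := ⟨_, rfl⟩
  have hXr : X = r + 4 * k := by omega
  have hr4 : r < 4 := by omega
  have hXr' : (X : ℝ) = r + 4 * k := by exact_mod_cast hXr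
  rw [hXr'] at h1 h2
  have hcos : cos (π * x / 2) = cos (π * (x - 4 * k) / 2) := by
    rw [← Real.cos_sub_nat_mul_two_pi _ k]
    congr 1
    ring
  rw [hcos, hXr, quarterSign_add_four_mul]
  have hpi := Real.pi_pos
  interval_cases r
  · have : 0 ≤ cos (π * (x - 4 * k) / 2) := by
      push_cast at h1 h2
      apply Real.cos_nonneg_of_mem_Icc
      constructor <;> nlinarith
    simp [quarterSign, this]
  · have : cos (π * (x - 4 * k) / 2) ≤ 0 := by
      push_cast at h1 h2
      apply Real.cos_nonpos_of_pi_div_two_le_of_le <;> nlinarith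
    simp [quarterSign, this]
  · have : cos (π * (x - 4 * k) / 2) ≤ 0 := by
      push_cast at h1 h2
      apply Real.cos_nonpos_of_pi_div_two_le_of_le <;> nlinarith
    simp [quarterSign, this]
  · have : 0 ≤ cos (π * (x - 4 * k) / 2) := by
      push_cast at h1 h2
      rw [← Real.cos_sub_two_pi]
      apply Real.cos_nonneg_of_mem_Icc
      constructor <;> nlinarith
    simp [quarterSign, this]

theorem quarterSign_succ_sub_mul_cos (l : ℕ) (a : ℝ) :
    (quarterSign (l + 1) - quarterSign l) * cos a =
      if Odd (l + 1) then sin (a - π * (l + 1 : ℕ) / 2) else 0 := by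
  obtain ⟨r, hr⟩ : ∃ r, r = l % 4 := ⟨_, rfl⟩
  obtain ⟨k, hk⟩ : ∃ k, k = l / 4 := ⟨_, rfl⟩
  have hl : l = r + 4 * k := by omega
  have hr4 : r < 4 := by omega
  have hsin : sin (a - π * (l + 1 : ℕ) / 2) = sin (a - π * (r + 1) / 2) := by
    rw [← Real.sin_add_nat_mul_two_pi _ k, hl]
    congr 1
    push_cast
    ring
  rw [hsin, hl, add_right_comm, quarterSign_add_four_mul, quarterSign_add_four_mul]
  have hodd : Odd (r + 1 + 4 * k) ↔ Odd (r + 1) := by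
    rw [Nat.odd_iff, Nat.odd_iff]
    omega
  simp only [hodd]
  interval_cases r
  · have : sin (a - π * ((0 : ℕ) + 1) / 2) = - cos a := by
      rw [← Real.sin_sub_pi_div_two]
      congr 1
      push_cast
      ring
    rw [this]
    simp [quarterSign]
  · simp [quarterSign, Nat.odd_iff]
  · have : sin (a - π * ((2 : ℕ) + 1) / 2) = cos a := by
      rw [← Real.sin_add_pi_div_two, ← Real.sin_add_two_pi]
      congr 1
      push_cast
      ring
    rw [this]
    have : Odd (2 + 1) := by decide
    simp [quarterSign, this]
  · have : ¬ Odd (3 + 1) := by decide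
    simp [quarterSign, this]

theorem quarterSign_sub_mul_cos {p q : ℕ} (h : p ≤ q) (a : ℝ) :
    (quarterSign q - quarterSign p) * cos a =
      ∑ l ∈ Finset.Ioc p q, if Odd l then sin (a - π * l / 2) else 0 := by
  induction q, h using Nat.le_induction with
  | base => simp
  | succ q h ih =>
    rw [← Finset.insert_Ioc_right_eq_Ioc_add_one (by omega), Finset.sum_insert (by simp), ← ih,
      ← quarterSign_succ_sub_mul_cos]
    ring

/-- Consecutive vectors `(n, c)` and `(m, d)` of a Farey-type expansion of `ω`. -/
structure FareyPair (ω : ℝ) where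
  (n c m d : ℕ)
  n_pos : 0 < n
  m_pos : 0 < m
  det : n * d = m * c + 1
  lower : (c : ℝ) < n * ω
  upper : (m : ℝ) * ω < d

namespace FareyPair

variable {ω : ℝ} (p : FareyPair ω)

/-- The defect of the lower vector. -/
def lo : ℝ := p.n * ω - p.c

/-- The defect of the upper vector. -/
def hi : ℝ := p.d - p.m * ω

/-- The ratio of the defects. -/
noncomputable def slope : ℝ := p.hi / p.lo

theorem lo_pos : 0 < p.lo := sub_pos.mpr p.lower

theorem hi_pos : 0 < p.hi := sub_pos.mpr p.upper

theorem slope_pos : 0 < p.slope := div_pos p.hi_pos p.lo_pos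

theorem slope_mul_lo : p.slope * p.lo = p.hi := div_mul_cancel₀ _ p.lo_pos.ne'

theorem det_real : (p.n : ℝ) * p.d = p.m * p.c + 1 := by exact_mod_cast p.det

theorem n_mul_hi_add : p.n * p.hi + p.m * p.lo = 1 := by
  have := p.det_real
  simp only [lo, hi]
  linear_combination this

theorem lattice_mul_sub (i j : ℕ) :
    ((i * p.n + j * p.m : ℕ) : ℝ) * ω - (i * p.c + j * p.d : ℕ) = i * p.lo - j * p.hi := by
  simp only [lo, hi]
  push_cast
  ring

theorem lattice_injective :
    Function.Injective fun x : ℕ × ℕ => (x.1 * p.n + x.2 * p.m, x.1 * p.c + x.2 * p.d) := by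
  rintro ⟨i, j⟩ ⟨i', j'⟩ h
  simp only [Prod.mk.injEq] at h
  obtain ⟨h1, h2⟩ := h
  have hd := p.det
  zify at h1 h2 hd
  have hj : (j : ℤ) = j' := by linear_combination p.n * h2 - p.c * h1 + (j' - j : ℤ) * hd
  have hi : (i : ℤ) = i' := by linear_combination p.d * h1 - p.m * h2 + (i' - i : ℤ) * hd
  exact Prod.ext (by exact_mod_cast hi) (by exact_mod_cast hj)

theorem exists_lattice {k l : ℕ} (h1 : k * p.c < l * p.n) (h2 : (l : ℝ) < k * ω) :
    ∃ i j, i * p.n + j * p.m = k ∧ i * p.c + j * p.d = l := by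
  have h3 : l * p.m ≤ k * p.d := by
    have : (l : ℝ) * p.m ≤ k * p.d := by
      have := p.upper
      have hm : (0 : ℝ) < p.m := by exact_mod_cast p.m_pos
      have hk : (0 : ℝ) ≤ k := by positivity
      nlinarith
    exact_mod_cast this
  refine ⟨k * p.d - l * p.m, l * p.n - k * p.c, ?_, ?_⟩
  all_goals
    have hd := p.det
    zify [h3, h1.le] at hd ⊢
  · linear_combination (k : ℤ) * hd
  · linear_combination (l : ℤ) * hd

/-- The coefficient pattern of the double series attached to a Farey pair. -/
noncomputable def pattern (i j : ℕ) : ℝ :=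
  if 1 ≤ j ∧ (j : ℝ) * p.slope < i ∧ Odd (i * p.c + j * p.d) then 1 else 0

theorem pattern_nonneg (i j : ℕ) : 0 ≤ p.pattern i j := by
  unfold pattern
  split_ifs <;> norm_num

theorem pattern_le_one (i j : ℕ) : p.pattern i j ≤ 1 := by
  unfold pattern
  split_ifs <;> norm_num

/-- The term of the double series attached to a Farey pair. -/
noncomputable def term (β : ℝ) (x : ℕ × ℕ) : ℝ :=
  p.pattern x.1 x.2 * sin (π / 2 * (x.1 * p.lo - x.2 * p.hi)) *
    β ^ (x.1 * p.n + x.2 * p.m)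

theorem abs_term_le (β : ℝ) (x : ℕ × ℕ) :
    |p.term β x| ≤ (|β| ^ p.n) ^ x.1 * (|β| ^ p.m) ^ x.2 := by
  rw [term, abs_mul, abs_mul, abs_pow, pow_add, mul_comm x.1, mul_comm x.2, pow_mul, pow_mul,
    abs_of_nonneg (p.pattern_nonneg _ _)]
  refine mul_le_of_le_one_left (by positivity) ?_
  exact mul_le_one₀ (p.pattern_le_one _ _) (abs_nonneg _) (Real.abs_sin_le_one _)

theorem summable_geometric {β : ℝ} (hβ : |β| < 1) :
    Summable fun x : ℕ × ℕ => (|β| ^ p.n) ^ x.1 * (|β| ^ p.m) ^ x.2 := by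
  have h1 : Summable fun i : ℕ => (|β| ^ p.n) ^ i :=
    summable_geometric_of_lt_one (by positivity) (pow_lt_one₀ (abs_nonneg _) hβ p.n_pos.ne')
  have h2 : Summable fun i : ℕ => (|β| ^ p.m) ^ i :=
    summable_geometric_of_lt_one (by positivity) (pow_lt_one₀ (abs_nonneg _) hβ p.m_pos.ne')
  exact h1.mul_of_nonneg h2 (fun _ => by positivity) (fun _ => by positivity)

theorem summable_term {β : ℝ} (hβ : |β| < 1) : Summable (p.term β) :=
  Summable.of_norm_bounded (p.summable_geometric hβ) fun x => p.abs_term_le β x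

theorem tsum_sub_tsum_eq (hω : 0 < ω) {β : ℝ} (hβ : |β| < 1) :
    ∑' k : ℕ, max (cos (π * (k * ω) / 2)) 0 * β ^ k -
      ∑' k : ℕ, quarterSign (k * p.c / p.n) * cos (π * (k * ω) / 2) * β ^ k =
    ∑' x, p.term β x := by
  classical
  have hgeo : Summable fun k : ℕ => |β| ^ k := summable_geometric_of_lt_one (abs_nonneg _) hβ
  have hs1 : Summable fun k : ℕ => max (cos (π * (k * ω) / 2)) 0 * β ^ k := by
    refine Summable.of_norm_bounded hgeo fun k => ?_
    rw [norm_mul, norm_pow, Real.norm_eq_abs, Real.norm_eq_abs]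
    refine mul_le_of_le_one_left (by positivity) ?_
    rw [abs_of_nonneg (le_max_right _ _)]
    exact max_le (Real.cos_le_one _) zero_le_one
  have hs2 : Summable fun k : ℕ =>
      quarterSign (k * p.c / p.n) * cos (π * (k * ω) / 2) * β ^ k := by
    refine Summable.of_norm_bounded hgeo fun k => ?_
    rw [norm_mul, norm_mul, norm_pow, Real.norm_eq_abs, Real.norm_eq_abs, Real.norm_eq_abs]
    refine mul_le_of_le_one_left (by positivity) ?_
    refine mul_le_one₀ ?_ (abs_nonneg _) (Real.abs_cos_le_one _)
    unfold quarterSign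
    split_ifs <;> simp
  let F : ℕ × ℕ → ℝ := fun x =>
    if x.1 * p.c < x.2 * p.n ∧ (x.2 : ℝ) < x.1 * ω ∧ Odd x.2 then
      sin (π * (x.1 * ω) / 2 - π * x.2 / 2) * β ^ x.1 else 0
  have hF : ∀ x : ℕ × ℕ, F (x.1 * p.n + x.2 * p.m, x.1 * p.c + x.2 * p.d) = p.term β x := by
    rintro ⟨i, j⟩
    have hd := p.det
    have e1 : (i * p.n + j * p.m) * p.c < (i * p.c + j * p.d) * p.n ↔ 1 ≤ j := by
      have : (i * p.c + j * p.d) * p.n = (i * p.n + j * p.m) * p.c + j := by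
        linear_combination j * hd
      omega
    have e2 : ((i * p.c + j * p.d : ℕ) : ℝ) < (i * p.n + j * p.m : ℕ) * ω ↔
        (j : ℝ) * p.slope < i := by
      have := p.lattice_mul_sub i j
      rw [← sub_pos, this, sub_pos, ← p.slope_mul_lo, ← mul_assoc,
        mul_lt_mul_iff_left₀ p.lo_pos]
    have e3 : π * ((i * p.n + j * p.m : ℕ) * ω) / 2 - π * (i * p.c + j * p.d : ℕ) / 2 =
        π / 2 * (i * p.lo - j * p.hi) := by
      rw [← p.lattice_mul_sub i j]
      ring
    simp only [F, e1, e2, e3, term, pattern]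
    split_ifs <;> simp
  have hsupp : Function.support F ⊆
      Set.range fun x : ℕ × ℕ => (x.1 * p.n + x.2 * p.m, x.1 * p.c + x.2 * p.d) := by
    rintro ⟨k, l⟩ h
    simp only [F, Function.mem_support, ne_eq, ite_eq_right_iff, not_forall] at h
    obtain ⟨⟨h1, h2, -⟩, -⟩ := h
    obtain ⟨i, j, h3, h4⟩ := p.exists_lattice h1 h2
    exact ⟨(i, j), by simp [h3, h4]⟩
  have hFs : Summable F := by
    rw [← p.lattice_injective.summable_iff (f := F) (fun x hx => by
      by_contra h
      exact hx (hsupp h))]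
    exact (p.summable_term hβ).congr fun x => (hF x).symm
  have hrow : ∀ k : ℕ, ∑' l, F (k, l) = max (cos (π * (k * ω) / 2)) 0 * β ^ k -
      quarterSign (k * p.c / p.n) * cos (π * (k * ω) / 2) * β ^ k := by
    intro k
    have hk : (0 : ℝ) ≤ k * ω := by positivity
    have hle : k * p.c / p.n ≤ ⌊(k : ℝ) * ω⌋₊ := by
      refine Nat.le_floor ?_
      have h1 : ((k * p.c / p.n : ℕ) : ℝ) * p.n ≤ k * p.c := by
        exact_mod_cast Nat.div_mul_le_self _ _
      have hn : (0 : ℝ) < p.n := by exact_mod_cast p.n_pos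
      have := p.lower
      have hk : (0 : ℝ) ≤ k := by positivity
      by_contra! hcon
      nlinarith
    rw [← quarterSign_mul_cos _ hk, ← sub_mul, ← sub_mul, quarterSign_sub_mul_cos hle,
      tsum_eq_sum (s := Finset.Ioc (k * p.c / p.n) ⌊(k : ℝ) * ω⌋₊), Finset.sum_mul]
    · refine Finset.sum_congr rfl fun l hl => ?_
      rw [Finset.mem_Ioc, Nat.div_lt_iff_lt_mul p.n_pos, Nat.le_floor_iff hk] at hl
      simp only [F]
      rcases hl.2.lt_or_eq with h | h
      · by_cases ho : Odd l <;> simp [hl.1, h, ho]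
      · have : π * (k * ω) / 2 - π * l / 2 = 0 := by rw [h]; ring
        simp [this]
    · intro l hl
      simp only [F, ite_eq_right_iff]
      rintro ⟨h1, h2, -⟩
      refine absurd ?_ hl
      rw [Finset.mem_Ioc, Nat.div_lt_iff_lt_mul p.n_pos, Nat.le_floor_iff hk]
      exact ⟨h1, h2.le⟩
  rw [← hs1.tsum_sub hs2]
  simp only [← hrow]
  rw [← hFs.tsum_prod, ← p.lattice_injective.tsum_eq hsupp]
  exact tsum_congr hF

end FareyPair

theorem tsum_mul_one_sub_pow {s : ℕ → ℂ} {N : ℕ} (hs : ∀ k, s (k + N) = s k)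
    (hb : ∀ k, ‖s k‖ ≤ 1) {x : ℂ} (hx : ‖x‖ < 1) :
    (∑' k, s k * x ^ k) * (1 - x ^ N) = ∑ k ∈ Finset.range N, s k * x ^ k := by
  have hsum : Summable fun k => s k * x ^ k := by
    refine Summable.of_norm_bounded (summable_geometric_of_lt_one (norm_nonneg _) hx) fun k => ?_
    rw [norm_mul, norm_pow]
    exact mul_le_of_le_one_left (by positivity) (hb k)
  have h := hsum.sum_add_tsum_nat_add N
  have h2 : ∑' k, s (k + N) * x ^ (k + N) = (∑' k, s k * x ^ k) * x ^ N := by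
    rw [← tsum_mul_right]
    refine tsum_congr fun k => ?_
    rw [hs, pow_add]
    ring
  rw [h2] at h
  linear_combination -h

theorem one_sub_pow_ne_zero {x : ℂ} (hx : ‖x‖ < 1) {N : ℕ} (hN : N ≠ 0) : 1 - x ^ N ≠ 0 := by
  intro h
  have h1 : x ^ N = 1 := (sub_eq_zero.mp h).symm
  have h2 : ‖x‖ ^ N < 1 := pow_lt_one₀ (norm_nonneg _) hx hN
  rw [← norm_pow, h1, norm_one] at h2
  exact lt_irrefl _ h2

theorem norm_one_sub_pow_le {x : ℂ} (hx : ‖x‖ < 1) (N : ℕ) : ‖1 - x ^ N‖ ≤ 2 := by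
  refine (norm_sub_le _ _).trans ?_
  have h2 : ‖x‖ ^ N ≤ 1 := pow_le_one₀ (norm_nonneg _) hx.le
  rw [norm_one, norm_pow]
  linarith

/-- Multiplying by an explicit denominator makes the double series an algebraic number of size
exponential in `n`. -/
theorem FareyPair.exists_denominator {K : Type*} [Field K] {φ : K →+* ℂ} {q : ℕ} {H : ℝ}
    (hH : 1 ≤ H) {ω β : ℝ} (hω : 0 < ω) (hβ : |β| < 1) {α : ℂ}
    (hα : α = Complex.exp ((π * ω / 2 : ℝ) * Complex.I))
    (h1 : SizeLE φ q 1 H α) (h2 : SizeLE φ q 1 H α⁻¹) (h3 : SizeLE φ q 1 H β)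
    (h4 : SizeLE φ q 1 H (∑' k : ℕ, max (cos (π * (k * ω) / 2)) 0 * β ^ k : ℝ))
    (h5 : SizeLE φ q 1 H Complex.I) (p : FareyPair ω) :
    ∃ D : ℂ, D ≠ 0 ∧ ‖D‖ ≤ 4 ∧ SizeLE φ q (18 * p.n) ((64 * H) ^ (18 * p.n)) D ∧
      SizeLE φ q (18 * p.n) ((64 * H) ^ (18 * p.n))
        (D * (2 * Complex.I * (∑' x, p.term β x : ℝ))) := by
  have hn := p.n_pos
  have hαn : ‖α‖ = 1 := by rw [hα, Complex.norm_exp_ofReal_mul_I]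
  have hα0 : α ≠ 0 := by rw [hα]; exact Complex.exp_ne_zero _
  set x1 : ℂ := α * β with hx1
  set x2 : ℂ := α⁻¹ * β with hx2
  have hx1n : ‖x1‖ < 1 := by
    rw [hx1, norm_mul, hαn, one_mul, Complex.norm_real]
    exact hβ
  have hx2n : ‖x2‖ < 1 := by
    rw [hx2, norm_mul, norm_inv, hαn, inv_one, one_mul, Complex.norm_real]
    exact hβ
  set s : ℕ → ℂ := fun k => (quarterSign (k * p.c / p.n) : ℝ) with hsdef
  have hs01 : ∀ k, s k = 0 ∨ s k = 1 := by
    intro k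
    simp only [hsdef, quarterSign]
    split_ifs <;> simp
  have hs1 : ∀ k, ‖s k‖ ≤ 1 := by
    intro k
    rcases hs01 k with h | h <;> simp [h]
  have hsper : ∀ k, s (k + 4 * p.n) = s k := by
    intro k
    have : (k + 4 * p.n) * p.c / p.n = k * p.c / p.n + 4 * p.c := by
      rw [show (k + 4 * p.n) * p.c = k * p.c + p.n * (4 * p.c) by ring,
        Nat.add_mul_div_left _ _ hn]
    simp only [hsdef, this, quarterSign_add_four_mul]
  have hA1 := tsum_mul_one_sub_pow hsper hs1 hx1n
  have hA2 := tsum_mul_one_sub_pow hsper hs1 hx2n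
  set A1 : ℂ := ∑ k ∈ Finset.range (4 * p.n), s k * x1 ^ k with hA1def
  set A2 : ℂ := ∑ k ∈ Finset.range (4 * p.n), s k * x2 ^ k with hA2def
  have hsum : ∀ x : ℂ, ‖x‖ < 1 → Summable fun k => s k * x ^ k := by
    intro x hx
    refine Summable.of_norm_bounded (summable_geometric_of_lt_one (norm_nonneg _) hx) fun k => ?_
    rw [norm_mul, norm_pow]
    exact mul_le_of_le_one_left (by positivity) (hs1 k)
  have hR : 2 * ((∑' k : ℕ, quarterSign (k * p.c / p.n) * cos (π * (k * ω) / 2) * β ^ k : ℝ) : ℂ) =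
      (∑' k, s k * x1 ^ k) + ∑' k, s k * x2 ^ k := by
    rw [← (hsum x1 hx1n).tsum_add (hsum x2 hx2n), Complex.ofReal_tsum, ← tsum_mul_left]
    refine tsum_congr fun k => ?_
    have hcos : 2 * ((cos (π * (k * ω) / 2) : ℝ) : ℂ) = α ^ k + α⁻¹ ^ k := by
      rw [Complex.ofReal_cos, Complex.two_cos, hα, ← Complex.exp_neg, ← Complex.exp_nat_mul,
        ← Complex.exp_nat_mul]
      congr 2 <;> (push_cast; ring)
    simp only [hsdef, hx1, hx2, mul_pow]
    push_cast
    push_cast at hcos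
    linear_combination (quarterSign (k * p.c / p.n) : ℂ) * (β : ℂ) ^ k * hcos
  have hy := p.tsum_sub_tsum_eq hω hβ
  set y : ℝ := ∑' x, p.term β x with hydef
  set g : ℝ := ∑' k : ℕ, max (cos (π * (k * ω) / 2)) 0 * β ^ k with hg
  set D : ℂ := (1 - x1 ^ (4 * p.n)) * (1 - x2 ^ (4 * p.n)) with hD
  have hform : D * (2 * Complex.I * y) = Complex.I *
      (2 * g * D - (A1 * (1 - x2 ^ (4 * p.n)) + A2 * (1 - x1 ^ (4 * p.n)))) := by
    rw [← hA1, ← hA2, ← hy]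
    push_cast
    push_cast at hR
    rw [hD]
    linear_combination (-Complex.I * D) * hR
  have hx1S : SizeLE φ q 2 (H ^ 2) x1 := by
    rw [sq]
    exact h1.mul h3
  have hx2S : SizeLE φ q 2 (H ^ 2) x2 := by
    rw [sq]
    exact h2.mul h3
  have hpow : ∀ x, SizeLE φ q 2 (H ^ 2) x → ∀ k ≤ 4 * p.n,
      SizeLE φ q (8 * p.n) (H ^ (8 * p.n)) (x ^ k) := by
    intro x hx k hk
    refine (hx.pow k).mono (by omega) ?_
    rw [← pow_mul]
    exact pow_le_pow_right₀ hH (by omega)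
  have hone : ∀ e, ∀ B : ℝ, 1 ≤ B → SizeLE φ q e B 1 := fun e B hB =>
    SizeLE.one.mono (Nat.zero_le _) hB
  have hHp : ∀ k, (1 : ℝ) ≤ H ^ k := fun k => one_le_pow₀ hH
  have hB : ∀ x, SizeLE φ q 2 (H ^ 2) x →
      SizeLE φ q (8 * p.n) (2 * H ^ (8 * p.n)) (1 - x ^ (4 * p.n)) := by
    intro x hx
    rw [two_mul]
    exact (hone _ _ (hHp _)).sub (hpow x hx _ le_rfl)
  have hA : ∀ x, SizeLE φ q 2 (H ^ 2) x → SizeLE φ q (8 * p.n) ((4 * p.n : ℕ) * H ^ (8 * p.n))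
      (∑ k ∈ Finset.range (4 * p.n), s k * x ^ k) := by
    intro x hx
    have := SizeLE.sum (φ := φ) (q := q) (e := 8 * p.n) (Finset.range (4 * p.n))
      (f := fun k => s k * x ^ k) (g := fun _ => H ^ (8 * p.n)) (by
        intro k hk
        have hk' := hpow x hx k (Finset.mem_range.mp hk).le
        rcases hs01 k with h | h
        · rw [h, zero_mul]
          simpa using (SizeLE.intCast (φ := φ) (q := q) 0).mono (Nat.zero_le (8 * p.n))
            (by simpa using zero_le_one.trans (hHp (8 * p.n)))
        · rwa [h, one_mul])
    simpa using this
  have hDS : SizeLE φ q (16 * p.n) (4 * H ^ (16 * p.n)) D := by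
    refine ((hB x1 hx1S).mul (hB x2 hx2S)).mono (by omega) (le_of_eq ?_)
    rw [show 16 * p.n = 8 * p.n + 8 * p.n by ring, pow_add]
    ring
  have hn2 : (p.n : ℝ) ≤ 2 ^ p.n := by exact_mod_cast Nat.lt_two_pow_self.le
  have h64 : (1 : ℝ) ≤ 64 ^ p.n := one_le_pow₀ (by norm_num)
  have hsplit : (64 * H) ^ (18 * p.n) = 64 ^ p.n * 64 ^ (17 * p.n) * H ^ (18 * p.n) := by
    rw [mul_pow, ← pow_add]
    congr 2
    ring
  have h6417 : (64 : ℝ) ≤ 64 ^ (17 * p.n) :=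
    le_self_pow₀ (by norm_num) (by omega)
  refine ⟨D, ?_, ?_, ?_, ?_⟩
  · exact mul_ne_zero (one_sub_pow_ne_zero hx1n (by omega)) (one_sub_pow_ne_zero hx2n (by omega))
  · rw [hD, norm_mul]
    have e1 := norm_one_sub_pow_le hx1n (4 * p.n)
    have e2 := norm_one_sub_pow_le hx2n (4 * p.n)
    nlinarith [norm_nonneg (1 - x1 ^ (4 * p.n)), norm_nonneg (1 - x2 ^ (4 * p.n))]
  · refine hDS.mono (by omega) ?_
    rw [hsplit]
    have e1 : H ^ (16 * p.n) ≤ H ^ (18 * p.n) := pow_le_pow_right₀ hH (by omega)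
    have e2 : (4 : ℝ) ≤ 64 ^ p.n * 64 ^ (17 * p.n) := by nlinarith
    exact mul_le_mul e2 e1 (by positivity) (by positivity)
  · rw [hform]
    have t1 : SizeLE φ q (16 * p.n + 1) (2 * H * (4 * H ^ (16 * p.n))) (2 * g * D) := by
      have h2' : SizeLE φ q 0 2 (2 : ℂ) := by
        simpa using SizeLE.intCast (φ := φ) (q := q) 2
      exact ((h2'.mul h4).mul hDS).mono (by omega) le_rfl
    have t2 : SizeLE φ q (16 * p.n + 1) ((4 * p.n : ℕ) * H ^ (8 * p.n) * (2 * H ^ (8 * p.n)) +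
        (4 * p.n : ℕ) * H ^ (8 * p.n) * (2 * H ^ (8 * p.n)))
        (A1 * (1 - x2 ^ (4 * p.n)) + A2 * (1 - x1 ^ (4 * p.n))) :=
      (((hA x1 hx1S).mul (hB x2 hx2S)).add ((hA x2 hx2S).mul (hB x1 hx1S))).mono
        (by omega) le_rfl
    refine (h5.mul (t1.sub t2)).mono (by omega) ?_
    have e16 : H ^ (8 * p.n) * H ^ (8 * p.n) = H ^ (16 * p.n) := by
      rw [← pow_add]
      congr 1
      ring
    have e18 : H ^ 2 * H ^ (16 * p.n) ≤ H ^ (18 * p.n) := by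
      rw [← pow_add]
      exact pow_le_pow_right₀ hH (by omega)
    have hH16 := hHp (16 * p.n)
    have hn1 : (1 : ℝ) ≤ p.n := by exact_mod_cast hn
    have hn64 : (p.n : ℝ) ≤ 64 ^ p.n :=
      hn2.trans (pow_le_pow_left₀ (by norm_num) (by norm_num) _)
    have hHH : H ≤ H ^ 2 := le_self_pow₀ hH (by norm_num)
    rw [hsplit]
    push_cast
    calc H * (2 * H * (4 * H ^ (16 * p.n)) +
          (4 * (p.n : ℝ) * H ^ (8 * p.n) * (2 * H ^ (8 * p.n)) +
            4 * (p.n : ℝ) * H ^ (8 * p.n) * (2 * H ^ (8 * p.n))))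
        = 8 * (H ^ 2 * H ^ (16 * p.n)) + 16 * (p.n : ℝ) * (H * H ^ (16 * p.n)) := by
          rw [← e16]; ring
      _ ≤ 8 * (p.n : ℝ) * (H ^ 2 * H ^ (16 * p.n)) + 16 * (p.n : ℝ) * (H ^ 2 * H ^ (16 * p.n)) := by
          gcongr
          linarith
      _ = 24 * (p.n : ℝ) * (H ^ 2 * H ^ (16 * p.n)) := by ring
      _ ≤ 24 * 64 ^ p.n * H ^ (18 * p.n) := by gcongr
      _ ≤ 64 ^ p.n * 64 ^ (17 * p.n) * H ^ (18 * p.n) := by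
          rw [mul_comm 24]
          gcongr
          linarith

theorem abs_tsum_le_of_support {g : ℕ × ℕ → ℝ} {q r : ℝ} (hq0 : 0 ≤ q) (hq : q < 1)
    (hr0 : 0 ≤ r) (hr : r < 1) {A B : ℕ} (hg : ∀ x, |g x| ≤ q ^ x.1 * r ^ x.2)
    (hs : ∀ x, g x ≠ 0 → A ≤ x.1 ∧ B ≤ x.2) :
    |∑' x, g x| ≤ q ^ A * r ^ B * ((1 - q)⁻¹ * (1 - r)⁻¹) := by
  have hinj : Function.Injective fun x : ℕ × ℕ => (x.1 + A, x.2 + B) := by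
    rintro ⟨i, j⟩ ⟨i', j'⟩ h
    simpa using h
  have hsupp : Function.support g ⊆ Set.range fun x : ℕ × ℕ => (x.1 + A, x.2 + B) := by
    rintro ⟨i, j⟩ h
    obtain ⟨h1, h2⟩ := hs _ h
    exact ⟨(i - A, j - B), by simp [Nat.sub_add_cancel h1, Nat.sub_add_cancel h2]⟩
  rw [← hinj.tsum_eq hsupp, ← Real.norm_eq_abs]
  have hgeo : HasSum (fun x : ℕ × ℕ => q ^ x.1 * r ^ x.2) ((1 - q)⁻¹ * (1 - r)⁻¹) := by
    have h1 := hasSum_geometric_of_lt_one hq0 hq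
    have h2 := hasSum_geometric_of_lt_one hr0 hr
    exact h1.mul h2 (h1.summable.mul_of_nonneg h2.summable (fun _ => by positivity)
      (fun _ => by positivity))
  refine tsum_of_norm_bounded (hgeo.mul_left (q ^ A * r ^ B)) fun x => ?_
  refine (hg _).trans (le_of_eq ?_)
  rw [pow_add, pow_add]
  ring

namespace FareyPair

variable {ω : ℝ} (p : FareyPair ω)

/-- The least `i` for which the vector `i • (n, c) + (m, d)` has positive defect. -/
noncomputable def idx : ℕ := ⌊p.slope⌋₊ + 1

theorem slope_lt_idx : p.slope < p.idx := by
  simpa [idx] using Nat.lt_floor_add_one p.slope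

theorem idx_le_slope_add_one : (p.idx : ℝ) ≤ p.slope + 1 := by
  simpa [idx] using Nat.floor_le p.slope_pos.le

theorem one_le_idx : 1 ≤ p.idx := by simp [idx]

theorem hi_lt_idx_mul_lo : p.hi < p.idx * p.lo := by
  rw [← p.slope_mul_lo]
  exact mul_lt_mul_of_pos_right p.slope_lt_idx p.lo_pos

theorem idx_mul_lo_le : p.idx * p.lo ≤ p.hi + p.lo := by
  rw [← p.slope_mul_lo, ← add_one_mul]
  exact mul_le_mul_of_nonneg_right p.idx_le_slope_add_one p.lo_pos.le

theorem term_ne_zero {β : ℝ} {x : ℕ × ℕ} (h : p.term β x ≠ 0) :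
    1 ≤ x.2 ∧ (x.2 : ℝ) * p.slope < x.1 ∧ Odd (x.1 * p.c + x.2 * p.d) := by
  by_contra h'
  apply h
  simp [term, pattern, h']

theorem pow_n_le {β : ℝ} (hβ : |β| < 1) : |β| ^ p.n ≤ |β| :=
  pow_le_of_le_one (abs_nonneg _) hβ.le p.n_pos.ne'

theorem pow_m_le {β : ℝ} (hβ : |β| < 1) : |β| ^ p.m ≤ |β| :=
  pow_le_of_le_one (abs_nonneg _) hβ.le p.m_pos.ne'

theorem inv_mul_inv_le {β : ℝ} (hβ : |β| < 1) :
    (1 - |β| ^ p.n)⁻¹ * (1 - |β| ^ p.m)⁻¹ ≤ (1 - |β|)⁻¹ * (1 - |β|)⁻¹ := by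
  have h1 := p.pow_n_le hβ
  have h2 := p.pow_m_le hβ
  have h3 : 0 < 1 - |β| := by linarith
  refine mul_le_mul (inv_anti₀ h3 (by linarith)) (inv_anti₀ h3 (by linarith))
    (inv_nonneg.mpr (by linarith)) (inv_nonneg.mpr h3.le)

theorem abs_tsum_term_le {β : ℝ} (hβ : |β| < 1) {M : ℕ} (hM : (M : ℝ) ≤ p.slope) :
    |∑' x, p.term β x| ≤ (|β| ^ p.n) ^ M * ((1 - |β|)⁻¹ * (1 - |β|)⁻¹) := by
  have hq : |β| ^ p.n < 1 := (p.pow_n_le hβ).trans_lt hβ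
  have hr : |β| ^ p.m < 1 := (p.pow_m_le hβ).trans_lt hβ
  refine (abs_tsum_le_of_support (A := M) (B := 0) (by positivity) hq (by positivity) hr
    (p.abs_term_le β) fun x hx => ⟨?_, Nat.zero_le _⟩).trans ?_
  · obtain ⟨h1, h2, -⟩ := p.term_ne_zero hx
    have h1' : (1 : ℝ) ≤ x.2 := by exact_mod_cast h1
    have : (M : ℝ) ≤ x.1 := by nlinarith [p.slope_pos]
    exact_mod_cast this
  · rw [pow_zero, mul_one]
    exact mul_le_mul_of_nonneg_left (p.inv_mul_inv_le hβ) (by positivity)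

theorem abs_tsum_term_sub_le {β : ℝ} (hβ : |β| < 1) :
    |∑' x, p.term β x - ∑ i ∈ Finset.range (2 * p.idx - 1), p.term β (i, 1)| ≤
      (|β| ^ p.n) ^ (2 * p.idx - 1) * |β| ^ p.m * ((1 - |β|)⁻¹ * (1 - |β|)⁻¹) := by
  classical
  have hq : |β| ^ p.n < 1 := (p.pow_n_le hβ).trans_lt hβ
  have hr : |β| ^ p.m < 1 := (p.pow_m_le hβ).trans_lt hβ
  set F : Finset (ℕ × ℕ) := Finset.range (2 * p.idx - 1) ×ˢ {1} with hF
  have hfin : ∑ i ∈ Finset.range (2 * p.idx - 1), p.term β (i, 1) =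
      ∑' x, if x ∈ F then p.term β x else 0 := by
    rw [tsum_eq_sum (s := F) (by
      intro x hx
      simp [hx])]
    rw [Finset.sum_congr rfl (fun x hx => if_pos hx), hF, Finset.sum_product]
    simp
  have hs : Summable fun x => if x ∈ F then p.term β x else 0 := by
    refine summable_of_ne_finset_zero (s := F) ?_
    intro x hx
    simp [hx]
  rw [hfin, ← (p.summable_term hβ).tsum_sub hs]
  refine (abs_tsum_le_of_support (q := |β| ^ p.n) (r := |β| ^ p.m) (A := 2 * p.idx - 1) (B := 1)
    (by positivity) hq (by positivity) hr (fun x => ?_) fun x hx => ?_).trans ?_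
  · split_ifs with h
    · rw [sub_self, abs_zero]
      positivity
    · rw [sub_zero]
      exact p.abs_term_le β x
  · split_ifs at hx with h
    · simp at hx
    · rw [sub_zero] at hx
      obtain ⟨h1, h2, -⟩ := p.term_ne_zero hx
      refine ⟨?_, h1⟩
      by_contra! hlt
      apply h
      rw [hF, Finset.mem_product, Finset.mem_range, Finset.mem_singleton]
      refine ⟨hlt, ?_⟩
      by_contra h3
      have h4 : (2 : ℝ) ≤ x.2 := by
        have : 2 ≤ x.2 := by omega
        exact_mod_cast this
      have h5 : (x.1 : ℝ) + 2 ≤ 2 * p.idx := by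
        have : x.1 + 2 ≤ 2 * p.idx := by omega
        exact_mod_cast this
      have := p.idx_le_slope_add_one
      nlinarith [p.slope_pos]
  · rw [pow_one]
    exact mul_le_mul_of_nonneg_left (p.inv_mul_inv_le hβ) (by positivity)

theorem pattern_one (i : ℕ) (hi : p.idx ≤ i) (ho : Odd (i * p.c + p.d)) : p.pattern i 1 = 1 := by
  have h2 : p.slope < i := p.slope_lt_idx.trans_le (by exact_mod_cast hi)
  simp [pattern, h2, ho]

theorem pattern_one_eq_zero (i : ℕ) (hi : i < p.idx) : p.pattern i 1 = 0 := by
  have h3 : (i : ℝ) + 1 ≤ p.idx := by exact_mod_cast hi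
  have h2 : ¬ p.slope < i := by
    have := p.idx_le_slope_add_one
    linarith
  simp [pattern, h2]

theorem tsum_term_ne_zero_of_odd {β : ℝ} (hβ0 : β ≠ 0) (hβ : |β| < 1) (hc : Odd p.c)
    (hidx : 4 ≤ p.idx) (hlo : p.lo ≤ 1 / 2) (hhi : p.hi ≤ 1)
    (hbig : (1 - |β|)⁻¹ * (1 - |β|)⁻¹ * (|β| ^ p.n) ^ (p.idx - 3) < p.lo) :
    ∑' x, p.term β x ≠ 0 := by
  intro h0
  have herr := p.abs_tsum_term_sub_le hβ
  rw [h0, zero_sub, abs_neg] at herr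
  obtain ⟨ε, hε, hβε⟩ : ∃ ε : ℝ, (ε = 1 ∨ ε = -1) ∧ β = ε * |β| := by
    rcases lt_or_gt_of_ne hβ0 with h | h
    · exact ⟨-1, Or.inr rfl, by rw [abs_of_neg h]; ring⟩
    · exact ⟨1, Or.inl rfl, by rw [abs_of_pos h]; ring⟩
  have hε2 : ε ^ 2 = 1 := by rcases hε with h | h <;> rw [h] <;> norm_num
  have hβpos : 0 < |β| := abs_pos.mpr hβ0
  set s : ℝ := ε ^ ((p.d + 1) * p.n + p.m) with hs
  have hss : |s| = 1 := by
    rw [hs, abs_pow]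
    rcases hε with h | h <;> rw [h] <;> simp
  have hsign : ∀ i, Odd (i * p.c + p.d) → s * β ^ (i * p.n + 1 * p.m) =
      (|β| ^ p.n) ^ i * |β| ^ p.m := by
    intro i hi
    have hev : Even (((p.d + 1) * p.n + p.m) + (i * p.n + 1 * p.m)) := by
      have h1 : Even (p.d + 1 + i) := by
        rw [Nat.odd_add, Nat.odd_mul] at hi
        rcases Nat.even_or_odd i with h | h
        · have := hi.not.mp (by simp [h])
          rw [Nat.not_even_iff_odd] at this
          exact this.add_one.add h
        · have := hi.mp ⟨h, hc⟩
          exact (this.add_one).add_odd h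
      rw [show ((p.d + 1) * p.n + p.m) + (i * p.n + 1 * p.m) =
        (p.d + 1 + i) * p.n + 2 * p.m by ring]
      exact (h1.mul_right _).add (even_two_mul _)
    obtain ⟨t, ht⟩ := hev
    conv_lhs => rw [hβε]
    rw [mul_pow, hs, ← mul_assoc, ← pow_add, ht, ← two_mul, pow_mul, hε2, one_pow, one_mul,
      one_mul, pow_add, ← pow_mul, mul_comm i]
  have hpi := Real.pi_pos
  have hpi4 := Real.pi_le_four
  have hpi3 := Real.pi_gt_three
  have hlop := p.lo_pos
  have hidx1 := p.hi_lt_idx_mul_lo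
  have hidx2 := p.idx_mul_lo_le
  have hnonneg : ∀ i ∈ Finset.range (2 * p.idx - 1), 0 ≤ s * p.term β (i, 1) := by
    intro i hi
    rw [Finset.mem_range] at hi
    by_cases ht : p.term β (i, 1) = 0
    · rw [ht, mul_zero]
    obtain ⟨-, h2, h3⟩ := p.term_ne_zero ht
    simp only [Nat.cast_one, one_mul] at h2 h3
    have h4 : p.idx ≤ i := by
      by_contra! hlt
      apply ht
      simp [term, p.pattern_one_eq_zero i hlt]
    simp only [term, p.pattern_one i h4 h3, one_mul]
    rw [mul_left_comm]
    have := hsign i h3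
    rw [one_mul] at this
    rw [this]
    have hi1 : (i : ℝ) * p.lo ≤ (2 * p.idx - 1) * p.lo := by
      have : (i : ℝ) + 1 ≤ 2 * p.idx := by
        have : i + 1 ≤ 2 * p.idx := by omega
        exact_mod_cast this
      nlinarith
    have hi2 : (p.idx : ℝ) * p.lo ≤ i * p.lo := by
      have : (p.idx : ℝ) ≤ i := by exact_mod_cast h4
      nlinarith
    refine mul_nonneg (Real.sin_nonneg_of_nonneg_of_le_pi ?_ ?_) (by positivity)
    · push_cast
      have : 0 ≤ i * p.lo - 1 * p.hi := by linarith
      positivity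
    · push_cast
      have : i * p.lo - 1 * p.hi ≤ 2 := by linarith
      nlinarith
  obtain ⟨i, hi1, hi2, ho⟩ : ∃ i, p.idx + 1 ≤ i ∧ i ≤ p.idx + 2 ∧ Odd (i * p.c + p.d) := by
    rcases Nat.even_or_odd ((p.idx + 1) * p.c + p.d) with h | h
    · refine ⟨p.idx + 2, by omega, le_rfl, ?_⟩
      rw [show (p.idx + 2) * p.c + p.d = ((p.idx + 1) * p.c + p.d) + p.c by ring]
      exact h.add_odd hc
    · exact ⟨p.idx + 1, le_rfl, by omega, h⟩
  have hmain : p.lo * ((|β| ^ p.n) ^ (p.idx + 2) * |β| ^ p.m) ≤ s * p.term β (i, 1) := by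
    simp only [term, p.pattern_one i (by omega) ho, one_mul]
    rw [mul_left_comm s]
    have := hsign i ho
    rw [one_mul] at this
    rw [this]
    have hi1' : (p.idx : ℝ) + 1 ≤ i := by exact_mod_cast hi1
    have hi2' : (i : ℝ) ≤ p.idx + 2 := by exact_mod_cast hi2
    have a1 : p.lo ≤ i * p.lo - (1 : ℕ) * p.hi := by push_cast; nlinarith
    have a2 : i * p.lo - (1 : ℕ) * p.hi ≤ 3 * p.lo := by push_cast; nlinarith
    set a : ℝ := i * p.lo - (1 : ℕ) * p.hi with ha
    have hsin : p.lo ≤ sin (π / 2 * a) := by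
      rcases le_total a 1 with h1 | h1
      · have := Real.mul_le_sin (x := π / 2 * a)
          (mul_nonneg (by positivity) (hlop.le.trans a1)) (by nlinarith)
        refine a1.trans (le_trans (le_of_eq ?_) this)
        field_simp
      · rw [← Real.sin_pi_sub]
        have := Real.mul_le_sin (x := π - π / 2 * a) (by nlinarith) (by nlinarith)
        refine le_trans (le_trans ?_ (le_of_eq (?_ : 2 - a = 2 / π * (π - π / 2 * a)))) this
        · linarith
        · field_simp
    refine mul_le_mul hsin ?_ (by positivity) (hlop.le.trans hsin)
    refine mul_le_mul_of_nonneg_right ?_ (by positivity)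
    exact pow_le_pow_of_le_one (by positivity) ((p.pow_n_le hβ).trans hβ.le) hi2
  have hsum : s * p.term β (i, 1) ≤
      s * ∑ i ∈ Finset.range (2 * p.idx - 1), p.term β (i, 1) := by
    rw [Finset.mul_sum]
    exact Finset.single_le_sum hnonneg (Finset.mem_range.mpr (by omega))
  have habs : s * ∑ i ∈ Finset.range (2 * p.idx - 1), p.term β (i, 1) ≤
      |∑ i ∈ Finset.range (2 * p.idx - 1), p.term β (i, 1)| := by
    refine (le_abs_self _).trans ?_
    rw [abs_mul, hss, one_mul]
  have hfin := (hmain.trans hsum).trans (habs.trans herr)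
  rw [show 2 * p.idx - 1 = (p.idx - 3) + (p.idx + 2) by omega,
    pow_add _ (p.idx - 3) (p.idx + 2)] at hfin
  have hpos : 0 < (|β| ^ p.n) ^ (p.idx + 2) * |β| ^ p.m := by positivity
  have : p.lo * ((|β| ^ p.n) ^ (p.idx + 2) * |β| ^ p.m) ≤
      (1 - |β|)⁻¹ * (1 - |β|)⁻¹ * (|β| ^ p.n) ^ (p.idx - 3) *
        ((|β| ^ p.n) ^ (p.idx + 2) * |β| ^ p.m) := by
    refine hfin.trans (le_of_eq ?_)
    ring
  exact absurd (le_of_mul_le_mul_right this hpos) (not_le.mpr hbig)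

end FareyPair

/-- Every coprime vector with small defect is the lower vector of a Farey pair. -/
theorem exists_fareyPair {ω : ℝ} {n c : ℕ} (hn : 0 < n) (hcop : IsCoprime (n : ℤ) c)
    (h0 : 0 < n * ω - c) (h1 : n * (n * ω - c) < 1) :
    ∃ p : FareyPair ω, p.n = n ∧ p.c = c ∧ p.m ≤ n := by
  obtain ⟨a, b, hab⟩ := hcop
  have hn' : (0 : ℤ) < n := by exact_mod_cast hn
  set m : ℤ := (-b - 1) % n + 1 with hm
  have hm1 : 1 ≤ m := by
    have := Int.emod_nonneg (-b - 1) hn'.ne'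
    omega
  have hm2 : m ≤ n := by
    have := Int.emod_lt_of_pos (-b - 1) hn'
    omega
  have hdvd : (n : ℤ) ∣ m * c + 1 := by
    have h2 : (-b - 1) % n = (-b - 1) - n * ((-b - 1) / n) := by
      have := Int.emod_add_mul_ediv (-b - 1) n
      linarith
    refine ⟨a - ((-b - 1) / n) * c, ?_⟩
    rw [hm, h2]
    linear_combination -hab
  obtain ⟨d, hd⟩ := hdvd
  have hd0 : 0 ≤ d := by
    by_contra! hlt
    have : (0 : ℤ) ≤ m * c := by positivity
    nlinarith
  clear_value m
  lift m to ℕ using by omega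
  lift d to ℕ using hd0
  have hdet : n * d = m * c + 1 := by exact_mod_cast hd.symm
  refine ⟨⟨n, c, m, d, hn, by omega, hdet, by linarith, ?_⟩, rfl, rfl, by exact_mod_cast hm2⟩
  have hdet' : (n : ℝ) * d = m * c + 1 := by exact_mod_cast hdet
  have hn0 : (0 : ℝ) < n := by exact_mod_cast hn
  have hmn : (m : ℝ) ≤ n := by exact_mod_cast hm2
  have h3 : (m : ℝ) * (n * ω - c) < 1 := lt_of_le_of_lt (mul_le_mul_of_nonneg_right hmn h0.le) h1
  have : 0 < (n : ℝ) * (d - m * ω) := by nlinarith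
  have := pos_of_mul_pos_right this hn0.le
  linarith

namespace FareyPair

variable {ω : ℝ} (p : FareyPair ω)

theorem isCoprime_idx : IsCoprime ((p.idx * p.n + p.m : ℕ) : ℤ) (p.idx * p.c + p.d : ℕ) := by
  refine ⟨-p.c, p.n, ?_⟩
  have hd := p.det
  zify at hd
  push_cast
  linear_combination hd

theorem idx_defect_le_of_tsum_eq_zero {β C : ℝ} (hβ0 : β ≠ 0) (hβ : |β| < 1)
    (hC : ∀ T : ℕ, ∑ t ∈ Finset.range T, ((t : ℝ) + 2) * |β| ^ t ≤ C) (hc : Even p.c)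
    (hidx : 4 ≤ p.idx) (hlo : p.lo ≤ 1 / 2) (h0 : ∑' x, p.term β x = 0) :
    p.idx * p.lo - p.hi ≤ 2 * C * (|β| ^ p.n * p.lo) +
      (1 - |β|)⁻¹ * (1 - |β|)⁻¹ * (|β| ^ p.n) ^ (p.idx - 1) := by
  have herr := p.abs_tsum_term_sub_le hβ
  rw [h0, zero_sub, abs_neg] at herr
  have hd : Odd p.d := by
    have h1 : Odd (p.n * p.d) := by
      rw [p.det]
      exact (hc.mul_left _).add_one
    exact (Nat.odd_mul.mp h1).2
  have hodd : ∀ i, Odd (i * p.c + p.d) := fun i => (hc.mul_left i).add_odd hd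
  have hβpos : 0 < |β| := abs_pos.mpr hβ0
  have hq0 : 0 < |β| ^ p.n := by positivity
  have hqβ := p.pow_n_le hβ
  set q : ℝ := |β| ^ p.n with hq
  set r : ℝ := |β| ^ p.m with hr
  set B : ℝ := (1 - |β|)⁻¹ * (1 - |β|)⁻¹ with hB
  have hpi := Real.pi_pos
  have hpi4 := Real.pi_le_four
  have hlop := p.lo_pos
  have hidx1 := p.hi_lt_idx_mul_lo
  have hidx2 := p.idx_mul_lo_le
  rw [show 2 * p.idx - 1 = p.idx + ((p.idx - 2) + 1) by omega, Finset.sum_range_add,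
    Finset.sum_eq_zero (s := Finset.range p.idx), zero_add, Finset.sum_range_succ', add_zero] at herr
  swap
  · intro i hi
    simp [term, p.pattern_one_eq_zero i (Finset.mem_range.mp hi)]
  have habs : ∀ i, |β ^ (i * p.n + 1 * p.m)| = q ^ i * r := by
    intro i
    rw [abs_pow, pow_add, one_mul, mul_comm i, pow_mul]
  have hrest : |∑ t ∈ Finset.range (p.idx - 2), p.term β (p.idx + (t + 1), 1)| ≤
      2 * C * (q * p.lo) * (q ^ p.idx * r) := by
    refine (Finset.abs_sum_le_sum_abs _ _).trans ?_
    have hstep : ∀ t ∈ Finset.range (p.idx - 2), |p.term β (p.idx + (t + 1), 1)| ≤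
        (((t : ℝ) + 2) * |β| ^ t) * (2 * (q * p.lo) * (q ^ p.idx * r)) := by
      intro t _
      simp only [term, p.pattern_one _ (show p.idx ≤ p.idx + (t + 1) by omega) (hodd _), one_mul]
      rw [abs_mul]
      have := habs (p.idx + (t + 1))
      rw [one_mul] at this
      rw [this]
      push_cast
      have hang0 : 0 ≤ π / 2 * ((p.idx + (t + 1)) * p.lo - 1 * p.hi) := by
        have : 0 ≤ (p.idx + ((t : ℝ) + 1)) * p.lo - 1 * p.hi := by nlinarith
        positivity
      have hang : |sin (π / 2 * ((p.idx + (t + 1)) * p.lo - 1 * p.hi))| ≤ 2 * ((t + 2) * p.lo) := by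
        refine (Real.abs_sin_le_abs).trans ?_
        rw [abs_of_nonneg hang0]
        have e1 : (p.idx + ((t : ℝ) + 1)) * p.lo - 1 * p.hi ≤ (t + 2) * p.lo := by nlinarith
        have e2 : 0 ≤ ((t : ℝ) + 2) * p.lo := by positivity
        calc π / 2 * ((p.idx + ((t : ℝ) + 1)) * p.lo - 1 * p.hi) ≤ π / 2 * ((t + 2) * p.lo) := by
              gcongr
          _ ≤ 2 * ((t + 2) * p.lo) := by nlinarith
      calc |sin (π / 2 * ((p.idx + (t + 1)) * p.lo - 1 * p.hi))| * (q ^ (p.idx + (t + 1)) * r)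
          ≤ 2 * ((t + 2) * p.lo) * (q ^ (p.idx + (t + 1)) * r) := by gcongr
        _ = q ^ t * (((t : ℝ) + 2) * (2 * (q * p.lo) * (q ^ p.idx * r))) := by
            rw [pow_add, pow_add, pow_one]
            ring
        _ ≤ |β| ^ t * (((t : ℝ) + 2) * (2 * (q * p.lo) * (q ^ p.idx * r))) := by gcongr
        _ = _ := by ring
    refine (Finset.sum_le_sum hstep).trans ?_
    rw [← Finset.sum_mul]
    have := mul_le_mul_of_nonneg_right (hC (p.idx - 2))
      (show 0 ≤ 2 * (q * p.lo) * (q ^ p.idx * r) by positivity)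
    linarith
  have hmain : (p.idx * p.lo - p.hi) * (q ^ p.idx * r) ≤ |p.term β (p.idx, 1)| := by
    simp only [term, p.pattern_one _ le_rfl (hodd _), one_mul]
    rw [abs_mul]
    have := habs p.idx
    rw [one_mul] at this
    rw [this]
    push_cast
    have e0 : 0 ≤ p.idx * p.lo - 1 * p.hi := by linarith
    have e1 : p.idx * p.lo - 1 * p.hi ≤ 1 := by linarith
    have := Real.mul_le_sin (x := π / 2 * (p.idx * p.lo - 1 * p.hi))
      (by positivity) (by nlinarith)
    refine mul_le_mul_of_nonneg_right ?_ (by positivity)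
    refine le_trans (le_of_eq ?_) (this.trans (le_abs_self _))
    field_simp
  have hpow : q ^ (p.idx + (p.idx - 2 + 1)) = q ^ (p.idx - 1) * q ^ p.idx := by
    rw [← pow_add]
    congr 1
    omega
  have htri : |p.term β (p.idx, 1)| ≤
      q ^ (p.idx + (p.idx - 2 + 1)) * r * B + 2 * C * (q * p.lo) * (q ^ p.idx * r) := by
    have := abs_sub_abs_le_abs_sub (p.term β (p.idx, 1))
      (-∑ t ∈ Finset.range (p.idx - 2), p.term β (p.idx + (t + 1), 1))
    rw [abs_neg, sub_neg_eq_add, add_comm (p.term β (p.idx, 1))] at this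
    linarith
  have hpos : 0 < q ^ p.idx * r := by positivity
  refine le_of_mul_le_mul_right ?_ hpos
  refine (hmain.trans htri).trans (le_of_eq ?_)
  rw [hpow]
  ring

theorem half_le_n_mul_hi (hmn : p.m ≤ p.n) (h : p.n * p.lo ≤ 1 / 2) : 1 / 2 ≤ p.n * p.hi := by
  have := p.n_mul_hi_add
  have hmn' : (p.m : ℝ) ≤ p.n := by exact_mod_cast hmn
  nlinarith [p.lo_pos]

theorem hi_le_one : p.hi ≤ 1 := by
  have := p.n_mul_hi_add
  have hn : (1 : ℝ) ≤ p.n := by exact_mod_cast p.n_pos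
  have hm : (0 : ℝ) ≤ p.m := by positivity
  nlinarith [p.lo_pos, p.hi_pos]

theorem lo_le_n_mul_lo : p.lo ≤ p.n * p.lo := by
  have hn : (1 : ℝ) ≤ p.n := by exact_mod_cast p.n_pos
  nlinarith [p.lo_pos]

theorem le_slope_of_n_mul_lo_lt {X : ℝ} (hX : 1 ≤ X) (hmn : p.m ≤ p.n)
    (h : p.n * p.lo < 1 / (2 * X)) : X ≤ p.slope := by
  have hX2 : 1 / (2 * X) ≤ 1 / 2 := by
    apply one_div_le_one_div_of_le <;> linarith
  have h1 := p.half_le_n_mul_hi hmn (h.le.trans hX2)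
  have hn : (0 : ℝ) < p.n := by exact_mod_cast p.n_pos
  rw [lt_div_iff₀ (by positivity)] at h
  rw [slope, le_div_iff₀ p.lo_pos]
  nlinarith

theorem idx_mul_n_add_m_le (hmn : p.m ≤ p.n) :
    ((p.idx * p.n + p.m : ℕ) : ℝ) ≤ 2 * (p.n * p.idx : ℕ) := by
  have h1 : p.n ≤ p.n * p.idx := Nat.le_mul_of_pos_right _ p.one_le_idx
  have h2 : p.idx * p.n + p.m ≤ 2 * (p.n * p.idx) := by
    rw [mul_comm p.idx]
    omega
  exact_mod_cast h2

theorem n_mul_idx_mul_lo_le (h : p.n * p.lo ≤ 1 / 2) : ((p.n * p.idx : ℕ) : ℝ) * p.lo ≤ 2 := by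
  have a1 := mul_le_mul_of_nonneg_left p.idx_mul_lo_le (Nat.cast_nonneg (α := ℝ) p.n)
  have a2 := p.n_mul_hi_add
  have a3 : 0 ≤ p.m * p.lo := mul_nonneg (by positivity) p.lo_pos.le
  push_cast
  linarith

end FareyPair

theorem exists_lt_of_defect_lt {ω : ℝ} (hirr : ∀ n : ℕ, 0 < n → ∀ c : ℤ, (n : ℝ) * ω ≠ c) (N : ℕ) :
    ∃ ε > 0, ∀ n c : ℕ, 0 < n → 0 < n * ω - c → n * (n * ω - c) < ε → N ≤ n := by
  induction N with
  | zero => exact ⟨1, one_pos, fun _ _ _ _ _ => Nat.zero_le _⟩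
  | succ N ih =>
    obtain ⟨ε, hε, h⟩ := ih
    rcases Nat.eq_zero_or_pos N with rfl | hN
    · exact ⟨1, one_pos, fun n _ hn _ _ => hn⟩
    have hfr : 0 < Int.fract (N * ω) := by
      rw [Int.fract_pos]
      exact hirr N hN _
    refine ⟨min ε (Int.fract (N * ω)), lt_min hε hfr, fun n c hn h0 h1 => ?_⟩
    have h2 := h n c hn h0 (h1.trans_le (min_le_left _ _))
    rcases h2.lt_or_eq with h3 | rfl
    · exact h3
    exfalso
    have h4 := h1.trans_le (min_le_right _ _)
    have h5 : (c : ℤ) ≤ ⌊(N : ℝ) * ω⌋ := Int.le_floor.mpr (by push_cast; linarith)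
    have h6 : (c : ℝ) ≤ ⌊(N : ℝ) * ω⌋ := by exact_mod_cast h5
    have h7 : (1 : ℝ) ≤ N := by exact_mod_cast hN
    rw [Int.fract] at h4
    nlinarith

theorem exists_coprime_defect {ω ε : ℝ} (hω : 0 < ω) (hε1 : ε ≤ 1)
    {k : ℕ} {l : ℤ} (hk : 0 < k) (h0 : 0 < k * (k * ω - l)) (h1 : k * (k * ω - l) < ε) :
    ∃ n c : ℕ, 0 < n ∧ IsCoprime (n : ℤ) c ∧ 0 < n * ω - c ∧ n * (n * ω - c) < ε := by
  have hk1 : (1 : ℝ) ≤ k := by exact_mod_cast hk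
  have hd0 : 0 < k * ω - l := pos_of_mul_pos_right h0 (by linarith)
  have hl : 0 ≤ l := by
    have : (-1 : ℝ) < l := by nlinarith
    have : (-1 : ℤ) < l := by exact_mod_cast this
    omega
  lift l to ℕ using hl
  rw [Int.cast_natCast] at *
  have hg : 0 < Nat.gcd k l := Nat.gcd_pos_of_pos_left _ hk
  obtain ⟨g, n, c, hg0, hcop, hkn, hlc⟩ := Nat.exists_coprime' (m := k) (n := l) hg
  have hn : 0 < n := by
    rcases Nat.eq_zero_or_pos n with rfl | h
    · omega
    · exact h
  refine ⟨n, c, hn, Nat.isCoprime_iff_coprime.mpr hcop, ?_, ?_⟩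
  · rw [hkn, hlc] at hd0
    push_cast at hd0
    have hgr : (0 : ℝ) < g := by exact_mod_cast hg0
    have : 0 < (g : ℝ) * (n * ω - c) := by linarith
    exact pos_of_mul_pos_right this hgr.le
  · rw [hkn, hlc] at h1 hd0
    push_cast at h1 hd0
    have hgr : (1 : ℝ) ≤ g := by exact_mod_cast hg0
    have hp : 0 < (g : ℝ) * (n * ω - c) := by linarith
    have hp' : 0 < (n * ω - c : ℝ) := pos_of_mul_pos_right hp (by linarith)
    have hn' : (0 : ℝ) < n := by exact_mod_cast hn
    have : 0 < n * (n * ω - c) := by positivity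
    have hg2 : (1 : ℝ) ≤ g * g := by nlinarith
    nlinarith

set_option maxHeartbeats 1000000 in
theorem exists_fareyPair_tsum_ne_zero {ω β : ℝ} (hω : 0 < ω)
    (hirr : ∀ n : ℕ, 0 < n → ∀ c : ℤ, (n : ℝ) * ω ≠ c) (hβ0 : β ≠ 0) (hβ : |β| < 1)
    (happ : ∀ ε > 0, ∃ (k : ℕ) (l : ℤ), 0 < k ∧ 0 < k * (k * ω - l) ∧ k * (k * ω - l) < ε) :
    ∀ ε > 0, ∃ p : FareyPair ω, p.n * p.lo < ε ∧ p.m ≤ p.n ∧ ∑' x, p.term β x ≠ 0 := by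
  intro ε hε
  have hβpos : 0 < |β| := abs_pos.mpr hβ0
  set B : ℝ := (1 - |β|)⁻¹ * (1 - |β|)⁻¹ with hB
  have hB0 : 0 < B := by
    have : 0 < 1 - |β| := by linarith
    positivity
  obtain ⟨γ, hγ0, hγ1, hγ⟩ : ∃ γ : ℝ, 0 < γ ∧ γ < 1 ∧ |β| = γ ^ 4 := by
    refine ⟨|β| ^ (1 / 4 : ℝ), by positivity, Real.rpow_lt_one hβpos.le hβ (by norm_num), ?_⟩
    rw [← Real.rpow_natCast, ← Real.rpow_mul hβpos.le]
    norm_num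
  obtain ⟨C, hC⟩ : ∃ C : ℝ, ∀ T : ℕ, ∑ t ∈ Finset.range T, ((t : ℝ) + 2) * |β| ^ t ≤ C := by
    have h1 : Summable fun t : ℕ => (t : ℝ) * |β| ^ t := by
      simpa using summable_pow_mul_geometric_of_norm_lt_one 1 (r := |β|) (by simpa using hβ)
    have h2 : Summable fun t : ℕ => (2 : ℝ) * |β| ^ t :=
      (summable_geometric_of_lt_one hβpos.le hβ).mul_left 2
    have h3 : Summable fun t : ℕ => ((t : ℝ) + 2) * |β| ^ t :=
      (h1.add h2).congr fun t => by ring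
    exact ⟨_, fun T => h3.sum_le_tsum _ fun _ _ => by positivity⟩
  have hC0 : 0 ≤ C := by simpa using hC 0
  have htend := tendsto_self_mul_const_pow_of_lt_one hγ0.le hγ1
  have hsmall : ∀ η > 0, ∃ X0 : ℕ, 4 ≤ X0 ∧ ∀ X : ℕ, X0 ≤ X → (X : ℝ) * γ ^ X < η := by
    intro η hη
    obtain ⟨X0, h⟩ := eventually_atTop.mp (htend.eventually_lt_const hη)
    exact ⟨max X0 4, le_max_right _ _, fun X hX => h X ((le_max_left _ _).trans hX)⟩
  have hγpow : ∀ n i X : ℕ, X ≤ 4 * (n * i) → (|β| ^ n) ^ i ≤ γ ^ X := by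
    intro n i X h
    rw [hγ, ← pow_mul, ← pow_mul]
    exact pow_le_pow_of_le_one hγ0.le hγ1.le h
  -- pairs with odd `c`
  obtain ⟨ε₁, hε₁, hodd⟩ : ∃ ε₁ > 0, ∀ p : FareyPair ω, p.m ≤ p.n → p.n * p.lo < ε₁ → Odd p.c →
      ∑' x, p.term β x ≠ 0 := by
    obtain ⟨X0, hX4, hX0⟩ := hsmall (1 / (2 * B)) (by positivity)
    have hX4' : (4 : ℝ) ≤ X0 := by exact_mod_cast hX4
    refine ⟨1 / (2 * X0), by positivity, fun p hmn hlt hc => ?_⟩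
    have hle := p.le_slope_of_n_mul_lo_lt (X := X0) (by linarith) hmn hlt
    have h12 : p.n * p.lo ≤ 1 / 2 := by
      refine hlt.le.trans ?_
      apply one_div_le_one_div_of_le <;> linarith
    have hidx : X0 ≤ p.idx := by exact_mod_cast hle.trans p.slope_lt_idx.le
    have hn : (1 : ℝ) ≤ p.n := by exact_mod_cast p.n_pos
    refine p.tsum_term_ne_zero_of_odd hβ0 hβ hc (hX4.trans hidx) (p.lo_le_n_mul_lo.trans h12)
      p.hi_le_one ?_
    have hX : X0 ≤ p.n * p.idx := hidx.trans (Nat.le_mul_of_pos_left _ p.n_pos)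
    have h1 := hX0 _ hX
    have h2 := hγpow p.n (p.idx - 3) (p.n * p.idx) (by
      rw [mul_left_comm]
      exact Nat.mul_le_mul_left _ (by omega))
    have hXpos : (0 : ℝ) < (p.n * p.idx : ℕ) := by
      have : 0 < p.n * p.idx := by omega
      exact_mod_cast this
    have h3 : 1 / 2 < (p.n * p.idx : ℕ) * p.lo := by
      have := p.half_le_n_mul_hi hmn h12
      have := p.hi_lt_idx_mul_lo
      push_cast
      nlinarith
    rw [lt_div_iff₀ (by positivity)] at h1
    refine lt_of_mul_lt_mul_left (lt_of_le_of_lt ?_ h3) hXpos.le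
    calc ((p.n * p.idx : ℕ) : ℝ) * (B * (|β| ^ p.n) ^ (p.idx - 3))
        ≤ ((p.n * p.idx : ℕ) : ℝ) * (B * γ ^ (p.n * p.idx)) := by gcongr
      _ ≤ 1 / 2 := by linarith
  -- pairs with even `c`
  set η : ℝ := min (min ε ε₁) 1 with hη
  have hη0 : 0 < η := lt_min (lt_min hε hε₁) one_pos
  obtain ⟨X0, hX4, hX0⟩ := hsmall (η / (4 * B)) (by positivity)
  have hX4' : (4 : ℝ) ≤ X0 := by exact_mod_cast hX4
  obtain ⟨N0, hN0⟩ : ∃ N0 : ℕ, ∀ n, N0 ≤ n → 8 * C * |β| ^ n < η / 2 := by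
    have : Tendsto (fun n : ℕ => 8 * C * |β| ^ n) atTop (nhds (8 * C * 0)) :=
      (tendsto_pow_atTop_nhds_zero_of_lt_one hβpos.le hβ).const_mul _
    rw [mul_zero] at this
    exact eventually_atTop.mp (this.eventually_lt_const (by positivity))
  obtain ⟨ε₃, hε₃, hlarge⟩ := exists_lt_of_defect_lt hirr N0
  set ε' : ℝ := min (min η ε₃) (1 / (2 * X0)) with hε'
  have hε'0 : 0 < ε' := lt_min (lt_min hη0 hε₃) (by positivity)
  have hε'1 : ε' ≤ 1 := ((min_le_left _ _).trans (min_le_left _ _)).trans (min_le_right _ _)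
  obtain ⟨k, l, hk, hkl0, hkl1⟩ := happ ε' hε'0
  obtain ⟨n, c, hn, hcop, hnc0, hnc1⟩ := exists_coprime_defect hω hε'1 hk hkl0 hkl1
  obtain ⟨p, rfl, rfl, hmn⟩ := exists_fareyPair hn hcop hnc0 (hnc1.trans_le hε'1)
  have hlo : p.n * p.lo < ε' := hnc1
  by_cases hy : ∑' x, p.term β x = 0
  swap
  · exact ⟨p, hlo.trans_le (((min_le_left _ _).trans (min_le_left _ _)).trans
      ((min_le_left _ _).trans (min_le_left _ _))), hmn, hy⟩
  have hceven : Even p.c := by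
    rw [← Nat.not_odd_iff_even]
    intro ho
    exact hodd p hmn (hlo.trans_le (((min_le_left _ _).trans (min_le_left _ _)).trans
      ((min_le_left _ _).trans (min_le_right _ _)))) ho hy
  have hlt : p.n * p.lo < 1 / (2 * X0) := hlo.trans_le (min_le_right _ _)
  have hle := p.le_slope_of_n_mul_lo_lt (X := X0) (by linarith) hmn hlt
  have h12 : p.n * p.lo ≤ 1 / 2 := by
    refine hlt.le.trans ?_
    apply one_div_le_one_div_of_le <;> linarith
  have hidx : X0 ≤ p.idx := by exact_mod_cast hle.trans p.slope_lt_idx.le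
  have hN := hN0 p.n (hlarge p.n p.c p.n_pos hnc0
    (hnc1.trans_le ((min_le_left _ _).trans (min_le_right _ _))))
  have hdef := p.idx_defect_le_of_tsum_eq_zero hβ0 hβ hC hceven (hX4.trans hidx)
    (p.lo_le_n_mul_lo.trans h12) hy
  have hX : X0 ≤ p.n * p.idx := hidx.trans (Nat.le_mul_of_pos_left _ p.n_pos)
  have h1 := hX0 _ hX
  have h2 := hγpow p.n (p.idx - 1) (p.n * p.idx) (by
    rw [mul_left_comm]
    exact Nat.mul_le_mul_left _ (by omega))
  have hn1 : (1 : ℝ) ≤ p.n := by exact_mod_cast p.n_pos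
  have hmn' : (p.m : ℝ) ≤ p.n := by exact_mod_cast hmn
  have hidx1 : (1 : ℝ) ≤ p.idx := by exact_mod_cast p.one_le_idx
  have hv0 : 0 < p.idx * p.lo - p.hi := sub_pos.mpr p.hi_lt_idx_mul_lo
  have hveq : ((p.idx * p.n + p.m : ℕ) : ℝ) * ω - (p.idx * p.c + p.d : ℕ) =
      p.idx * p.lo - p.hi := by
    have := p.lattice_mul_sub p.idx 1
    simpa using this
  have hvsmall : ((p.idx * p.n + p.m : ℕ) : ℝ) * (p.idx * p.lo - p.hi) < η := by
    have e1 := p.idx_mul_n_add_m_le hmn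
    have e2 := p.n_mul_idx_mul_lo_le h12
    rw [lt_div_iff₀ (by positivity)] at h1
    have hq0 : 0 < |β| ^ p.n := by positivity
    calc ((p.idx * p.n + p.m : ℕ) : ℝ) * (p.idx * p.lo - p.hi)
        ≤ 2 * (p.n * p.idx : ℕ) * (2 * C * (|β| ^ p.n * p.lo) + B * (|β| ^ p.n) ^ (p.idx - 1)) := by
          refine mul_le_mul e1 hdef hv0.le (by positivity)
      _ = 4 * C * |β| ^ p.n * ((p.n * p.idx : ℕ) * p.lo) +
          2 * B * ((p.n * p.idx : ℕ) * (|β| ^ p.n) ^ (p.idx - 1)) := by ring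
      _ ≤ 4 * C * |β| ^ p.n * 2 + 2 * B * ((p.n * p.idx : ℕ) * γ ^ (p.n * p.idx)) := by gcongr
      _ < η := by linarith
  obtain ⟨v, hvn, hvc, hvm⟩ := exists_fareyPair (ω := ω) (n := p.idx * p.n + p.m)
    (c := p.idx * p.c + p.d) (Nat.add_pos_right _ p.m_pos) p.isCoprime_idx (by rw [hveq]; exact hv0)
    (by rw [hveq]; exact hvsmall.trans_le (min_le_right _ _))
  have hvlo : v.n * v.lo < η := by
    rw [FareyPair.lo, hvn, hvc, hveq]
    exact hvsmall
  have hvodd : Odd v.c := by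
    rw [hvc]
    have h1 : Odd (p.n * p.d) := by
      rw [p.det]
      exact (hceven.mul_left _).add_one
    exact (hceven.mul_left _).add_odd (Nat.odd_mul.mp h1).2
  refine ⟨v, hvlo.trans_le ((min_le_left _ _).trans (min_le_left _ _)), hvn ▸ hvm, ?_⟩
  exact hodd v (hvn ▸ hvm) (hvlo.trans_le ((min_le_left _ _).trans (min_le_right _ _))) hvodd

theorem FareyPair.one_le_abs_tsum_mul {K : Type*} [Field K] [NumberField K] {φ : K →+* ℂ} {q : ℕ}
    {H : ℝ} (hq : 1 ≤ q) (hH : 1 ≤ H) {ω β : ℝ} (hω : 0 < ω) (hβ : |β| < 1) {α : ℂ}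
    (hα : α = Complex.exp ((π * ω / 2 : ℝ) * Complex.I))
    (h1 : SizeLE φ q 1 H α) (h2 : SizeLE φ q 1 H α⁻¹) (h3 : SizeLE φ q 1 H β)
    (h4 : SizeLE φ q 1 H (∑' k : ℕ, max (cos (π * (k * ω) / 2)) 0 * β ^ k : ℝ))
    (h5 : SizeLE φ q 1 H Complex.I) (p : FareyPair ω) (hy : ∑' x, p.term β x ≠ 0) :
    1 ≤ 8 * |∑' x, p.term β x| * (((q : ℝ) ^ 18) ^ Module.finrank ℚ K *
      ((64 * H) ^ 18) ^ (Module.finrank ℚ K - 1)) ^ p.n := by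
  obtain ⟨D, hD0, hD4, -, hD⟩ := p.exists_denominator hH hω hβ hα h1 h2 h3 h4 h5
  have hne : D * (2 * Complex.I * (∑' x, p.term β x : ℝ)) ≠ 0 := by
    refine mul_ne_zero hD0 (mul_ne_zero (by simp) ?_)
    exact_mod_cast hy
  have h := hD.one_le_norm_mul hq hne
  have hnorm : ‖D * (2 * Complex.I * (∑' x, p.term β x : ℝ))‖ ≤ 8 * |∑' x, p.term β x| := by
    rw [norm_mul, norm_mul, norm_mul, Complex.norm_I, Complex.norm_real, Real.norm_eq_abs,
      Complex.norm_ofNat]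
    nlinarith [abs_nonneg (∑' x, p.term β x)]
  refine h.trans ?_
  have e : ((q : ℝ) ^ (18 * p.n)) ^ Module.finrank ℚ K *
      ((64 * H) ^ (18 * p.n)) ^ (Module.finrank ℚ K - 1) =
      (((q : ℝ) ^ 18) ^ Module.finrank ℚ K *
      ((64 * H) ^ 18) ^ (Module.finrank ℚ K - 1)) ^ p.n := by
    have aux : ∀ (a b : ℝ) (k n f g : ℕ),
        (a ^ (k * n)) ^ f * (b ^ (k * n)) ^ g = ((a ^ k) ^ f * (b ^ k) ^ g) ^ n := by
      intro a b k n f g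
      rw [mul_pow, ← pow_mul, ← pow_mul, ← pow_mul, ← pow_mul, ← pow_mul, ← pow_mul]
      congr 2 <;> ring
    exact aux _ _ _ _ _ _
  rw [e]
  exact mul_le_mul_of_nonneg_right hnorm (by positivity)

/-- The arithmetic data cannot exist if `ω` is well approximable from below. -/
theorem false_of_well_approximable {K : Type*} [Field K] [NumberField K] {φ : K →+* ℂ} {q : ℕ}
    {H : ℝ} (hq : 1 ≤ q) (hH : 1 ≤ H) {ω β : ℝ} (hω : 0 < ω) (hβ0 : β ≠ 0) (hβ : |β| < 1) {α : ℂ}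
    (hα : α = Complex.exp ((π * ω / 2 : ℝ) * Complex.I))
    (h1 : SizeLE φ q 1 H α) (h2 : SizeLE φ q 1 H α⁻¹) (h3 : SizeLE φ q 1 H β)
    (h4 : SizeLE φ q 1 H (∑' k : ℕ, max (cos (π * (k * ω) / 2)) 0 * β ^ k : ℝ))
    (h5 : SizeLE φ q 1 H Complex.I)
    (hirr : ∀ n : ℕ, 0 < n → ∀ c : ℤ, (n : ℝ) * ω ≠ c)
    (happ : ∀ ε > 0, ∃ (k : ℕ) (l : ℤ), 0 < k ∧ 0 < k * (k * ω - l) ∧ k * (k * ω - l) < ε) :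
    False := by
  have hβpos : 0 < |β| := abs_pos.mpr hβ0
  set B : ℝ := (1 - |β|)⁻¹ * (1 - |β|)⁻¹ with hB
  have hB1 : 1 ≤ B := by
    have : 1 ≤ (1 - |β|)⁻¹ := (one_le_inv₀ (by linarith)).mpr (by linarith)
    nlinarith
  set C : ℝ := ((q : ℝ) ^ 18) ^ Module.finrank ℚ K *
    ((64 * H) ^ 18) ^ (Module.finrank ℚ K - 1) with hC
  have hq1 : (1 : ℝ) ≤ q := by exact_mod_cast hq
  have hC1 : 1 ≤ C := one_le_mul_of_one_le_of_one_le (one_le_pow₀ (one_le_pow₀ hq1))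
    (one_le_pow₀ (one_le_pow₀ (by linarith)))
  obtain ⟨M, hM⟩ : ∃ M : ℕ, 8 * B * C * |β| ^ M < 1 := by
    have : Tendsto (fun n : ℕ => 8 * B * C * |β| ^ n) atTop (nhds (8 * B * C * 0)) :=
      (tendsto_pow_atTop_nhds_zero_of_lt_one hβpos.le hβ).const_mul _
    rw [mul_zero] at this
    exact (this.eventually_lt_const one_pos).exists
  obtain ⟨p, hp1, hmn, hy⟩ := exists_fareyPair_tsum_ne_zero hω hirr hβ0 hβ happ
    (1 / (2 * (M + 1))) (by positivity)
  have hslope := p.le_slope_of_n_mul_lo_lt (X := M + 1) (by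
    have : (0 : ℝ) ≤ M := by positivity
    linarith) hmn hp1
  have hup := p.abs_tsum_term_le hβ (M := M) (by linarith)
  have hlow := p.one_le_abs_tsum_mul hq hH hω hβ hα h1 h2 h3 h4 h5 hy
  have hle : 8 * |∑' x, p.term β x| * C ^ p.n ≤ (8 * B * C * |β| ^ M) ^ p.n := by
    have h8 : 8 * B ≤ (8 * B) ^ p.n := le_self_pow₀ (by linarith) p.n_pos.ne'
    calc 8 * |∑' x, p.term β x| * C ^ p.n ≤ 8 * ((|β| ^ p.n) ^ M * B) * C ^ p.n := by gcongr
      _ = (8 * B) * (C ^ p.n * (|β| ^ M) ^ p.n) := by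
          rw [← pow_mul, ← pow_mul, mul_comm p.n]
          ring
      _ ≤ (8 * B) ^ p.n * (C ^ p.n * (|β| ^ M) ^ p.n) := by gcongr
      _ = _ := by rw [mul_pow, mul_pow]; ring
  have hlt : (8 * B * C * |β| ^ M) ^ p.n < 1 :=
    pow_lt_one₀ (by positivity) hM p.n_pos.ne'
  linarith

/-- `ω` is badly approximable. -/
def BadlyApprox (ω c₀ : ℝ) : Prop :=
  0 < c₀ ∧ ∀ (k : ℕ) (l : ℤ), 0 < k → c₀ ≤ k * |k * ω - l|

theorem exists_badlyApprox {ω : ℝ} (hirr : ∀ n : ℕ, 0 < n → ∀ c : ℤ, (n : ℝ) * ω ≠ c) (L : ℤ)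
    (h1 : ¬ ∀ ε > 0, ∃ (k : ℕ) (l : ℤ), 0 < k ∧ 0 < k * (k * ω - l) ∧ k * (k * ω - l) < ε)
    (h2 : ¬ ∀ ε > 0, ∃ (k : ℕ) (l : ℤ), 0 < k ∧ 0 < k * (k * (L - ω) - l) ∧
      k * (k * (L - ω) - l) < ε) : ∃ c₀, BadlyApprox ω c₀ := by
  push Not at h1 h2
  obtain ⟨ε₁, hε₁, h1⟩ := h1
  obtain ⟨ε₂, hε₂, h2⟩ := h2
  refine ⟨min ε₁ ε₂, lt_min hε₁ hε₂, fun k l hk => ?_⟩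
  have hk' : (0 : ℝ) < k := by exact_mod_cast hk
  rcases lt_or_gt_of_ne (sub_ne_zero.mpr (hirr k hk l)) with h | h
  · rw [abs_of_neg h]
    refine (min_le_right _ _).trans ?_
    have e : (k : ℝ) * (L - ω) - (k * L - l : ℤ) = -(k * ω - l) := by
      push_cast
      ring
    have := h2 k (k * L - l) hk (by rw [e]; exact mul_pos hk' (by linarith))
    rwa [e] at this
  · rw [abs_of_pos h]
    exact (min_le_left _ _).trans (h1 k l hk (mul_pos hk' h))

namespace BadlyApprox

variable {ω c₀ : ℝ} (h : BadlyApprox ω c₀) (p : FareyPair ω)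
include h

theorem irrational_like (n : ℕ) (hn : 0 < n) (c : ℤ) : (n : ℝ) * ω ≠ c := by
  intro hc
  have := h.2 n c hn
  rw [hc, sub_self, abs_zero, mul_zero] at this
  exact absurd h.1 (not_lt.mpr this)

theorem le_n_mul_lo : c₀ ≤ p.n * p.lo := by
  have := h.2 p.n p.c p.n_pos
  rw [Int.cast_natCast, abs_of_pos (show 0 < p.n * ω - p.c from p.lo_pos)] at this
  exact this

theorem le_m_mul_hi : c₀ ≤ p.m * p.hi := by
  have := h.2 p.m p.d p.m_pos
  rw [Int.cast_natCast, abs_sub_comm, abs_of_pos (show 0 < (p.d : ℝ) - p.m * ω from p.hi_pos)] at this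
  exact this

theorem le_slope : c₀ ≤ p.slope := by
  have h1 := h.le_m_mul_hi p
  have h2 := p.n_mul_hi_add
  have hn : (0 : ℝ) < p.n := by exact_mod_cast p.n_pos
  have hm : (0 : ℝ) < p.m := by exact_mod_cast p.m_pos
  have h3 : p.m * p.lo ≤ 1 := by nlinarith [p.hi_pos]
  rw [FareyPair.slope, le_div_iff₀ p.lo_pos]
  nlinarith [p.hi_pos, p.lo_pos, mul_le_mul_of_nonneg_right h1 p.lo_pos.le,
    mul_le_mul_of_nonneg_left h3 p.hi_pos.le]

theorem slope_le : p.slope ≤ c₀⁻¹ := by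
  have h1 := h.le_n_mul_lo p
  have h2 := p.n_mul_hi_add
  have hm : (0 : ℝ) < p.m := by exact_mod_cast p.m_pos
  have h3 : p.n * p.hi ≤ 1 := by nlinarith [p.lo_pos]
  rw [FareyPair.slope, div_le_iff₀ p.lo_pos, inv_mul_eq_div, le_div_iff₀ h.1]
  nlinarith [p.hi_pos, p.lo_pos, mul_le_mul_of_nonneg_right h1 p.hi_pos.le,
    mul_le_mul_of_nonneg_left h3 p.lo_pos.le]

theorem exists_start (hω : 0 < ω) : Nonempty (FareyPair ω) := by
  refine ⟨⟨1, ⌊ω⌋₊, 1, ⌊ω⌋₊ + 1, one_pos, one_pos, by ring, ?_, ?_⟩⟩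
  · have h1 := Nat.floor_le hω.le
    rw [Nat.cast_one, one_mul]
    refine lt_of_le_of_ne h1 fun h2 => ?_
    have := h.irrational_like 1 one_pos ⌊ω⌋₊
    simp only [Nat.cast_one, one_mul, Int.cast_natCast] at this
    exact this h2.symm
  · have := Nat.lt_floor_add_one ω
    push_cast
    linarith

end BadlyApprox

/-- The slow continued fraction map. -/
noncomputable def slowMap (x : ℝ) : ℝ := if x < 1 then x / (1 - x) else x - 1

theorem BadlyApprox.exists_next {ω c₀ : ℝ} (h : BadlyApprox ω c₀) (p : FareyPair ω) :
    ∃ p' : FareyPair ω, p.n + p.m < p'.n + p'.m ∧ p'.slope = slowMap p.slope := by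
  have hlop := p.lo_pos
  have hne : p.lo ≠ p.hi := by
    intro heq
    apply h.irrational_like (p.n + p.m) (Nat.add_pos_left p.n_pos _) (p.c + p.d)
    simp only [FareyPair.lo, FareyPair.hi] at heq
    push_cast
    linarith
  rcases lt_or_gt_of_ne hne with hlt | hlt
  · refine ⟨⟨p.n, p.c, p.n + p.m, p.c + p.d, p.n_pos, Nat.add_pos_left p.n_pos _, ?_, p.lower, ?_⟩,
      ?_, ?_⟩
    · have := p.det
      linear_combination this
    · simp only [FareyPair.lo, FareyPair.hi] at hlt
      push_cast
      linarith
    · have := p.n_pos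
      show p.n + p.m < p.n + (p.n + p.m)
      omega
    · have h1 : ¬ p.slope < 1 := by
        rw [FareyPair.slope, div_lt_one hlop]
        linarith
      rw [slowMap, if_neg h1]
      simp only [FareyPair.slope, FareyPair.hi, FareyPair.lo] at hlop ⊢
      push_cast
      field_simp
      ring
  · refine ⟨⟨p.n + p.m, p.c + p.d, p.m, p.d, Nat.add_pos_left p.n_pos _, p.m_pos, ?_, ?_, p.upper⟩,
      ?_, ?_⟩
    · have := p.det
      linear_combination this
    · simp only [FareyPair.lo, FareyPair.hi] at hlt
      push_cast
      linarith
    · have := p.m_pos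
      show p.n + p.m < p.n + p.m + p.m
      omega
    · have h1 : p.slope < 1 := by
        rw [FareyPair.slope, div_lt_one hlop]
        exact hlt
      rw [slowMap, if_pos h1]
      have h2 : 0 < 1 - p.slope := by linarith
      have h3 : p.lo - p.hi ≠ 0 := sub_ne_zero.mpr hlt.ne'
      have h4 : ((p.n + p.m : ℕ) : ℝ) * ω - ((p.c + p.d : ℕ) : ℝ) = p.lo - p.hi := by
        simp only [FareyPair.hi, FareyPair.lo]
        push_cast
        ring
      rw [eq_div_iff h2.ne']
      change p.hi / (((p.n + p.m : ℕ) : ℝ) * ω - ((p.c + p.d : ℕ) : ℝ)) * (1 - p.hi / p.lo)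
        = p.hi / p.lo
      rw [h4]
      field_simp

theorem exists_close_root {ℓ : Polynomial ℝ} (hℓ : ℓ ≠ 0) (a b : ℝ) {ε : ℝ} (hε : 0 < ε) :
    ∃ η > 0, ∀ x ∈ Set.Icc a b, |ℓ.eval x| < η → ∃ z ∈ ℓ.roots.toFinset, |x - z| < ε := by
  set S : Set ℝ := Set.Icc a b ∩ {x | ∀ z ∈ ℓ.roots.toFinset, ε ≤ |x - z|} with hS
  have hclosed : IsClosed {x : ℝ | ∀ z ∈ ℓ.roots.toFinset, ε ≤ |x - z|} := by
    simp only [Set.ofPred_forall]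
    exact isClosed_iInter fun z => isClosed_iInter fun _ =>
      isClosed_le continuous_const (by fun_prop)
  have hcomp : IsCompact S := isCompact_Icc.inter_right hclosed
  rcases S.eq_empty_or_nonempty with he | hne
  · refine ⟨1, one_pos, fun x hx _ => ?_⟩
    by_contra! hcon
    have : x ∈ S := ⟨hx, hcon⟩
    rw [he] at this
    exact this
  · obtain ⟨x₀, hx₀, hmin⟩ := hcomp.exists_isMinOn hne
      (f := fun x => |ℓ.eval x|) (by fun_prop)
    refine ⟨|ℓ.eval x₀|, ?_, fun x hx hlt => ?_⟩
    · refine abs_pos.mpr ?_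
      intro h0
      have := hx₀.2 x₀ (by
        rw [Multiset.mem_toFinset, Polynomial.mem_roots hℓ]
        exact h0)
      simp at this
      linarith
    · by_contra! hcon
      have h1 : |ℓ.eval x₀| ≤ |ℓ.eval x| := hmin (show x ∈ S from ⟨hx, hcon⟩)
      linarith

theorem Finset.exists_separation (Z : Finset ℝ) :
    ∃ s > 0, ∀ z ∈ Z, ∀ z' ∈ Z, |z - z'| < s → z = z' := by
  rcases Z.offDiag.eq_empty_or_nonempty with he | hne
  · refine ⟨1, one_pos, fun z hz z' hz' _ => ?_⟩
    by_contra hcon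
    have : (z, z') ∈ Z.offDiag := Finset.mem_offDiag.mpr ⟨hz, hz', hcon⟩
    rw [he] at this
    simp at this
  · obtain ⟨x, hx, hmin⟩ := Z.offDiag.exists_min_image (fun x => |x.1 - x.2|) hne
    refine ⟨|x.1 - x.2|, ?_, fun z hz z' hz' hlt => ?_⟩
    · have := (Finset.mem_offDiag.mp hx).2.2
      exact abs_pos.mpr (sub_ne_zero.mpr this)
    · by_contra hcon
      have := hmin (z, z') (Finset.mem_offDiag.mpr ⟨hz, hz', hcon⟩)
      simp only at this
      linarith

/-- A bounded orbit of the slow map that stays away from its discontinuity and accumulates only at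
finitely many points is eventually periodic. -/
theorem exists_orbit_eq {x : ℕ → ℝ} {a b : ℝ} (ha0 : 0 < a) (hx : ∀ k, x k ∈ Set.Icc a b)
    (hT : ∀ k, x (k + 1) = slowMap (x k)) {ℓ : Polynomial ℝ} (hℓ : ℓ ≠ 0)
    (hlim : ∀ ε > 0, ∃ N, ∀ k ≥ N, |ℓ.eval (x k)| < ε) (hne : ∀ k, x k ≠ 1) :
    ∃ k k', k < k' ∧ x k = x k' := by
  have hgap : ∃ g > 0, g ≤ 1 ∧ ∀ k, (x k < 1 → x k ≤ 1 - g) ∧ (1 < x k → 1 + g ≤ x k) := by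
    have hb : 0 < b := ha0.trans_le ((hx 0).1.trans (hx 0).2)
    refine ⟨min (a / b) (min a 1), by positivity, (min_le_right _ _).trans (min_le_right _ _),
      fun k => ⟨fun h => ?_, fun h => ?_⟩⟩
    · have h1 := (hx (k + 1)).2
      rw [hT, slowMap, if_pos h, div_le_iff₀ (by linarith)] at h1
      have h2 := (hx k).1
      have h3 : a / b ≤ 1 - x k := by
        rw [div_le_iff₀ hb]
        linarith
      have := min_le_left (a / b) (min a 1)
      linarith
    · have h1 := (hx (k + 1)).1
      rw [hT, slowMap, if_neg (by linarith)] at h1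
      have := (min_le_right (a / b) (min a 1)).trans (min_le_left _ _)
      linarith
  obtain ⟨g, hg0, hg1, hg⟩ := hgap
  obtain ⟨s, hs0, hs⟩ := ℓ.roots.toFinset.exists_separation
  -- Behaviour of differences of two orbit points that are close together.
  have hstep : ∀ k k', |x k - x k'| < g →
      |x k - x k'| ≤ |x (k + 1) - x (k' + 1)| ∧
      (x k < 1 → |x k - x k'| / (1 - a) ≤ |x (k + 1) - x (k' + 1)|) ∧
      |x (k + 1) - x (k' + 1)| ≤ |x k - x k'| / g ^ 2 := by
    intro k k' hlt
    rw [hT, hT]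
    have hlt' := abs_lt.mp hlt
    have hg2 : g ^ 2 ≤ 1 := pow_le_one₀ hg0.le hg1
    rcases lt_or_gt_of_ne (hne k) with h | h
    · have h1 := (hg k).1 h
      have h' : x k' < 1 := by
        rcases lt_or_gt_of_ne (hne k') with h' | h'
        · exact h'
        · have := (hg k').2 h'
          linarith
      have h1' := (hg k').1 h'
      have ha := (hx k).1
      have ha' := (hx k').1
      have e : slowMap (x k) - slowMap (x k') = (x k - x k') / ((1 - x k) * (1 - x k')) := by
        rw [slowMap, slowMap, if_pos h, if_pos h']
        have p1 : 1 - x k ≠ 0 := by linarith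
        have p2 : 1 - x k' ≠ 0 := by linarith
        field_simp
        ring
      have hp : 0 < (1 - x k) * (1 - x k') := mul_pos (by linarith) (by linarith)
      rw [e, abs_div, abs_of_pos hp]
      have hp1 : (1 - x k) * (1 - x k') ≤ 1 - a := by nlinarith
      have hp2 : g ^ 2 ≤ (1 - x k) * (1 - x k') := by nlinarith
      refine ⟨?_, fun _ => ?_, ?_⟩
      · exact le_div_self (abs_nonneg _) hp (by linarith)
      · exact div_le_div_of_nonneg_left (abs_nonneg _) hp hp1
      · exact div_le_div_of_nonneg_left (abs_nonneg _) (by positivity) hp2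
    · have h1 := (hg k).2 h
      have h' : 1 < x k' := by
        rcases lt_or_gt_of_ne (hne k') with h' | h'
        · have := (hg k').1 h'
          linarith
        · exact h'
      have e : slowMap (x k) - slowMap (x k') = x k - x k' := by
        rw [slowMap, slowMap, if_neg (by linarith), if_neg (by linarith)]
        ring
      rw [e]
      refine ⟨le_rfl, fun hc => absurd hc (by linarith), ?_⟩
      exact le_div_self (abs_nonneg _) (by positivity) hg2
  set ε : ℝ := min (g / 3) (s * g ^ 2 / 5) with hε
  have hε0 : 0 < ε := by positivity
  have hεg : 2 * ε < g := by
    have := min_le_left (g / 3) (s * g ^ 2 / 5)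
    linarith
  have hεs : 2 * ε / g ^ 2 + 2 * ε < s := by
    have h1 := min_le_right (g / 3) (s * g ^ 2 / 5)
    have hg2 : g ^ 2 ≤ 1 := pow_le_one₀ hg0.le hg1
    have h2 : 2 * ε / g ^ 2 ≤ 2 * s / 5 := by
      rw [div_le_iff₀ (by positivity)]
      linarith
    have h3 : s * g ^ 2 ≤ s := mul_le_of_le_one_right hs0.le hg2
    linarith
  obtain ⟨η, hη0, hη⟩ := exists_close_root hℓ a b hε0
  obtain ⟨N, hN⟩ := hlim η hη0
  have hroot : ∀ k, ∃ z ∈ ℓ.roots.toFinset, |x (N + k) - z| < ε := fun k =>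
    hη _ (hx _) (hN _ (Nat.le_add_right _ _))
  choose z hz hzx using hroot
  obtain ⟨k, k', hkk', hzz⟩ : ∃ k k', k < k' ∧ z k = z k' := by
    obtain ⟨k, k', hne', h⟩ := Finite.exists_ne_map_eq_of_infinite
      (fun k => (⟨z k, hz k⟩ : ℓ.roots.toFinset))
    have h := congrArg Subtype.val h
    simp only at h
    rcases lt_or_gt_of_ne hne' with h1 | h1
    · exact ⟨k, k', h1, h⟩
    · exact ⟨k', k, h1, h.symm⟩
  have hclose : ∀ i, |x (N + k + i) - x (N + k' + i)| ≤ 2 * ε := by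
    intro i
    induction i with
    | zero =>
      have h1 := hzx k
      have h2 := hzx k'
      rw [← hzz] at h2
      rw [abs_lt] at h1 h2
      rw [abs_le]
      simp only [add_zero]
      constructor <;> linarith
    | succ i ih =>
      have h1 := (hstep _ _ (ih.trans_lt hεg)).2.2
      have h2 : |x (N + k + i) - x (N + k' + i)| / g ^ 2 ≤ 2 * ε / g ^ 2 := by gcongr
      have h3 := hzx (k + (i + 1))
      have h4 := hzx (k' + (i + 1))
      have e1 : N + (k + (i + 1)) = N + k + i + 1 := by ring
      have e2 : N + (k' + (i + 1)) = N + k' + i + 1 := by ring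
      rw [e1] at h3
      rw [e2] at h4
      have h5 : z (k + (i + 1)) = z (k' + (i + 1)) := by
        refine hs _ (hz _) _ (hz _) ?_
        have := h1.trans h2
        rw [abs_le] at this
        rw [abs_lt] at h3 h4 ⊢
        constructor <;> linarith
      rw [← h5] at h4
      rw [show N + k + (i + 1) = N + k + i + 1 from rfl,
        show N + k' + (i + 1) = N + k' + i + 1 from rfl]
      rw [abs_lt] at h3 h4
      rw [abs_le]
      constructor <;> linarith
  refine ⟨N + k, N + k', by omega, ?_⟩
  by_contra hcon
  have hd0 : 0 < |x (N + k) - x (N + k')| := abs_pos.mpr (sub_ne_zero.mpr hcon)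
  have hmono : ∀ i j, |x (N + k + i) - x (N + k' + i)| ≤
      |x (N + k + (i + j)) - x (N + k' + (i + j))| := by
    intro i j
    induction j with
    | zero => exact le_rfl
    | succ j ih =>
      refine ih.trans ?_
      have := (hstep _ _ ((hclose (i + j)).trans_lt hεg)).1
      simpa [add_assoc] using this
  have hless : ∀ i, ∃ j, x (i + j) < 1 := by
    intro i
    by_contra! hcon
    have : ∀ j : ℕ, x (i + j) = x i - j := by
      intro j
      induction j with
      | zero => simp
      | succ j ih =>
        rw [← add_assoc, hT, slowMap, if_neg (not_lt.mpr (hcon j)), ih]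
        push_cast
        ring
    obtain ⟨j, hj⟩ := exists_nat_gt (x i)
    have := hcon j
    have h2 := ‹∀ j : ℕ, x (i + j) = x i - j› j
    linarith
  obtain ⟨j₀, hj₀⟩ := hless 0
  have ha1 : a < 1 := (hx _).1.trans_lt hj₀
  have hgrow : ∀ t : ℕ, ∃ i, (1 / (1 - a)) ^ t * |x (N + k) - x (N + k')| ≤
      |x (N + k + i) - x (N + k' + i)| := by
    intro t
    induction t with
    | zero => exact ⟨0, by simp⟩
    | succ t ih =>
      obtain ⟨i, hi⟩ := ih
      obtain ⟨j, hj⟩ := hless (N + k + i)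
      refine ⟨i + j + 1, ?_⟩
      have h1 := (hstep (N + k + (i + j)) (N + k' + (i + j))
        ((hclose (i + j)).trans_lt hεg)).2.1 (by rwa [← add_assoc])
      have h2 := hi.trans (hmono i j)
      rw [show N + k + (i + j + 1) = N + k + (i + j) + 1 from rfl,
        show N + k' + (i + j + 1) = N + k' + (i + j) + 1 from rfl]
      refine le_trans ?_ h1
      rw [pow_succ, le_div_iff₀ (by linarith)]
      have h3 : 1 - a ≠ 0 := by linarith
      calc (1 / (1 - a)) ^ t * (1 / (1 - a)) * |x (N + k) - x (N + k')| * (1 - a)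
          = (1 / (1 - a)) ^ t * |x (N + k) - x (N + k')| := by field_simp
        _ ≤ _ := h2
  have hgt : 1 < 1 / (1 - a) := by
    rw [lt_div_iff₀ (by linarith)]
    linarith
  obtain ⟨t, ht⟩ := pow_unbounded_of_one_lt (2 * ε / |x (N + k) - x (N + k')|) hgt
  obtain ⟨i, hi⟩ := hgrow t
  rw [div_lt_iff₀ hd0] at ht
  linarith [hclose i]

theorem BadlyApprox.false_of_slopes {ω c₀ : ℝ} (h : BadlyApprox ω c₀) (hω : 0 < ω)
    {ℓ : Polynomial ℝ} (hℓ : ℓ ≠ 0)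
    (h1 : ∀ ε > 0, ∃ N, ∀ p : FareyPair ω, N ≤ p.n + p.m → |ℓ.eval p.slope| < ε)
    (h2 : ∀ s : ℝ, ∃ N, ∀ p : FareyPair ω, N ≤ p.n + p.m → p.slope ≠ s) : False := by
  choose next hnext1 hnext2 using h.exists_next
  obtain ⟨p₀⟩ := h.exists_start hω
  let P : ℕ → FareyPair ω := fun k => next^[k] p₀
  have hP : ∀ k, P (k + 1) = next (P k) := fun k => Function.iterate_succ_apply' _ _ _
  have hlarge : ∀ k, k ≤ (P k).n + (P k).m := by
    intro k
    induction k with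
    | zero => exact Nat.zero_le _
    | succ k ih =>
      have := hnext1 (P k)
      rw [hP]
      omega
  have hT : ∀ k, (P (k + 1)).slope = slowMap (P k).slope := by
    intro k
    rw [hP, hnext2]
  have hne : ∀ k, (P k).slope ≠ 1 := by
    intro k hk
    have h3 := (P (k + 1)).slope_pos
    rw [hT, hk, slowMap] at h3
    simp at h3
  obtain ⟨k, k', hkk', heq⟩ := exists_orbit_eq (x := fun k => (P k).slope) (a := c₀) (b := c₀⁻¹) h.1
    (fun k => ⟨h.le_slope _, h.slope_le _⟩) hT hℓ (fun ε hε => by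
      obtain ⟨N, hN⟩ := h1 ε hε
      exact ⟨N, fun k hk => hN _ (hk.le.trans (hlarge k))⟩) hne
  have hper : ∀ i, (P (k + i)).slope = (P (k' + i)).slope := by
    intro i
    induction i with
    | zero => exact heq
    | succ i ih => rw [← add_assoc, ← add_assoc, hT, hT, ih]
  have hrec : ∀ t : ℕ, (P (k + t * (k' - k))).slope = (P k).slope := by
    intro t
    induction t with
    | zero => simp
    | succ t ih =>
      rw [← ih, hper (t * (k' - k))]
      congr 2
      rw [Nat.succ_mul]
      omega
  obtain ⟨N, hN⟩ := h2 (P k).slope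
  refine hN (P (k + N * (k' - k))) ?_ (hrec N)
  refine le_trans ?_ (hlarge _)
  have : N ≤ N * (k' - k) := Nat.le_mul_of_pos_right _ (by omega)
  omega

end

section

open Real Filter MvPolynomial

/-- The polynomial in five quantities with coefficients `c`, and exponents at most `N`. -/
def auxSum {N : ℕ} (c : (Fin 4 → Fin (N + 1)) × Fin (N + 1) → ℤ) {R : Type*} [CommRing R]
    (p : Fin 4 → R) (y : R) : R :=
  ∑ x, (c x : R) * (∏ k, p k ^ (x.1 k : ℕ)) * y ^ (x.2 : ℕ)

/-- Truncation of the difference of two double power series with coefficients `a`. -/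
def pairSum (a : ℕ → ℕ → ℤ) (r : ℕ) {R : Type*} [CommRing R] (p : Fin 4 → R) : R :=
  ∑ x ∈ Finset.range r ×ˢ Finset.range r,
    (a x.1 x.2 : R) * (p 0 ^ x.1 * p 2 ^ x.2 - p 1 ^ x.1 * p 3 ^ x.2)

theorem map_auxSum {N : ℕ} (c : (Fin 4 → Fin (N + 1)) × Fin (N + 1) → ℤ) {R S : Type*}
    [CommRing R] [CommRing S] (f : R →+* S) (p : Fin 4 → R) (y : R) :
    f (auxSum c p y) = auxSum c (fun k => f (p k)) (f y) := by
  simp [auxSum, map_sum, map_mul, map_prod, map_pow]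

theorem map_pairSum (a : ℕ → ℕ → ℤ) (r : ℕ) {R S : Type*} [CommRing R] [CommRing S]
    (f : R →+* S) (p : Fin 4 → R) : f (pairSum a r p) = pairSum a r (fun k => f (p k)) := by
  simp [pairSum, map_sum, map_mul, map_sub, map_pow]

namespace MvPolynomial

variable {σ : Type*}

/-- All monomials of the polynomial have degree at least `r`. -/
def OrderGE (r : ℕ) (F : MvPolynomial σ ℤ) : Prop := ∀ μ : σ →₀ ℕ, μ.degree < r → F.coeff μ = 0

namespace OrderGE

variable {r : ℕ} {F G : MvPolynomial σ ℤ}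

theorem sub (hF : OrderGE r F) (hG : OrderGE r G) : OrderGE r (F - G) := fun μ hμ => by
  rw [coeff_sub, hF μ hμ, hG μ hμ, sub_zero]

theorem sum {ι : Type*} {s : Finset ι} {f : ι → MvPolynomial σ ℤ}
    (h : ∀ i ∈ s, OrderGE r (f i)) : OrderGE r (∑ i ∈ s, f i) := fun μ hμ => by
  rw [coeff_sum]
  exact Finset.sum_eq_zero fun i hi => h i hi μ hμ

theorem mul_left (hF : OrderGE r F) (G : MvPolynomial σ ℤ) : OrderGE r (G * F) := fun μ hμ => by
  classical
  rw [coeff_mul]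
  refine Finset.sum_eq_zero fun x hx => ?_
  have h := Finset.HasAntidiagonal.mem_antidiagonal.mp hx
  have : x.2.degree < r := by
    have h2 : x.1.degree + x.2.degree = μ.degree := by rw [← map_add, h]
    omega
  rw [hF _ this, mul_zero]

theorem monomial {μ : σ →₀ ℕ} (h : r ≤ μ.degree) (k : ℤ) :
    OrderGE r (MvPolynomial.monomial μ k) := fun ν hν => by
  classical
  rw [coeff_monomial, if_neg]
  rintro rfl
  omega

end OrderGE

/-- The sum of the absolute values of the coefficients. -/
noncomputable def absSum (F : MvPolynomial σ ℤ) : ℝ := ∑ μ ∈ F.support, |((F.coeff μ : ℤ) : ℝ)|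

theorem absSum_nonneg (F : MvPolynomial σ ℤ) : 0 ≤ F.absSum :=
  Finset.sum_nonneg fun _ _ => abs_nonneg _

theorem norm_prod_pow_le [Finite σ] {p : σ → ℂ} {t : ℝ} (hp : ∀ i, ‖p i‖ ≤ t) (μ : σ →₀ ℕ) :
    ‖∏ i ∈ μ.support, p i ^ μ i‖ ≤ t ^ μ.degree := by
  rw [norm_prod, Finsupp.degree_apply, ← Finset.prod_pow_eq_pow_sum]
  refine Finset.prod_le_prod (fun _ _ => norm_nonneg _) fun i _ => ?_
  rw [norm_pow]
  exact pow_le_pow_left₀ (norm_nonneg _) (hp i) _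

theorem OrderGE.norm_eval₂_le [Finite σ] {r : ℕ} {F : MvPolynomial σ ℤ} (hF : OrderGE r F)
    {p : σ → ℂ} {t : ℝ} (ht0 : 0 ≤ t) (ht : t ≤ 1) (hp : ∀ i, ‖p i‖ ≤ t) :
    ‖eval₂Hom (Int.castRingHom ℂ) p F‖ ≤ F.absSum * t ^ r := by
  rw [coe_eval₂Hom, eval₂_eq, absSum, Finset.sum_mul]
  refine norm_sum_le_of_le _ fun μ hμ => ?_
  rw [norm_mul]
  have h1 : ‖(Int.castRingHom ℂ) (coeff μ F)‖ = |((coeff μ F : ℤ) : ℝ)| := by simp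
  rw [h1]
  refine mul_le_mul_of_nonneg_left ((norm_prod_pow_le hp μ).trans ?_) (abs_nonneg _)
  refine pow_le_pow_of_le_one ht0 ht ?_
  by_contra! hlt
  exact mem_support_iff.mp hμ (hF μ hlt)

end MvPolynomial

/-- The auxiliary polynomial evaluated at a truncated series. -/
noncomputable def auxPoly {N : ℕ} (c : (Fin 4 → Fin (N + 1)) × Fin (N + 1) → ℤ)
    (a : ℕ → ℕ → ℤ) (r : ℕ) : MvPolynomial (Fin 4) ℤ :=
  auxSum c X (pairSum a r X)

theorem eval₂Hom_auxPoly {N : ℕ} (c : (Fin 4 → Fin (N + 1)) × Fin (N + 1) → ℤ)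
    (a : ℕ → ℕ → ℤ) (r : ℕ) {R : Type*} [CommRing R] (p : Fin 4 → R) :
    eval₂Hom (Int.castRingHom R) p (auxPoly c a r) = auxSum c p (pairSum a r p) := by
  rw [auxPoly, map_auxSum, map_pairSum]
  simp only [coe_eval₂Hom, eval₂_X]

theorem exists_auxPoly_orderGE (a : ℕ → ℕ → ℤ) {r N : ℕ} (hr : 0 < r)
    (hN : r ^ 4 < (N + 1) ^ 5) :
    ∃ c : (Fin 4 → Fin (N + 1)) × Fin (N + 1) → ℤ, c ≠ 0 ∧ OrderGE r (auxPoly c a r) := by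
  let A : Matrix (Fin 4 → Fin r) ((Fin 4 → Fin (N + 1)) × Fin (N + 1)) ℤ := fun μ x =>
    coeff (Finsupp.equivFunOnFinite.symm fun k => (μ k : ℕ))
      ((∏ k, X k ^ (x.1 k : ℕ)) * (pairSum a r X : MvPolynomial (Fin 4) ℤ) ^ (x.2 : ℕ))
  have h1 : Fintype.card (Fin 4 → Fin r) < Fintype.card ((Fin 4 → Fin (N + 1)) × Fin (N + 1)) := by
    simp only [Fintype.card_pi, Fintype.card_prod, Fintype.card_fin, Finset.prod_const,
      Finset.card_univ]
    rw [← pow_succ]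
    exact hN
  have h2 : 0 < Fintype.card (Fin 4 → Fin r) := by
    simp only [Fintype.card_pi, Fintype.card_fin, Finset.prod_const, Finset.card_univ]
    positivity
  obtain ⟨c, hc0, hc, -⟩ := Int.Matrix.exists_ne_zero_int_vec_norm_le A h1 h2
  refine ⟨c, hc0, fun μ hμ => ?_⟩
  have hlt : ∀ k, μ k < r := fun k => (Finsupp.le_degree k μ).trans_lt hμ
  have h3 := congrFun hc fun k => ⟨μ k, hlt k⟩
  simp only [Matrix.mulVec, dotProduct, Pi.zero_apply, A] at h3
  have e : (Finsupp.equivFunOnFinite.symm fun k => μ k) = μ := by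
    ext k
    simp
  rw [e] at h3
  rw [auxPoly, auxSum, coeff_sum, ← h3]
  refine Finset.sum_congr rfl fun x _ => ?_
  rw [mul_assoc, ← map_intCast (C : ℤ →+* MvPolynomial (Fin 4) ℤ), coeff_C_mul]
  rw [Int.cast_id, mul_comm]

theorem orderGE_pairSum_sub (a : ℕ → ℕ → ℤ) {r r' : ℕ} (h : r ≤ r') :
    OrderGE r ((pairSum a r' X : MvPolynomial (Fin 4) ℤ) - pairSum a r X) := by
  classical
  have hsub : Finset.range r ×ˢ Finset.range r ⊆ Finset.range r' ×ˢ Finset.range r' :=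
    Finset.product_subset_product (Finset.range_mono h) (Finset.range_mono h)
  rw [pairSum, pairSum, ← Finset.sum_sdiff hsub, add_sub_cancel_right]
  refine OrderGE.sum fun x hx => ?_
  have hx' : r ≤ x.1 + x.2 := by
    simp only [Finset.mem_sdiff, Finset.mem_product, Finset.mem_range] at hx
    omega
  refine OrderGE.mul_left (OrderGE.sub ?_ ?_) _
  all_goals
    rw [X_pow_eq_monomial, X_pow_eq_monomial, monomial_mul]
    refine OrderGE.monomial ?_ _
    rw [map_add]
    simpa using hx'

theorem orderGE_auxPoly_sub {N : ℕ} (c : (Fin 4 → Fin (N + 1)) × Fin (N + 1) → ℤ)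
    (a : ℕ → ℕ → ℤ) {r r' : ℕ} (h : r ≤ r') : OrderGE r (auxPoly c a r' - auxPoly c a r) := by
  rw [auxPoly, auxPoly, auxSum, auxSum, ← Finset.sum_sub_distrib]
  refine OrderGE.sum fun x _ => ?_
  rw [← mul_sub]
  refine OrderGE.mul_left ?_ _
  obtain ⟨k, hk⟩ := sub_dvd_pow_sub_pow (pairSum a r' X : MvPolynomial (Fin 4) ℤ)
    (pairSum a r X) x.2
  rw [hk, mul_comm]
  exact (orderGE_pairSum_sub a h).mul_left _

/-- The sum of the absolute values of the coefficients of an auxiliary sum. -/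
def coeffSum {N : ℕ} (c : (Fin 4 → Fin (N + 1)) × Fin (N + 1) → ℤ) : ℝ := ∑ x, |(c x : ℝ)|

theorem coeffSum_nonneg {N : ℕ} (c : (Fin 4 → Fin (N + 1)) × Fin (N + 1) → ℤ) : 0 ≤ coeffSum c :=
  Finset.sum_nonneg fun _ _ => abs_nonneg _

theorem norm_pow_sub_pow_le {y z : ℂ} {B : ℝ} (hB : 1 ≤ B) (hy : ‖y‖ ≤ B) (hz : ‖z‖ ≤ B) {d N : ℕ}
    (hd : d ≤ N) : ‖y ^ d - z ^ d‖ ≤ N * B ^ N * ‖y - z‖ := by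
  rw [← Commute.geom_sum₂_mul (Commute.all y z), norm_mul]
  refine mul_le_mul_of_nonneg_right ?_ (norm_nonneg _)
  calc ‖∑ i ∈ Finset.range d, y ^ i * z ^ (d - 1 - i)‖
      ≤ ∑ i ∈ Finset.range d, B ^ N := by
        refine norm_sum_le_of_le _ fun i hi => ?_
        rw [norm_mul, norm_pow, norm_pow]
        have hi := Finset.mem_range.mp hi
        calc ‖y‖ ^ i * ‖z‖ ^ (d - 1 - i) ≤ B ^ i * B ^ (d - 1 - i) := by gcongr
          _ = B ^ (d - 1) := by rw [← pow_add]; congr 1; omega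
          _ ≤ B ^ N := pow_le_pow_right₀ hB (by omega)
    _ = d * B ^ N := by simp
    _ ≤ N * B ^ N := by
        have : (d : ℝ) ≤ N := by exact_mod_cast hd
        gcongr

theorem norm_auxSum_sub_le {N : ℕ} (c : (Fin 4 → Fin (N + 1)) × Fin (N + 1) → ℤ) {p : Fin 4 → ℂ}
    (hp : ∀ k, ‖p k‖ ≤ 1) {y z : ℂ} {B : ℝ} (hB : 1 ≤ B) (hy : ‖y‖ ≤ B) (hz : ‖z‖ ≤ B) :
    ‖auxSum c p y - auxSum c p z‖ ≤ coeffSum c * (N * B ^ N) * ‖y - z‖ := by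
  rw [auxSum, auxSum, ← Finset.sum_sub_distrib, mul_assoc, coeffSum, Finset.sum_mul]
  refine norm_sum_le_of_le _ fun x _ => ?_
  rw [← mul_sub, norm_mul, norm_mul, Complex.norm_intCast, mul_assoc]
  refine mul_le_mul_of_nonneg_left ?_ (abs_nonneg _)
  refine (mul_le_of_le_one_left (norm_nonneg _) ?_).trans
    (norm_pow_sub_pow_le hB hy hz (by omega))
  rw [norm_prod]
  refine Finset.prod_le_one (fun _ _ => norm_nonneg _) fun k _ => ?_
  rw [norm_pow]
  exact pow_le_one₀ (norm_nonneg _) (hp k)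

namespace FareyPair

variable {ω : ℝ} (p : FareyPair ω)

/-- The values of the variables at a Farey pair. -/
noncomputable def point (β : ℝ) : Fin 4 → ℂ :=
  ![(β : ℂ) ^ p.n * Complex.exp ((π / 2 * p.lo : ℝ) * Complex.I),
    (β : ℂ) ^ p.n * Complex.exp (-((π / 2 * p.lo : ℝ) * Complex.I)),
    (β : ℂ) ^ p.m * Complex.exp (-((π / 2 * p.hi : ℝ) * Complex.I)),
    (β : ℂ) ^ p.m * Complex.exp ((π / 2 * p.hi : ℝ) * Complex.I)]

/-- The normalized value of the double series at a Farey pair. -/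
noncomputable def value (β : ℝ) : ℂ := 2 * Complex.I * (∑' x, p.term β x : ℝ)

/-- The coefficients of the double series agree with `a` on a square. -/
def Matches (a : ℕ → ℕ → ℤ) (r : ℕ) : Prop := ∀ i < r, ∀ j < r, (a i j : ℝ) = p.pattern i j

theorem norm_point_le {β t : ℝ} (h1 : |β| ^ p.n ≤ t) (h2 : |β| ^ p.m ≤ t) (k : Fin 4) :
    ‖p.point β k‖ ≤ t := by
  have h : ∀ x : ℝ, ‖Complex.exp (-(x * Complex.I))‖ = 1 := fun x => by
    rw [← neg_mul, ← Complex.ofReal_neg, Complex.norm_exp_ofReal_mul_I]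
  fin_cases k
  all_goals
    simp [point, h, Complex.norm_exp_ofReal_mul_I, -Complex.ofReal_mul,
      -Complex.ofReal_div, h1, h2]

theorem two_mul_I_mul_term (β : ℝ) (x : ℕ × ℕ) :
    2 * Complex.I * (p.term β x : ℂ) = p.pattern x.1 x.2 *
      (p.point β 0 ^ x.1 * p.point β 2 ^ x.2 - p.point β 1 ^ x.1 * p.point β 3 ^ x.2) := by
  have hs : ∀ u : ℝ, 2 * Complex.I * (sin u : ℂ) =
      Complex.exp (u * Complex.I) - Complex.exp (-(u * Complex.I)) := by
    intro u
    rw [Complex.ofReal_sin, mul_comm 2, mul_assoc, Complex.two_sin, neg_mul]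
    linear_combination (Complex.exp (-(u * Complex.I)) - Complex.exp (u * Complex.I)) *
      Complex.I_mul_I
  have h := hs (π / 2 * (x.1 * p.lo - x.2 * p.hi))
  have e1 : ∀ A B : ℂ, (β ^ p.n * A) ^ x.1 * (β ^ p.m * B) ^ x.2 =
      (β : ℂ) ^ (x.1 * p.n + x.2 * p.m) * (A ^ x.1 * B ^ x.2) := by
    intro A B
    rw [mul_pow, mul_pow, ← pow_mul, ← pow_mul, pow_add, mul_comm p.n, mul_comm p.m]
    ring
  simp only [point, Matrix.cons_val_zero, Matrix.cons_val_one, Matrix.cons_val]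
  rw [e1, e1, ← mul_sub, ← Complex.exp_nat_mul, ← Complex.exp_nat_mul, ← Complex.exp_nat_mul,
    ← Complex.exp_nat_mul, ← Complex.exp_add, ← Complex.exp_add]
  have e2 : (x.1 : ℂ) * ((π / 2 * p.lo : ℝ) * Complex.I) +
      x.2 * (-((π / 2 * p.hi : ℝ) * Complex.I)) =
      (π / 2 * (x.1 * p.lo - x.2 * p.hi) : ℝ) * Complex.I := by
    push_cast
    ring
  have e3 : (x.1 : ℂ) * (-((π / 2 * p.lo : ℝ) * Complex.I)) +
      x.2 * ((π / 2 * p.hi : ℝ) * Complex.I) =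
      -((π / 2 * (x.1 * p.lo - x.2 * p.hi) : ℝ) * Complex.I) := by
    push_cast
    ring
  rw [e2, e3, ← h, term]
  push_cast
  ring

theorem norm_value_sub_pairSum_le {β t : ℝ} (hβ : |β| < 1) (ht : t ≤ 1 / 2) (h1 : |β| ^ p.n ≤ t)
    (h2 : |β| ^ p.m ≤ t) {a : ℕ → ℕ → ℤ} {r : ℕ} (ha : p.Matches a r) :
    ‖p.value β - pairSum a r (p.point β)‖ ≤ 8 * (2 * t) ^ r := by
  classical
  have ht0 : 0 ≤ t := le_trans (by positivity) h1
  set s := Finset.range r ×ˢ Finset.range r with hs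
  have e1 : pairSum a r (p.point β) = 2 * Complex.I * ((∑ x ∈ s, p.term β x : ℝ) : ℂ) := by
    rw [pairSum, Complex.ofReal_sum, Finset.mul_sum]
    refine Finset.sum_congr rfl fun x hx => ?_
    have hx' := Finset.mem_product.mp hx
    have := ha x.1 (Finset.mem_range.mp hx'.1) x.2 (Finset.mem_range.mp hx'.2)
    rw [two_mul_I_mul_term, ← this]
    simp
  have e2 : ∑' x, p.term β x - ∑ x ∈ s, p.term β x =
      ∑' x, if x ∈ s then 0 else p.term β x := by
    have hfin : HasSum (fun x => if x ∈ s then p.term β x else 0) (∑ x ∈ s, p.term β x) := by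
      have : HasSum (fun x => if x ∈ s then p.term β x else 0)
          (∑ x ∈ s, if x ∈ s then p.term β x else 0) :=
        hasSum_sum_of_ne_finset_zero fun x hx => if_neg hx
      rwa [Finset.sum_congr rfl fun x hx => if_pos hx] at this
    rw [← ((p.summable_term hβ).hasSum.sub hfin).tsum_eq]
    refine tsum_congr fun x => ?_
    split_ifs <;> simp
  have hgeo : HasSum (fun x : ℕ × ℕ => (2 * t) ^ r * ((1 / 2 : ℝ) ^ x.1 * (1 / 2) ^ x.2))
      ((2 * t) ^ r * (2 * 2)) := by
    refine (hasSum_geometric_two.mul hasSum_geometric_two ?_).mul_left _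
    exact summable_geometric_two.mul_of_nonneg summable_geometric_two
      (fun _ => by positivity) (fun _ => by positivity)
  have h3 : ‖∑' x, if x ∈ s then 0 else p.term β x‖ ≤ (2 * t) ^ r * (2 * 2) := by
    refine tsum_of_norm_bounded hgeo fun x => ?_
    split_ifs with hx
    · rw [norm_zero]
      positivity
    · refine (p.abs_term_le β x).trans ?_
      have hr : r ≤ x.1 + x.2 := by
        simp only [hs, Finset.mem_product, Finset.mem_range] at hx
        omega
      calc (|β| ^ p.n) ^ x.1 * (|β| ^ p.m) ^ x.2 ≤ t ^ x.1 * t ^ x.2 := by gcongr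
        _ = (2 * t) ^ (x.1 + x.2) * ((1 / 2) ^ x.1 * (1 / 2) ^ x.2) := by
            rw [← pow_add, ← pow_add, ← mul_pow]
            congr 1
            ring
        _ ≤ _ := by
            refine mul_le_mul_of_nonneg_right ?_ (by positivity)
            exact pow_le_pow_of_le_one (by positivity) (by linarith) hr
  rw [value, e1, ← mul_sub, ← Complex.ofReal_sub, e2, norm_mul, norm_mul, Complex.norm_I,
    Complex.norm_real, Complex.norm_ofNat]
  linarith

theorem norm_auxSum_sub_le {β t : ℝ} (hβ : |β| < 1) (ht : t ≤ 1 / 2) (h1 : |β| ^ p.n ≤ t)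
    (h2 : |β| ^ p.m ≤ t) {a : ℕ → ℕ → ℤ} {r : ℕ} (ha : p.Matches a r) {N : ℕ}
    (c : (Fin 4 → Fin (N + 1)) × Fin (N + 1) → ℤ) :
    ‖auxSum c (p.point β) (p.value β) -
      eval₂Hom (Int.castRingHom ℂ) (p.point β) (auxPoly c a r)‖ ≤
    coeffSum c * (N * 16 ^ N) * 8 * (2 * t) ^ r := by
  have ht0 : 0 ≤ t := le_trans (by positivity) h1
  have h3 := p.norm_value_sub_pairSum_le hβ ht h1 h2 ha
  have h4 := p.norm_value_sub_pairSum_le (a := a) (r := 0) hβ ht h1 h2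
    (fun i hi => absurd hi (Nat.not_lt_zero i))
  have h5 : pairSum a 0 (p.point β) = 0 := by simp [pairSum]
  rw [h5, sub_zero, pow_zero] at h4
  have h6 : (2 * t) ^ r ≤ 1 := pow_le_one₀ (by positivity) (by linarith)
  have h7 : ‖pairSum a r (p.point β)‖ ≤ 16 := by
    have := norm_sub_norm_le (pairSum a r (p.point β)) (p.value β)
    rw [norm_sub_rev] at this
    linarith
  rw [eval₂Hom_auxPoly]
  refine (_root_.norm_auxSum_sub_le c (fun k => p.norm_point_le (h1.trans (by linarith))
    (h2.trans (by linarith)) k) (B := 16) (by norm_num) (by linarith) h7).trans ?_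
  rw [mul_assoc _ (8 : ℝ)]
  have := coeffSum_nonneg c
  gcongr

theorem sizeLE_point {K : Type*} [Field K] {φ : K →+* ℂ} {q : ℕ}
    {H : ℝ} (hH : 1 ≤ H) {β : ℝ} {α : ℂ}
    (hα : α = Complex.exp ((π * ω / 2 : ℝ) * Complex.I))
    (h1 : SizeLE φ q 1 H α) (h2 : SizeLE φ q 1 H α⁻¹) (h3 : SizeLE φ q 1 H β)
    (h5 : SizeLE φ q 1 H Complex.I) (k : Fin 4) :
    SizeLE φ q (5 * (p.n + p.m)) (H ^ (5 * (p.n + p.m))) (p.point β k) := by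
  have hn := p.n_pos
  have hm := p.m_pos
  have hI : ∀ k, SizeLE φ q 3 (H ^ 3) (Complex.I ^ k) := by
    intro k
    rw [Complex.I_pow_eq_pow_mod]
    exact (h5.pow (k % 4)).mono (by omega) (pow_le_pow_right₀ hH (by omega))
  have key : ∀ (γ : ℂ) (k l : ℕ), SizeLE φ q 1 H γ → 0 < k → k ≤ p.n + p.m →
      SizeLE φ q (5 * (p.n + p.m)) (H ^ (5 * (p.n + p.m)))
        ((β : ℂ) ^ k * (γ ^ k * Complex.I ^ l)) := by
    intro γ k l hγ hk hk2
    refine ((h3.pow k).mul ((hγ.pow k).mul (hI l))).mono (by omega) ?_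
    rw [← pow_add, ← pow_add]
    exact pow_le_pow_right₀ hH (by omega)
  have hexpI : Complex.exp ((π / 2 : ℝ) * Complex.I) = Complex.I := by
    push_cast
    exact Complex.exp_pi_div_two_mul_I
  have hpos : ∀ k l : ℕ, Complex.exp (-((π / 2 * (k * ω - l) : ℝ) * Complex.I)) =
      α⁻¹ ^ k * Complex.I ^ l := by
    intro k l
    have hIl : Complex.I ^ l = Complex.exp (l * ((π / 2 : ℝ) * Complex.I)) := by
      rw [Complex.exp_nat_mul, hexpI]
    rw [hα, ← Complex.exp_neg, ← Complex.exp_nat_mul, hIl, ← Complex.exp_add]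
    congr 1
    push_cast
    ring
  have hneg : ∀ k l : ℕ, Complex.exp ((π / 2 * (k * ω - l) : ℝ) * Complex.I) =
      α ^ k * Complex.I ^ (3 * l) := by
    intro k l
    have hI3 : Complex.I ^ 3 = Complex.exp (-((π / 2 : ℝ) * Complex.I)) := by
      rw [Complex.exp_neg, hexpI, Complex.I_pow_three, Complex.inv_I]
    rw [pow_mul, hI3, hα, ← Complex.exp_nat_mul, ← Complex.exp_nat_mul, ← Complex.exp_add]
    congr 1
    push_cast
    ring
  have hhi : π / 2 * p.hi = -(π / 2 * (p.m * ω - p.d)) := by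
    rw [hi]
    ring
  fin_cases k
  · have := key α p.n (3 * p.c) h1 hn (by omega)
    rw [← hneg] at this
    exact this
  · have := key α⁻¹ p.n p.c h2 hn (by omega)
    rw [← hpos] at this
    exact this
  · have := key α p.m (3 * p.d) h1 hm (by omega)
    rw [← hneg] at this
    simp only [point, hhi, Complex.ofReal_neg, neg_mul, neg_neg]
    exact this
  · have := key α⁻¹ p.m p.d h2 hm (by omega)
    rw [← hpos] at this
    simp only [point, hhi, Complex.ofReal_neg, neg_mul, neg_neg]
    exact this

end FareyPair

namespace BadlyApprox

variable {ω c₀ : ℝ} (h : BadlyApprox ω c₀)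
include h

theorem mul_m_le_n (p : FareyPair ω) : c₀ * p.m ≤ p.n := by
  have h1 := h.le_n_mul_lo p
  have h2 := p.n_mul_hi_add
  have hn : (0 : ℝ) < p.n := by exact_mod_cast p.n_pos
  have hm : (0 : ℝ) < p.m := by exact_mod_cast p.m_pos
  have h3 : p.m * p.lo ≤ 1 := by nlinarith [p.hi_pos]
  nlinarith [mul_le_mul_of_nonneg_right h1 hm.le, mul_le_mul_of_nonneg_left h3 hn.le]

theorem mul_n_le_m (p : FareyPair ω) : c₀ * p.n ≤ p.m := by
  have h1 := h.le_m_mul_hi p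
  have h2 := p.n_mul_hi_add
  have hn : (0 : ℝ) < p.n := by exact_mod_cast p.n_pos
  have hm : (0 : ℝ) < p.m := by exact_mod_cast p.m_pos
  have h3 : p.n * p.hi ≤ 1 := by nlinarith [p.lo_pos]
  nlinarith [mul_le_mul_of_nonneg_right h1 hn.le, mul_le_mul_of_nonneg_left h3 hm.le]

theorem exists_mul_ge : ∃ L : ℕ, 0 < L ∧ ∀ p : FareyPair ω,
    p.n + p.m ≤ L * p.n ∧ p.n + p.m ≤ L * p.m := by
  obtain ⟨L, hL⟩ := exists_nat_gt (1 + c₀⁻¹)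
  have hc := h.1
  have hci : 0 < c₀⁻¹ := inv_pos.mpr hc
  refine ⟨L, ?_, fun p => ?_⟩
  · have : (0 : ℝ) < L := by linarith
    exact_mod_cast this
  · have hn : (0 : ℝ) < p.n := by exact_mod_cast p.n_pos
    have hm : (0 : ℝ) < p.m := by exact_mod_cast p.m_pos
    have h1 : (p.m : ℝ) ≤ c₀⁻¹ * p.n := by
      rw [inv_mul_eq_div, le_div_iff₀ hc, mul_comm]
      exact h.mul_m_le_n p
    have h2 : (p.n : ℝ) ≤ c₀⁻¹ * p.m := by
      rw [inv_mul_eq_div, le_div_iff₀ hc, mul_comm]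
      exact h.mul_n_le_m p
    constructor
    · have : (p.n : ℝ) + p.m ≤ L * p.n := by nlinarith
      exact_mod_cast this
    · have : (p.n : ℝ) + p.m ≤ L * p.m := by nlinarith
      exact_mod_cast this

/-- The two geometric ratios of a Farey pair are uniformly exponentially small. -/
theorem exists_ratio_bound {β : ℝ} (hβ : |β| < 1) :
    ∃ L n₀ : ℕ, 0 < L ∧ ∀ p : FareyPair ω, n₀ ≤ p.n + p.m →
      ∃ t : ℝ, 0 ≤ t ∧ t ≤ 1 / 2 ∧ |β| ^ p.n ≤ t ∧ |β| ^ p.m ≤ t ∧ t ^ L ≤ |β| ^ (p.n + p.m) := by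
  obtain ⟨L, hL0, hL⟩ := h.exists_mul_ge
  obtain ⟨n₀, hn₀⟩ := exists_pow_lt_of_lt_one (show (0 : ℝ) < (1 / 2) ^ L by positivity) hβ
  have hb0 := abs_nonneg β
  refine ⟨L, n₀, hL0, fun p hp => ⟨max (|β| ^ p.n) (|β| ^ p.m), by positivity, ?_,
    le_max_left _ _, le_max_right _ _, ?_⟩⟩
  rotate_left
  · rcases max_choice (|β| ^ p.n) (|β| ^ p.m) with h1 | h1 <;> rw [h1, ← pow_mul]
    · exact pow_le_pow_of_le_one hb0 hβ.le (by rw [mul_comm]; exact (hL p).1)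
    · exact pow_le_pow_of_le_one hb0 hβ.le (by rw [mul_comm]; exact (hL p).2)
  · refine le_of_lt (lt_of_pow_lt_pow_left₀ L (by norm_num) (lt_of_le_of_lt ?_ hn₀))
    rcases max_choice (|β| ^ p.n) (|β| ^ p.m) with h1 | h1 <;> rw [h1, ← pow_mul]
    · exact pow_le_pow_of_le_one hb0 hβ.le (by rw [mul_comm]; exact hp.trans (hL p).1)
    · exact pow_le_pow_of_le_one hb0 hβ.le (by rw [mul_comm]; exact hp.trans (hL p).2)

end BadlyApprox

theorem FareyPair.one_le_norm_auxSum_mul {K : Type*} [Field K] [NumberField K] {φ : K →+* ℂ}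
    {q : ℕ} {H : ℝ} (hq : 1 ≤ q) (hH : 1 ≤ H) {ω β : ℝ} (hω : 0 < ω) (hβ : |β| < 1) {α : ℂ}
    (hα : α = Complex.exp ((π * ω / 2 : ℝ) * Complex.I))
    (h1 : SizeLE φ q 1 H α) (h2 : SizeLE φ q 1 H α⁻¹) (h3 : SizeLE φ q 1 H β)
    (h4 : SizeLE φ q 1 H (∑' k : ℕ, max (cos (π * (k * ω) / 2)) 0 * β ^ k : ℝ))
    (h5 : SizeLE φ q 1 H Complex.I) (p : FareyPair ω) {N : ℕ}
    (c : (Fin 4 → Fin (N + 1)) × Fin (N + 1) → ℤ) (hE : auxSum c (p.point β) (p.value β) ≠ 0) :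
    1 ≤ 4 ^ N * coeffSum c ^ (Module.finrank ℚ K - 1) * ‖auxSum c (p.point β) (p.value β)‖ *
      ((((q : ℝ) ^ 38) ^ Module.finrank ℚ K *
        ((64 * H) ^ 38) ^ (Module.finrank ℚ K - 1)) ^ N) ^ (p.n + p.m) := by
  obtain ⟨D, hD0, hD4, hD, hDv⟩ := p.exists_denominator hH hω hβ hα h1 h2 h3 h4 h5
  have hpt := p.sizeLE_point hH hα h1 h2 h3 h5
  set G : ℝ := 64 * H with hG
  have hG1 : 1 ≤ G := by linarith
  have hHG : H ≤ G := by linarith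
  set s := p.n + p.m with hs
  have hns : p.n ≤ s := Nat.le_add_right _ _
  have hD' : SizeLE φ q (18 * s) (G ^ (18 * s)) D :=
    hD.mono (by omega) (pow_le_pow_right₀ hG1 (by omega))
  have hDv' : SizeLE φ q (18 * s) (G ^ (18 * s)) (D * p.value β) :=
    hDv.mono (by omega) (pow_le_pow_right₀ hG1 (by omega))
  have hpow : ∀ k (e : Fin (N + 1)), SizeLE φ q (5 * s * N) (G ^ (5 * s * N))
      (p.point β k ^ (e : ℕ)) := by
    intro k e
    have he : (e : ℕ) ≤ N := by omega
    refine ((hpt k).pow e).mono ?_ ?_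
    · rw [mul_comm]
      exact Nat.mul_le_mul_left _ he
    · rw [← pow_mul]
      calc H ^ (5 * s * e) ≤ G ^ (5 * s * e) := by gcongr
        _ ≤ _ := pow_le_pow_right₀ hG1 (Nat.mul_le_mul_left _ he)
  have hsize : SizeLE φ q (38 * s * N) (coeffSum c * G ^ (38 * s * N))
      (D ^ N * auxSum c (p.point β) (p.value β)) := by
    rw [auxSum, Finset.mul_sum, coeffSum, Finset.sum_mul]
    refine SizeLE.sum _ fun x _ => ?_
    have hx : (x.2 : ℕ) ≤ N := by omega
    have e1 : D ^ N * ((c x : ℂ) * (∏ k, p.point β k ^ (x.1 k : ℕ)) * p.value β ^ (x.2 : ℕ)) =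
        (c x : ℂ) * ((∏ k, p.point β k ^ (x.1 k : ℕ)) *
          ((D * p.value β) ^ (x.2 : ℕ) * D ^ (N - x.2))) := by
      rw [← pow_mul_pow_sub D hx, mul_pow]
      ring
    rw [e1]
    refine ((SizeLE.intCast (c x)).mul ((SizeLE.prod Finset.univ fun k _ => hpow k (x.1 k)).mul
      ((hDv'.pow x.2).mul (hD'.pow (N - x.2))))).mono ?_ ?_
    · simp only [Finset.sum_const, Finset.card_univ, Fintype.card_fin, smul_eq_mul]
      have : (x.2 : ℕ) * (18 * s) + (N - x.2) * (18 * s) = 18 * s * N := by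
        rw [← Nat.add_mul, Nat.add_sub_cancel' hx, mul_comm]
      rw [this]
      apply le_of_eq
      ring
    · refine mul_le_mul_of_nonneg_left ?_ (abs_nonneg _)
      simp only [Finset.prod_const, Finset.card_univ, Fintype.card_fin]
      rw [← pow_mul, ← pow_mul, ← pow_mul, ← pow_add, ← pow_add]
      refine pow_le_pow_right₀ hG1 ?_
      have : 18 * s * x.2 + 18 * s * (N - x.2) = 18 * s * N := by
        rw [← Nat.mul_add, Nat.add_sub_cancel' hx]
      rw [this]
      apply le_of_eq
      ring
  have h := hsize.one_le_norm_mul hq (mul_ne_zero (pow_ne_zero _ hD0) hE)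
  refine h.trans ?_
  have hnorm : ‖D ^ N * auxSum c (p.point β) (p.value β)‖ ≤
      4 ^ N * ‖auxSum c (p.point β) (p.value β)‖ := by
    rw [norm_mul, norm_pow]
    gcongr
  have aux : ∀ (a b S : ℝ) (f g : ℕ), (a ^ (38 * s * N)) ^ f * (S * b ^ (38 * s * N)) ^ g =
      S ^ g * ((((a ^ 38) ^ f * (b ^ 38) ^ g) ^ N) ^ s) := by
    intro a b S f g
    rw [mul_pow S, mul_pow, mul_pow]
    simp only [← pow_mul]
    have e1 : 38 * s * N * f = 38 * f * N * s := by ring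
    have e2 : 38 * s * N * g = 38 * g * N * s := by ring
    rw [e1, e2]
    ring
  rw [aux]
  have hS := coeffSum_nonneg c
  calc ‖D ^ N * auxSum c (p.point β) (p.value β)‖ * (coeffSum c ^ (Module.finrank ℚ K - 1) *
        ((((q : ℝ) ^ 38) ^ Module.finrank ℚ K * (G ^ 38) ^ (Module.finrank ℚ K - 1)) ^ N) ^ s)
      ≤ 4 ^ N * ‖auxSum c (p.point β) (p.value β)‖ * (coeffSum c ^ (Module.finrank ℚ K - 1) *
        ((((q : ℝ) ^ 38) ^ Module.finrank ℚ K * (G ^ 38) ^ (Module.finrank ℚ K - 1)) ^ N) ^ s) := by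
        gcongr
    _ = _ := by ring

/-- There are parameters for which every sequence of Farey pairs whose double series share their
first coefficients satisfies a polynomial relation. -/
theorem BadlyApprox.exists_auxSum_eq_zero {K : Type*} [Field K] [NumberField K] {φ : K →+* ℂ}
    {q : ℕ} {H : ℝ} (hq : 1 ≤ q) (hH : 1 ≤ H) {ω β : ℝ} (hω : 0 < ω) (hβ : |β| < 1) {α : ℂ}
    (hα : α = Complex.exp ((π * ω / 2 : ℝ) * Complex.I))
    (h1 : SizeLE φ q 1 H α) (h2 : SizeLE φ q 1 H α⁻¹) (h3 : SizeLE φ q 1 H β)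
    (h4 : SizeLE φ q 1 H (∑' k : ℕ, max (cos (π * (k * ω) / 2)) 0 * β ^ k : ℝ))
    (h5 : SizeLE φ q 1 H Complex.I) {c₀ : ℝ} (hbad : BadlyApprox ω c₀) :
    ∃ N r : ℕ, ∀ a : ℕ → ℕ → ℤ, ∃ c : (Fin 4 → Fin (N + 1)) × Fin (N + 1) → ℤ, c ≠ 0 ∧
      ∃ n₀, ∀ p : FareyPair ω, n₀ ≤ p.n + p.m → p.Matches a r →
        auxSum c (p.point β) (p.value β) = 0 := by
  obtain ⟨L, n₁, hL0, hL⟩ := hbad.exists_ratio_bound hβ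
  set C₀ : ℝ := ((q : ℝ) ^ 38) ^ Module.finrank ℚ K *
    ((64 * H) ^ 38) ^ (Module.finrank ℚ K - 1) with hC₀
  have hq1 : (1 : ℝ) ≤ q := by exact_mod_cast hq
  have hC1 : 1 ≤ C₀ := one_le_mul_of_one_le_of_one_le (one_le_pow₀ (one_le_pow₀ hq1))
    (one_le_pow₀ (one_le_pow₀ (by linarith)))
  obtain ⟨M', hM'⟩ : ∃ M : ℕ, |β| ^ M < 1 / 2 / C₀ := exists_pow_lt_of_lt_one (by positivity) hβ
  set M := L * (M' + 1) with hM
  have hM0 : 0 < M := by positivity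
  refine ⟨M ^ 4, M * (M ^ 4 + 1), fun a => ?_⟩
  set N := M ^ 4 with hN
  set r := M * (N + 1) with hr
  obtain ⟨c, hc0, hc⟩ := exists_auxPoly_orderGE a (r := r) (N := N) (by positivity) (by
    rw [hr, mul_pow, ← hN, pow_succ (N + 1) 4, mul_comm]
    exact Nat.mul_lt_mul_of_pos_left (Nat.lt_succ_self N) (by positivity))
  refine ⟨c, hc0, ?_⟩
  set A : ℝ := coeffSum c * (N * 16 ^ N) * 8 + (auxPoly c a r).absSum with hA
  have hA0 : 0 ≤ A := by
    have := coeffSum_nonneg c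
    have := (auxPoly c a r).absSum_nonneg
    positivity
  set B : ℝ := 4 ^ N * coeffSum c ^ (Module.finrank ℚ K - 1) * (A * 2 ^ r) with hB
  have hB0 : 0 ≤ B := by
    have := coeffSum_nonneg c
    positivity
  obtain ⟨n₂, hn₂⟩ : ∃ n : ℕ, (1 / 2 : ℝ) ^ n < 1 / (B + 1) :=
    exists_pow_lt_of_lt_one (by positivity) (by norm_num)
  refine ⟨max n₁ n₂, fun p hp hpm => ?_⟩
  by_contra hE
  obtain ⟨t, ht0, ht, ht1, ht2, htL⟩ := hL p ((le_max_left _ _).trans hp)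
  have hlow := p.one_le_norm_auxSum_mul hq hH hω hβ hα h1 h2 h3 h4 h5 c hE
  have hup : ‖auxSum c (p.point β) (p.value β)‖ ≤ A * (2 * t) ^ r := by
    have e1 := p.norm_auxSum_sub_le hβ ht ht1 ht2 hpm c
    have e2 := hc.norm_eval₂_le (p := p.point β) ht0 (by linarith)
      (fun k => p.norm_point_le ht1 ht2 k)
    have e3 : t ^ r ≤ (2 * t) ^ r := pow_le_pow_left₀ ht0 (by linarith) _
    have e4 := norm_sub_norm_le (auxSum c (p.point β) (p.value β))
      (eval₂Hom (Int.castRingHom ℂ) (p.point β) (auxPoly c a r))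
    have e5 := mul_le_mul_of_nonneg_left e3 (auxPoly c a r).absSum_nonneg
    rw [hA, add_mul]
    linarith
  set s := p.n + p.m with hs
  have hb0 := abs_nonneg β
  have htr : t ^ r ≤ (|β| ^ M') ^ ((N + 1) * s) := by
    calc t ^ r = (t ^ L) ^ ((M' + 1) * (N + 1)) := by
          rw [← pow_mul, hr, hM, mul_assoc]
      _ ≤ (|β| ^ s) ^ ((M' + 1) * (N + 1)) := by gcongr
      _ = |β| ^ ((M' + 1) * ((N + 1) * s)) := by
          rw [← pow_mul]
          congr 1
          ring
      _ ≤ |β| ^ (M' * ((N + 1) * s)) :=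
          pow_le_pow_of_le_one hb0 hβ.le (Nat.mul_le_mul_right _ (Nat.le_succ _))
      _ = _ := by rw [pow_mul]
  have hfin : t ^ r * (C₀ ^ N) ^ s ≤ (1 / 2) ^ s := by
    calc t ^ r * (C₀ ^ N) ^ s ≤ (|β| ^ M') ^ ((N + 1) * s) * C₀ ^ ((N + 1) * s) := by
          rw [← pow_mul]
          refine mul_le_mul htr (pow_le_pow_right₀ hC1
            (Nat.mul_le_mul_right _ (Nat.le_succ _))) (by positivity) (by positivity)
      _ = (|β| ^ M' * C₀) ^ ((N + 1) * s) := (mul_pow _ _ _).symm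
      _ ≤ (1 / 2) ^ ((N + 1) * s) := by
          refine pow_le_pow_left₀ (by positivity) ?_ _
          rw [lt_div_iff₀ (by positivity)] at hM'
          exact hM'.le
      _ ≤ (1 / 2) ^ s :=
          pow_le_pow_of_le_one (by norm_num) (by norm_num) (Nat.le_mul_of_pos_left _ (by omega))
  have hS := coeffSum_nonneg c
  have : 4 ^ N * coeffSum c ^ (Module.finrank ℚ K - 1) *
      ‖auxSum c (p.point β) (p.value β)‖ * (C₀ ^ N) ^ s < 1 := by
    calc 4 ^ N * coeffSum c ^ (Module.finrank ℚ K - 1) *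
        ‖auxSum c (p.point β) (p.value β)‖ * (C₀ ^ N) ^ s
        ≤ 4 ^ N * coeffSum c ^ (Module.finrank ℚ K - 1) * (A * (2 * t) ^ r) * (C₀ ^ N) ^ s := by
          gcongr
      _ = B * (t ^ r * (C₀ ^ N) ^ s) := by rw [hB, mul_pow 2 t]; ring
      _ ≤ B * (1 / 2) ^ n₂ := by
          refine mul_le_mul_of_nonneg_left (hfin.trans ?_) hB0
          exact pow_le_pow_of_le_one (by norm_num) (by norm_num) ((le_max_right _ _).trans hp)
      _ ≤ B * (1 / (B + 1)) := by gcongr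
      _ < 1 := by
          rw [mul_one_div, div_lt_one (by linarith)]
          linarith
  linarith

theorem norm_eval₂_smul_le {F : MvPolynomial (Fin 4) ℤ} {r : ℕ} (hF : OrderGE r F)
    (p : Fin 4 → ℂ) {B : ℝ}
    (hB : ∀ u : ℂ, ‖u‖ = 1 → ‖eval₂Hom (Int.castRingHom ℂ) (fun k => u * p k) F‖ ≤ B)
    {u : ℂ} (hu : ‖u‖ ≤ 1) :
    ‖eval₂Hom (Int.castRingHom ℂ) (fun k => u * p k) F‖ ≤ ‖u‖ ^ r * B := by
  let G : ℂ → ℂ := fun u => ∑ μ ∈ F.support,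
    ((F.coeff μ : ℤ) : ℂ) * (∏ i ∈ μ.support, p i ^ μ i) * u ^ (μ.degree - r)
  have hG : ∀ u : ℂ, eval₂Hom (Int.castRingHom ℂ) (fun k => u * p k) F = u ^ r * G u := by
    intro u
    rw [coe_eval₂Hom, eval₂_eq, Finset.mul_sum]
    refine Finset.sum_congr rfl fun μ hμ => ?_
    have h1 : r ≤ μ.degree := by
      by_contra! hlt
      exact mem_support_iff.mp hμ (hF μ hlt)
    simp_rw [mul_pow]
    rw [Finset.prod_mul_distrib, Finset.prod_pow_eq_pow_sum, ← Finsupp.degree_apply]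
    conv_lhs => rw [← Nat.add_sub_cancel' h1]
    rw [pow_add, eq_intCast]
    ring
  have hd : Differentiable ℂ G := by
    dsimp only [G]
    fun_prop
  have h2 : ‖G u‖ ≤ B := by
    refine Complex.norm_le_of_forall_mem_frontier_norm_le (U := Metric.ball 0 1)
      Metric.isBounded_ball hd.diffContOnCl (fun z hz => ?_) ?_
    · rw [frontier_ball _ one_ne_zero, mem_sphere_zero_iff_norm] at hz
      have := hB z hz
      rwa [hG, norm_mul, norm_pow, hz, one_pow, one_mul] at this
    · rw [closure_ball _ one_ne_zero]
      simpa using hu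
  rw [hG, norm_mul, norm_pow]
  gcongr

theorem norm_auxSum_le {N : ℕ} (c : (Fin 4 → Fin (N + 1)) × Fin (N + 1) → ℤ) {p : Fin 4 → ℂ}
    {A : ℝ} (hA : 1 ≤ A) (hp : ∀ k, ‖p k‖ ≤ A) {y : ℂ} {B : ℝ} (hB : 1 ≤ B) (hy : ‖y‖ ≤ B) :
    ‖auxSum c p y‖ ≤ coeffSum c * ((A ^ N) ^ 4 * B ^ N) := by
  rw [auxSum, coeffSum, Finset.sum_mul]
  refine norm_sum_le_of_le _ fun x _ => ?_
  rw [norm_mul, norm_mul, Complex.norm_intCast, mul_assoc]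
  have h1 : ‖∏ k, p k ^ (x.1 k : ℕ)‖ ≤ (A ^ N) ^ 4 := by
    rw [norm_prod]
    refine (Finset.prod_le_prod (fun _ _ => norm_nonneg _) fun k _ => ?_).trans
      (b := ∏ k : Fin 4, A ^ N) (by simp)
    rw [norm_pow]
    calc ‖p k‖ ^ (x.1 k : ℕ) ≤ A ^ (x.1 k : ℕ) := by gcongr; exact hp k
      _ ≤ A ^ N := pow_le_pow_right₀ hA (by omega)
  have h2 : ‖y ^ (x.2 : ℕ)‖ ≤ B ^ N := by
    rw [norm_pow]
    calc ‖y‖ ^ (x.2 : ℕ) ≤ B ^ (x.2 : ℕ) := by gcongr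
      _ ≤ B ^ N := pow_le_pow_right₀ hB (by omega)
  gcongr

theorem norm_pairSum_le (a : ℕ → ℕ → ℤ) {x : ℝ} (hx0 : 0 < x) (hx : x < 1) {p : Fin 4 → ℂ}
    (h1 : ∀ i j, |(a i j : ℝ)| * (‖p 0‖ ^ i * ‖p 2‖ ^ j) ≤ x ^ i * x ^ j)
    (h2 : ∀ i j, |(a i j : ℝ)| * (‖p 1‖ ^ i * ‖p 3‖ ^ j) ≤ x ^ i * x ^ j) (r : ℕ) :
    ‖pairSum a r p‖ ≤ 2 * ((1 - x)⁻¹ * (1 - x)⁻¹) := by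
  have h3 : ∑ i ∈ Finset.range r, x ^ i ≤ (1 - x)⁻¹ := by
    rw [← tsum_geometric_of_lt_one hx0.le hx]
    exact (summable_geometric_of_lt_one hx0.le hx).sum_le_tsum _ fun _ _ => by positivity
  have h4 : 0 ≤ ∑ i ∈ Finset.range r, x ^ i := by positivity
  calc ‖pairSum a r p‖ ≤ ∑ z ∈ Finset.range r ×ˢ Finset.range r, 2 * (x ^ z.1 * x ^ z.2) := by
        refine norm_sum_le_of_le _ fun z _ => ?_
        rw [norm_mul, Complex.norm_intCast]
        refine (mul_le_mul_of_nonneg_left (norm_sub_le _ _) (abs_nonneg _)).trans ?_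
        rw [norm_mul, norm_mul, norm_pow, norm_pow, norm_pow, norm_pow]
        linarith [h1 z.1 z.2, h2 z.1 z.2]
    _ = 2 * ((∑ i ∈ Finset.range r, x ^ i) * ∑ i ∈ Finset.range r, x ^ i) := by
        rw [← Finset.mul_sum, Finset.sum_mul_sum, Finset.sum_product]
    _ ≤ _ := by gcongr

/-- If the auxiliary polynomials vanish to high order, then their values at a point inside the
domain of convergence tend to zero. -/
theorem tendsto_auxSum_zero {N : ℕ} (c : (Fin 4 → Fin (N + 1)) × Fin (N + 1) → ℤ)
    (a : ℕ → ℕ → ℤ) (h : ∀ r, OrderGE r (auxPoly c a r)) {s x : ℝ} (hs : 1 < s) (hx0 : 0 < x)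
    (hx : x < 1) (p : Fin 4 → ℝ)
    (h1 : ∀ i j, |(a i j : ℝ)| * ((s * |p 0|) ^ i * (s * |p 2|) ^ j) ≤ x ^ i * x ^ j)
    (h2 : ∀ i j, |(a i j : ℝ)| * ((s * |p 1|) ^ i * (s * |p 3|) ^ j) ≤ x ^ i * x ^ j) :
    Tendsto (fun r => auxSum c p (pairSum a r p)) atTop (nhds 0) := by
  obtain ⟨A, hA⟩ : ∃ A : ℝ, ∀ k, ‖(s * p k : ℂ)‖ ≤ A :=
    ⟨∑ k, ‖(s * p k : ℂ)‖, fun k => Finset.single_le_sum (f := fun k => ‖(s * p k : ℂ)‖)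
      (fun _ _ => norm_nonneg _) (Finset.mem_univ k)⟩
  have hs0 : 0 < s := by linarith
  have hn : ∀ (u : ℂ), ‖u‖ = 1 → ∀ k, ‖u * (s * p k : ℂ)‖ = s * |p k| := by
    intro u hu k
    rw [norm_mul, hu, one_mul, norm_mul, Complex.norm_real, Complex.norm_real, norm_eq_abs,
      norm_eq_abs, abs_of_pos hs0]
  set B : ℝ := coeffSum c * ((max A 1 ^ N) ^ 4 * max (2 * ((1 - x)⁻¹ * (1 - x)⁻¹)) 1 ^ N) with hB
  have key : ∀ r, |auxSum c p (pairSum a r p)| ≤ (s⁻¹) ^ r * B := by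
    intro r
    have h3 := norm_eval₂_smul_le (h r) (fun k => (s * p k : ℂ)) (B := B) (fun u hu => ?_)
      (u := (s⁻¹ : ℝ)) ?_
    · rw [eval₂Hom_auxPoly] at h3
      have e : (fun k => ((s⁻¹ : ℝ) : ℂ) * (s * p k : ℂ)) = fun k => Complex.ofRealHom (p k) := by
        funext k
        have : (s : ℂ) ≠ 0 := by exact_mod_cast hs0.ne'
        simp [this]
      rw [e, ← map_pairSum, ← map_auxSum] at h3
      simpa [abs_of_pos hs0] using h3
    · rw [eval₂Hom_auxPoly]
      refine norm_auxSum_le c (le_max_right _ _) (fun k => ?_) (le_max_right _ _)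
        ((norm_pairSum_le a hx0 hx ?_ ?_ r).trans (le_max_left _ _))
      · rw [norm_mul, hu, one_mul]
        exact (hA k).trans (le_max_left _ _)
      · intro i j
        rw [hn u hu, hn u hu]
        exact h1 i j
      · intro i j
        rw [hn u hu, hn u hu]
        exact h2 i j
    · rw [Complex.norm_real, norm_eq_abs, abs_of_pos (inv_pos.mpr hs0)]
      exact (inv_lt_one_of_one_lt₀ hs).le
  refine squeeze_zero_norm key ?_
  have := (tendsto_pow_atTop_nhds_zero_of_lt_one (inv_pos.mpr hs0).le
    (inv_lt_one_of_one_lt₀ hs)).mul_const B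
  simpa using this

/-- A form of the nonvanishing of the Vandermonde determinant. -/
theorem eq_zero_of_forall_sum_mul_pow_eq_zero {ι F : Type*} [Fintype ι] [Field F] {x : ι → F}
    (hx : Function.Injective x) {q : ι → F} (h : ∀ k : ℕ, ∑ i, q i * x i ^ k = 0) : q = 0 := by
  let e := Fintype.equivFin ι
  have := Matrix.eq_zero_of_forall_pow_sum_mul_pow_eq_zero (f := x ∘ e.symm) (v := q ∘ e.symm)
    (hx.comp e.symm.injective) (fun i => by
      rw [← h i]
      exact Equiv.sum_comp e.symm fun j => q j * x j ^ (i : ℕ))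
  funext i
  simpa using congrFun this (e i)

/-- The coefficients of the double series attached to a slope and to a parity class. -/
noncomputable def slopeCoeff (κ : ℝ) (c d : ℕ) (i j : ℕ) : ℤ :=
  open scoped Classical in if 1 ≤ j ∧ (j : ℝ) * κ < i ∧ Odd (i * c + j * d) then 1 else 0

/-- A family of points approaching the boundary of the domain of convergence of the double series
with coefficients `slopeCoeff κ c d`. -/
noncomputable def boundaryPoint (κ : ℝ) (N : ℕ) (ξ ζ : ℝ) : Fin 4 → ℝ :=
  ![exp (-ξ), exp (-((N + 1 : ℕ) * ξ)), exp (κ * ξ - ζ), exp (-((N + 1 : ℕ) ^ 2 * ξ))]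

section

variable {κ : ℝ} (c' d' : ℕ)

theorem abs_slopeCoeff_le (i j : ℕ) : |(slopeCoeff κ c' d' i j : ℝ)| ≤ 1 := by
  rw [slopeCoeff]
  split_ifs <;> simp

theorem tendsto_auxSum_boundaryPoint {N : ℕ} (c : (Fin 4 → Fin (N + 1)) × Fin (N + 1) → ℤ)
    (hκ : 0 < κ) (h : ∀ r, OrderGE r (auxPoly c (slopeCoeff κ c' d') r)) {ξ ζ : ℝ} (hξ : 0 < ξ)
    (hζ : 0 < ζ) :
    Tendsto (fun r => auxSum c (boundaryPoint κ N ξ ζ)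
      (pairSum (slopeCoeff κ c' d') r (boundaryPoint κ N ξ ζ))) atTop (nhds 0) := by
  set s : ℝ := min (ξ / 2) (ζ / (2 * (κ + 1))) with hs
  have hs0 : 0 < s := by positivity
  have hs1 : s ≤ ξ / 2 := min_le_left _ _
  have hs2 : s * (κ + 1) ≤ ζ / 2 := by
    have : s ≤ ζ / (2 * (κ + 1)) := min_le_right _ _
    rw [le_div_iff₀ (by positivity)] at this
    linarith
  refine tendsto_auxSum_zero c _ h (s := exp s) (x := exp (-s)) (by simpa using hs0)
    (exp_pos _) (by simpa using hs0) _ (fun i j => ?_) (fun i j => ?_)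
  · simp only [boundaryPoint, Matrix.cons_val, abs_exp]
    rw [slopeCoeff]
    split_ifs with hc
    · rw [Int.cast_one, abs_one, one_mul]
      simp only [← exp_add, ← exp_nat_mul]
      rw [exp_le_exp]
      have h1 : 0 < (i : ℝ) - j * κ := by linarith [hc.2.1]
      have h2 : (0 : ℝ) ≤ j := by positivity
      nlinarith [mul_le_mul_of_nonneg_left hs1 h1.le, mul_le_mul_of_nonneg_left hs2 h2]
    · simp only [Int.cast_zero, abs_zero, zero_mul]
      positivity
  · simp only [boundaryPoint, Matrix.cons_val, Matrix.cons_val_one, abs_exp]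
    refine (mul_le_of_le_one_left (by positivity) (abs_slopeCoeff_le c' d' i j)).trans ?_
    simp only [← exp_add, ← exp_nat_mul]
    rw [exp_le_exp]
    push_cast
    have h1 : (0 : ℝ) ≤ i := by positivity
    have h2 : (0 : ℝ) ≤ j := by positivity
    have h3 : (0 : ℝ) ≤ N := by positivity
    have h4 : s + -((N + 1) * ξ) ≤ - s := by nlinarith [mul_nonneg h3 hξ.le]
    have h5 : s + -((N + 1) ^ 2 * ξ) ≤ - s := by
      nlinarith [mul_nonneg h3 hξ.le, mul_nonneg (mul_nonneg h3 h3) hξ.le]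
    have := mul_le_mul_of_nonneg_left h4 h1
    have := mul_le_mul_of_nonneg_left h5 h2
    linarith

theorem exists_le_pairSum (hκ : 0 < κ) (hcd : Odd c' ∨ Odd d') (N : ℕ) {ξ : ℝ} (hξ : 0 < ξ)
    (K : ℝ) : ∃ ζ₀ : ℝ, 0 < ζ₀ ∧ ∀ ζ, 0 < ζ → ζ < ζ₀ → ∃ r₀, ∀ r ≥ r₀,
      K ≤ pairSum (slopeCoeff κ c' d') r (boundaryPoint κ N ξ ζ) := by
  have hi : ∀ t : ℕ, ∃ i : ℕ, ((2 * t + 1 : ℕ) : ℝ) * κ < i ∧ (i : ℝ) ≤ (2 * t + 1 : ℕ) * κ + 2 ∧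
      Odd (i * c' + (2 * t + 1) * d') := by
    intro t
    set y : ℝ := ((2 * t + 1 : ℕ) : ℝ) * κ with hy
    have h0 : 0 ≤ y := by positivity
    have h1 := Nat.lt_floor_add_one y
    have h2 := Nat.floor_le h0
    have h3 : Odd ((⌊y⌋₊ + 1) * c' + (2 * t + 1) * d') ∨
        Odd ((⌊y⌋₊ + 2) * c' + (2 * t + 1) * d') := by
      rcases Nat.even_or_odd c' with hc | hc
      · have hd : Odd d' := hcd.resolve_left (Nat.not_odd_iff_even.mpr hc)
        left
        exact (hc.mul_left _).add_odd ((odd_two_mul_add_one t).mul hd)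
      · by_contra! hcon
        rw [Nat.not_odd_iff_even, Nat.not_odd_iff_even] at hcon
        obtain ⟨u, hu⟩ := hcon.1
        obtain ⟨v, hv⟩ := hcon.2
        obtain ⟨w, hw⟩ := hc
        have e : (⌊y⌋₊ + 2) * c' + (2 * t + 1) * d' =
          (⌊y⌋₊ + 1) * c' + (2 * t + 1) * d' + c' := by ring
        omega
    rcases h3 with h3 | h3
    · exact ⟨_, by push_cast; linarith, by push_cast; linarith, h3⟩
    · exact ⟨_, by push_cast; linarith, by push_cast; linarith, h3⟩
  choose i hi1 hi2 hi3 using hi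
  set x := exp (-ξ) with hx
  have hx0 : 0 < x := exp_pos _
  have hx1 : x < 1 := by simpa [hx] using hξ
  set M : ℝ := (1 - x)⁻¹ * (1 - x)⁻¹ with hM
  obtain ⟨T, hT⟩ := exists_nat_ge ((K + M) / exp (-(2 * ξ) - 1))
  rw [div_le_iff₀ (exp_pos _)] at hT
  refine ⟨1 / (2 * T + 1), by positivity, fun ζ hζ0 hζ => ⟨2 * T + 1 + ∑ t ∈ Finset.range T, (i t + 1), fun r hr => ?_⟩⟩
  rw [lt_div_iff₀ (by positivity)] at hζ
  set p := boundaryPoint κ N ξ ζ with hp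
  have hp0 : ∀ k, 0 < p k := by
    intro k
    fin_cases k <;> simp [p, boundaryPoint, exp_pos]
  have ha0 : ∀ i j, (0 : ℝ) ≤ slopeCoeff κ c' d' i j := by
    intro i j
    rw [slopeCoeff]
    split_ifs <;> simp
  have ha1 : ∀ i j, (slopeCoeff κ c' d' i j : ℝ) ≤ 1 := fun i j =>
    (le_abs_self _).trans (abs_slopeCoeff_le c' d' i j)
  have e1 : pairSum (slopeCoeff κ c' d') r p =
      (∑ z ∈ Finset.range r ×ˢ Finset.range r,
        (slopeCoeff κ c' d' z.1 z.2 : ℝ) * (p 0 ^ z.1 * p 2 ^ z.2)) -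
      ∑ z ∈ Finset.range r ×ˢ Finset.range r,
        (slopeCoeff κ c' d' z.1 z.2 : ℝ) * (p 1 ^ z.1 * p 3 ^ z.2) := by
    rw [pairSum, ← Finset.sum_sub_distrib]
    exact Finset.sum_congr rfl fun z _ => by ring
  have h3 : ∑ i ∈ Finset.range r, x ^ i ≤ (1 - x)⁻¹ := by
    rw [← tsum_geometric_of_lt_one hx0.le hx1]
    exact (summable_geometric_of_lt_one hx0.le hx1).sum_le_tsum _ fun _ _ => by positivity
  have h4 : 0 ≤ ∑ i ∈ Finset.range r, x ^ i := by positivity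
  have e2 : ∑ z ∈ Finset.range r ×ˢ Finset.range r,
        (slopeCoeff κ c' d' z.1 z.2 : ℝ) * (p 1 ^ z.1 * p 3 ^ z.2) ≤ M := by
    have h1 : p 1 ≤ x := by
      simp only [p, boundaryPoint, Matrix.cons_val_one, Matrix.cons_val, x, exp_le_exp]
      push_cast
      nlinarith [mul_nonneg (Nat.cast_nonneg (α := ℝ) N) hξ.le]
    have h2 : p 3 ≤ x := by
      simp only [p, boundaryPoint, Matrix.cons_val, x, exp_le_exp]
      push_cast
      have h3 : (0 : ℝ) ≤ N := by positivity
      nlinarith [mul_nonneg h3 hξ.le, mul_nonneg (mul_nonneg h3 h3) hξ.le]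
    calc _ ≤ ∑ z ∈ Finset.range r ×ˢ Finset.range r, (x ^ z.1 * x ^ z.2) := by
          refine Finset.sum_le_sum fun z _ => ?_
          have := hp0 1
          have := hp0 3
          refine (mul_le_of_le_one_left (by positivity) (ha1 _ _)).trans ?_
          gcongr
      _ = (∑ i ∈ Finset.range r, x ^ i) * ∑ i ∈ Finset.range r, x ^ i := by
          rw [Finset.sum_mul_sum, Finset.sum_product]
      _ ≤ M := by rw [hM]; gcongr
  have e3 : T * exp (-(2 * ξ) - 1) ≤ ∑ z ∈ Finset.range r ×ˢ Finset.range r,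
        (slopeCoeff κ c' d' z.1 z.2 : ℝ) * (p 0 ^ z.1 * p 2 ^ z.2) := by
    have hinj : Set.InjOn (fun t : ℕ => (i t, 2 * t + 1)) (Finset.range T) := by
      intro t _ t' _ htt
      have := congrArg Prod.snd htt
      simp only at this
      omega
    have hsub : (Finset.range T).image (fun t : ℕ => (i t, 2 * t + 1)) ⊆
        Finset.range r ×ˢ Finset.range r := by
      intro z hz
      obtain ⟨t, ht, rfl⟩ := Finset.mem_image.mp hz
      have h1 := Finset.single_le_sum (f := fun t => i t + 1) (fun _ _ => Nat.zero_le _) ht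
      have := Finset.mem_range.mp ht
      simp only [Finset.mem_product, Finset.mem_range]
      omega
    refine le_trans ?_ (Finset.sum_le_sum_of_subset_of_nonneg hsub fun z _ _ => ?_)
    · rw [Finset.sum_image hinj]
      calc T * exp (-(2 * ξ) - 1) = ∑ t ∈ Finset.range T, exp (-(2 * ξ) - 1) := by simp
        _ ≤ _ := by
          refine Finset.sum_le_sum fun t ht => ?_
          have e : slopeCoeff κ c' d' (i t) (2 * t + 1) = 1 := by
            rw [slopeCoeff, if_pos ⟨by omega, hi1 t, hi3 t⟩]
          simp only [e, Int.cast_one, one_mul, p, boundaryPoint, Matrix.cons_val_zero,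
            Matrix.cons_val]
          simp only [← exp_add, ← exp_nat_mul]
          rw [exp_le_exp]
          have h1 : ((t : ℕ) : ℝ) + 1 ≤ T := by exact_mod_cast Finset.mem_range.mp ht
          have h2 := mul_le_mul_of_nonneg_right (hi2 t) hξ.le
          have h3 := mul_le_mul_of_nonneg_right h1 hζ0.le
          push_cast at h2 ⊢
          nlinarith
    · have := hp0 0
      have := hp0 2
      have := ha0 z.1 z.2
      positivity
  rw [e1]
  linarith

end

/-- The coefficient of `y ^ d` in `auxSum c p y`. -/
def auxCoeff {N : ℕ} (c : (Fin 4 → Fin (N + 1)) × Fin (N + 1) → ℤ) (d : Fin (N + 1))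
    (p : Fin 4 → ℝ) : ℝ := ∑ e, (c (e, d) : ℝ) * ∏ k, p k ^ (e k : ℕ)

theorem auxSum_eq_sum_auxCoeff {N : ℕ} (c : (Fin 4 → Fin (N + 1)) × Fin (N + 1) → ℤ)
    (p : Fin 4 → ℝ) (y : ℝ) : auxSum c p y = ∑ d, auxCoeff c d p * y ^ (d : ℕ) := by
  rw [auxSum, Fintype.sum_prod_type_right]
  exact Finset.sum_congr rfl fun d _ => by rw [auxCoeff, Finset.sum_mul]

theorem abs_auxCoeff_le {N : ℕ} (c : (Fin 4 → Fin (N + 1)) × Fin (N + 1) → ℤ) {D : Fin (N + 1)}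
    (hD : ∀ d, D < d → ∀ e, c (e, d) = 0) {p : Fin 4 → ℝ} {Q : ℝ} (hQ : ∀ d, |auxCoeff c d p| ≤ Q)
    {y : ℝ} (hy : 1 ≤ y) : |auxCoeff c D p| ≤ |auxSum c p y| + N * Q / y := by
  have hy0 : 0 < y := by linarith
  have hQ0 : 0 ≤ Q := (abs_nonneg _).trans (hQ 0)
  have e1 : auxCoeff c D p * y ^ (D : ℕ) = auxSum c p y -
      ∑ d ∈ Finset.univ.erase D, auxCoeff c d p * y ^ (d : ℕ) := by
    rw [auxSum_eq_sum_auxCoeff, ← Finset.add_sum_erase _ _ (Finset.mem_univ D)]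
    ring
  have h2 : ∀ d ∈ Finset.univ.erase D, |auxCoeff c d p * y ^ (d : ℕ)| ≤ Q * (y ^ (D : ℕ) / y) := by
    intro d hd
    rcases lt_or_gt_of_ne (Finset.ne_of_mem_erase hd) with hlt | hlt
    · rw [abs_mul, abs_pow, abs_of_pos hy0]
      refine mul_le_mul (hQ d) ?_ (by positivity) hQ0
      rw [le_div_iff₀ hy0, ← pow_succ]
      exact pow_le_pow_right₀ hy hlt
    · have : auxCoeff c d p = 0 := by
        rw [auxCoeff]
        exact Finset.sum_eq_zero fun e _ => by rw [hD d hlt e]; simp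
      rw [this, zero_mul, abs_zero]
      positivity
  have h3 : |auxCoeff c D p| * y ^ (D : ℕ) ≤ |auxSum c p y| + N * (Q * (y ^ (D : ℕ) / y)) := by
    have e2 : |auxCoeff c D p| * y ^ (D : ℕ) = |auxCoeff c D p * y ^ (D : ℕ)| := by
      rw [abs_mul, abs_pow, abs_of_pos hy0]
    rw [e2, e1]
    refine (abs_sub _ _).trans ?_
    gcongr
    refine (Finset.abs_sum_le_sum_abs _ _).trans ((Finset.sum_le_sum h2).trans ?_)
    rw [Finset.sum_const, Finset.card_erase_of_mem (Finset.mem_univ _)]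
    simp
  have h4 : (1 : ℝ) ≤ y ^ (D : ℕ) := one_le_pow₀ hy
  have h5 : |auxSum c p y| ≤ |auxSum c p y| * y ^ (D : ℕ) :=
    le_mul_of_one_le_right (abs_nonneg _) h4
  refine le_of_mul_le_mul_right ?_ (by linarith : 0 < y ^ (D : ℕ))
  calc _ ≤ _ := h3
    _ ≤ |auxSum c p y| * y ^ (D : ℕ) + N * (Q * (y ^ (D : ℕ) / y)) := by gcongr
    _ = _ := by ring

theorem exists_not_orderGE {N : ℕ} {c : (Fin 4 → Fin (N + 1)) × Fin (N + 1) → ℤ} (hc : c ≠ 0)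
    {κ : ℝ} (hκ : 0 < κ) (hirr : Irrational κ) {c' d' : ℕ} (hcd : Odd c' ∨ Odd d') :
    ∃ r, ¬ OrderGE r (auxPoly c (slopeCoeff κ c' d') r) := by
  by_contra! h
  obtain ⟨x₀, hx₀⟩ := Function.ne_iff.mp hc
  classical
  let S : Finset (Fin (N + 1)) := Finset.univ.filter fun d => ∃ e, c (e, d) ≠ 0
  have hS : S.Nonempty := ⟨x₀.2, by simp only [S, Finset.mem_filter_univ]; exact ⟨x₀.1, hx₀⟩⟩
  set D := S.max' hS with hD
  have hD1 : ∀ d, D < d → ∀ e, c (e, d) = 0 := by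
    intro d hd e
    by_contra hne
    exact absurd (S.le_max' d (by simp only [S, Finset.mem_filter_univ]; exact ⟨e, hne⟩)) (not_le.mpr hd)
  have hD2 : ∃ e, c (e, D) ≠ 0 := by
    have := S.max'_mem hS
    simpa only [S, Finset.mem_filter_univ] using this
  have hcont : ∀ ξ d, Continuous fun ζ => auxCoeff c d (boundaryPoint κ N ξ ζ) := by
    intro ξ d
    have : ∀ k, Continuous fun ζ => boundaryPoint κ N ξ ζ k := by
      intro k
      fin_cases k <;> simp [boundaryPoint] <;> fun_prop
    unfold auxCoeff
    fun_prop
  have hzero : ∀ ξ, 0 < ξ → auxCoeff c D (boundaryPoint κ N ξ 0) = 0 := by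
    intro ξ hξ
    obtain ⟨Q, hQ⟩ : ∃ Q, ∀ d, ∀ ζ ∈ Set.Icc (0 : ℝ) 1,
        |auxCoeff c d (boundaryPoint κ N ξ ζ)| ≤ Q := by
      have : ∀ d, ∃ Q, ∀ ζ ∈ Set.Icc (0 : ℝ) 1, |auxCoeff c d (boundaryPoint κ N ξ ζ)| ≤ Q :=
        fun d => isCompact_Icc.exists_bound_of_continuousOn (hcont ξ d).continuousOn
      choose q hq using this
      refine ⟨∑ d, |q d|, fun d ζ hζ => (hq d ζ hζ).trans ((le_abs_self _).trans ?_)⟩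
      exact Finset.single_le_sum (f := fun d => |q d|) (fun _ _ => abs_nonneg _) (Finset.mem_univ d)
    have hQ0 : 0 ≤ Q := (abs_nonneg _).trans (hQ 0 0 (by simp))
    refine abs_nonpos_iff.mp (le_of_forall_pos_le_add fun ε hε => ?_)
    rw [zero_add]
    have hK : ∃ K : ℝ, 1 ≤ K ∧ N * Q / K ≤ ε := by
      refine ⟨N * Q / ε + 1, by simp only [le_add_iff_nonneg_left]; positivity, ?_⟩
      rw [div_le_iff₀ (by positivity)]
      have : ε * (N * Q / ε) = N * Q := by field_simp
      nlinarith
    obtain ⟨K, hK1, hK2⟩ := hK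
    obtain ⟨ζ₀, hζ₀, hb⟩ := exists_le_pairSum c' d' hκ hcd N hξ K
    have hev : ∀ᶠ ζ in nhdsWithin (0 : ℝ) (Set.Ioi 0),
        |auxCoeff c D (boundaryPoint κ N ξ ζ)| ≤ ε := by
      filter_upwards [Ioo_mem_nhdsGT (lt_min hζ₀ one_pos)] with ζ hζ
      obtain ⟨r₀, hr₀⟩ := hb ζ hζ.1 (hζ.2.trans_le (min_le_left _ _))
      have ht := (tendsto_auxSum_boundaryPoint c' d' c hκ h hξ hζ.1).abs.add_const ε
      rw [abs_zero, zero_add] at ht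
      refine ge_of_tendsto ht ?_
      filter_upwards [eventually_ge_atTop r₀] with r hr
      have h1 := hr₀ r hr
      refine (abs_auxCoeff_le c hD1 (fun d => hQ d ζ
        ⟨hζ.1.le, (hζ.2.trans_le (min_le_right _ _)).le⟩) (hK1.trans h1)).trans ?_
      have h0 : 0 < K := by linarith
      have : N * Q / pairSum (slopeCoeff κ c' d') r (boundaryPoint κ N ξ ζ) ≤ N * Q / K := by
        gcongr
      linarith
    exact le_of_tendsto (((hcont ξ D).abs.tendsto 0).mono_left nhdsWithin_le_nhds) hev
  let lam : (Fin 4 → Fin (N + 1)) → ℝ := fun e =>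
    κ * (e 2 : ℕ) - ((e 0 : ℕ) + (N + 1 : ℕ) * (e 1 : ℕ) + (N + 1 : ℕ) ^ 2 * (e 3 : ℕ) : ℕ)
  have hlam : Function.Injective lam := by
    intro e f hef
    simp only [lam] at hef
    have h2 : (e 2 : ℕ) = f 2 := by
      by_contra hne
      have hne' : ((e 2 : ℕ) : ℤ) - (f 2 : ℕ) ≠ 0 := by omega
      refine (hirr.mul_intCast hne').ne_int
        ((((e 0 : ℕ) + (N + 1 : ℕ) * (e 1 : ℕ) + (N + 1 : ℕ) ^ 2 * (e 3 : ℕ) : ℕ) : ℤ) -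
        (((f 0 : ℕ) + (N + 1 : ℕ) * (f 1 : ℕ) + (N + 1 : ℕ) ^ 2 * (f 3 : ℕ) : ℕ) : ℤ)) ?_
      rw [Int.cast_sub, Int.cast_sub, Int.cast_natCast, Int.cast_natCast, Int.cast_natCast,
        Int.cast_natCast]
      linarith
    have h3 : (e 0 : ℕ) + (N + 1) * (e 1 : ℕ) + (N + 1) ^ 2 * (e 3 : ℕ) =
        (f 0 : ℕ) + (N + 1) * (f 1 : ℕ) + (N + 1) ^ 2 * (f 3 : ℕ) := by
      rw [h2] at hef
      exact_mod_cast sub_right_injective hef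
    have h3' : (e 0 : ℕ) + (N + 1) * ((e 1 : ℕ) + (N + 1) * (e 3 : ℕ)) =
        (f 0 : ℕ) + (N + 1) * ((f 1 : ℕ) + (N + 1) * (f 3 : ℕ)) := by linarith
    have h0 : (e 0 : ℕ) = f 0 := by
      have := congrArg (· % (N + 1)) h3'
      simpa [Nat.add_mul_mod_self_left, Nat.mod_eq_of_lt (e 0).2, Nat.mod_eq_of_lt (f 0).2]
        using this
    rw [h0] at h3'
    have h4 := Nat.eq_of_mul_eq_mul_left (Nat.succ_pos N) (Nat.add_left_cancel h3')
    have h1 : (e 1 : ℕ) = f 1 := by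
      have := congrArg (· % (N + 1)) h4
      simpa [Nat.add_mul_mod_self_left, Nat.mod_eq_of_lt (e 1).2, Nat.mod_eq_of_lt (f 1).2]
        using this
    rw [h1] at h4
    have h5 := Nat.eq_of_mul_eq_mul_left (Nat.succ_pos N) (Nat.add_left_cancel h4)
    funext k
    apply Fin.ext
    fin_cases k
    exacts [h0, h1, h2, h5]
  have hv := eq_zero_of_forall_sum_mul_pow_eq_zero (x := fun e => exp (lam e))
    (exp_injective.comp hlam) (q := fun e => (c (e, D) : ℝ) * exp (lam e)) (fun k => by
      rw [← hzero (k + 1 : ℕ) (by positivity), auxCoeff]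
      refine Finset.sum_congr rfl fun e _ => ?_
      rw [mul_assoc, ← pow_succ', Fin.prod_univ_four]
      congr 1
      simp only [boundaryPoint, Matrix.cons_val, Matrix.cons_val_zero, Matrix.cons_val_one, lam]
      simp only [← exp_add, ← exp_nat_mul]
      congr 1
      push_cast
      ring)
  obtain ⟨e, he⟩ := hD2
  have := congrFun hv e
  simp only [Pi.zero_apply, mul_eq_zero, Int.cast_eq_zero, exp_ne_zero, or_false] at this
  exact he this

/-- Near an irrational slope, the linear forms attached to the monomials of a polynomial are
minimized by one of them. -/
theorem exists_min_weight {s : Finset (ℕ × ℕ)} (hs : s.Nonempty) {τ₀ : ℝ} (hτ₀ : Irrational τ₀) :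
    ∃ x ∈ s, ∃ δ > 0, ∀ᶠ τ in nhds τ₀, ∀ y ∈ s, y ≠ x →
      (x.1 : ℝ) * τ + x.2 + δ ≤ y.1 * τ + y.2 := by
  obtain ⟨x, hx, hmin⟩ := s.exists_min_image (fun x => (x.1 : ℝ) * τ₀ + x.2) hs
  have hlt : ∀ y ∈ s, y ≠ x → (x.1 : ℝ) * τ₀ + x.2 < y.1 * τ₀ + y.2 := by
    intro y hy hne
    refine lt_of_le_of_ne (hmin y hy) fun he => ?_
    by_cases h1 : x.1 = y.1
    · rw [h1] at he
      exact hne (Prod.ext h1.symm (by exact_mod_cast (add_left_cancel he).symm))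
    · have h2 : ((x.1 : ℤ) - y.1) ≠ 0 := by omega
      refine (hτ₀.intCast_mul h2).ne_int ((y.2 : ℤ) - x.2) ?_
      push_cast
      linarith
  have h1 : ∀ᶠ δ in nhdsWithin (0 : ℝ) (Set.Ioi 0), ∀ y ∈ s, y ≠ x →
      (x.1 : ℝ) * τ₀ + x.2 + δ < y.1 * τ₀ + y.2 := by
    rw [eventually_all_finset]
    intro y hy
    by_cases hne : y = x
    · exact Eventually.of_forall fun _ h => absurd hne h
    · filter_upwards [Ioo_mem_nhdsGT (sub_pos.mpr (hlt y hy hne))] with δ hδ _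
      linarith [hδ.2]
  obtain ⟨δ, hδ1, hδ2⟩ := (h1.and self_mem_nhdsWithin).exists
  refine ⟨x, hx, δ, hδ2, ?_⟩
  rw [eventually_all_finset]
  intro y hy
  by_cases hne : y = x
  · exact Eventually.of_forall fun _ h => absurd hne h
  · have hc1 : ContinuousAt (fun τ : ℝ => (x.1 : ℝ) * τ + x.2 + δ) τ₀ := by fun_prop
    have hc2 : ContinuousAt (fun τ : ℝ => (y.1 : ℝ) * τ + y.2) τ₀ := by fun_prop
    filter_upwards [hc1.eventually_lt hc2 (hδ1 y hy hne)] with τ hτ _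
    exact hτ.le

namespace FareyPair

variable {ω : ℝ} (p : FareyPair ω)

theorem prod_point_pow (β : ℝ) (e : Fin 4 → ℕ) :
    ∏ k, p.point β k ^ e k = (β : ℂ) ^ ((e 0 + e 1) * p.n + (e 2 + e 3) * p.m) *
      (Complex.exp (-(π / 2 * ((e 0 + e 1 : ℕ) * p.lo - (e 2 + e 3 : ℕ) * p.hi) : ℝ) * Complex.I) *
        Complex.exp ((π * (e 0 * p.lo - e 2 * p.hi) : ℝ) * Complex.I)) := by
  simp only [Fin.prod_univ_four, point, Matrix.cons_val, Matrix.cons_val_zero,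
    Matrix.cons_val_one, mul_pow, ← Complex.exp_nat_mul, ← pow_mul]
  have e1 : ∀ A B C D E F G H : ℂ, A * B * (C * D) * (E * F) * (G * H) =
      (A * C * E * G) * (B * D * F * H) := by
    intros
    ring
  rw [e1]
  simp only [← pow_add, ← Complex.exp_add]
  congr 2
  · ring
  · push_cast
    ring

theorem norm_leading_sum_le {β : ℝ} (hβ0 : β ≠ 0) (hβ : |β| < 1) (G : MvPolynomial (Fin 4) ℤ)
    {x : ℕ × ℕ} {δ : ℝ} {W : ℕ} {C : ℝ}
    (hx : ∀ μ ∈ G.support, (μ 0 + μ 1, μ 2 + μ 3) ≠ x →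
      (x.1 : ℝ) * (p.n / p.m) + x.2 + δ ≤ (μ 0 + μ 1 : ℕ) * (p.n / p.m) + (μ 2 + μ 3 : ℕ))
    (hW : x.1 * p.n + x.2 * p.m ≤ W * (p.n + p.m))
    (hC : ‖eval₂Hom (Int.castRingHom ℂ) (p.point β) G‖ ≤ C * |β| ^ ((W + 1) * (p.n + p.m))) :
    ‖∑ μ ∈ G.support with (μ 0 + μ 1, μ 2 + μ 3) = x, ((G.coeff μ : ℤ) : ℂ) *
      Complex.exp ((π * (μ 0 * p.lo - μ 2 * p.hi) : ℝ) * Complex.I)‖ ≤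
    C * |β| ^ (p.n + p.m) + G.absSum * |β| ^ (δ * p.m) := by
  have hb0 : 0 < |β| := abs_pos.mpr hβ0
  have hm : (0 : ℝ) < p.m := by exact_mod_cast p.m_pos
  set V := x.1 * p.n + x.2 * p.m with hV
  set F : (Fin 4 →₀ ℕ) → ℂ := fun μ => ((G.coeff μ : ℤ) : ℂ) * ∏ k, p.point β k ^ μ k with hF
  have hsum : eval₂Hom (Int.castRingHom ℂ) (p.point β) G = ∑ μ ∈ G.support, F μ := by
    rw [coe_eval₂Hom, eval₂_eq']
    rfl
  rw [← Finset.sum_filter_add_sum_filter_not _ (fun μ : Fin 4 →₀ ℕ => (μ 0 + μ 1, μ 2 + μ 3) = x)]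
    at hsum
  have h1 : ‖∑ μ ∈ G.support with (μ 0 + μ 1, μ 2 + μ 3) = x, F μ‖ = |β| ^ V *
      ‖∑ μ ∈ G.support with (μ 0 + μ 1, μ 2 + μ 3) = x, ((G.coeff μ : ℤ) : ℂ) *
      Complex.exp ((π * (μ 0 * p.lo - μ 2 * p.hi) : ℝ) * Complex.I)‖ := by
    have e : ‖(β : ℂ) ^ V * Complex.exp (-(π / 2 * (x.1 * p.lo - x.2 * p.hi) : ℝ) * Complex.I)‖ =
        |β| ^ V := by
      rw [norm_mul, norm_pow, Complex.norm_real, norm_eq_abs, ← Complex.ofReal_neg,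
        Complex.norm_exp_ofReal_mul_I, mul_one]
    rw [← e, ← norm_mul, Finset.mul_sum]
    congr 1
    refine Finset.sum_congr rfl fun μ hμ => ?_
    have h2 := (Finset.mem_filter.mp hμ).2
    rw [hF]
    simp only
    rw [p.prod_point_pow β μ, hV, ← h2]
    ring
  have h2 : ‖∑ μ ∈ G.support with ¬ (μ 0 + μ 1, μ 2 + μ 3) = x, F μ‖ ≤
      |β| ^ V * (G.absSum * |β| ^ (δ * p.m)) := by
    rw [absSum, mul_left_comm, Finset.sum_mul]
    refine (norm_sum_le _ _).trans ((Finset.sum_le_sum (g := fun μ =>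
      |((G.coeff μ : ℤ) : ℝ)| * (|β| ^ V * |β| ^ (δ * p.m))) fun μ hμ => ?_).trans
      (Finset.sum_le_sum_of_subset_of_nonneg (Finset.filter_subset _ _)
        fun _ _ _ => by positivity))
    obtain ⟨hμ1, hμ2⟩ := Finset.mem_filter.mp hμ
    simp only [hF]
    rw [norm_mul, Complex.norm_intCast]
    refine mul_le_mul_of_nonneg_left ?_ (abs_nonneg _)
    rw [p.prod_point_pow β μ, norm_mul, norm_pow, Complex.norm_real, norm_eq_abs, norm_mul,
      ← Complex.ofReal_neg, Complex.norm_exp_ofReal_mul_I, Complex.norm_exp_ofReal_mul_I, mul_one,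
      mul_one, ← rpow_natCast, ← rpow_natCast, ← rpow_add hb0]
    refine rpow_le_rpow_of_exponent_ge hb0 hβ.le ?_
    have h3 := mul_le_mul_of_nonneg_right (hx μ hμ1 hμ2) hm.le
    have e3 : ∀ a b : ℝ, (a * (p.n / p.m) + b) * p.m = a * p.n + b * p.m := by
      intro a b
      field_simp
    rw [add_mul, e3, e3] at h3
    rw [hV]
    push_cast at h3 ⊢
    linarith
  have h3 : |β| ^ V * ‖∑ μ ∈ G.support with (μ 0 + μ 1, μ 2 + μ 3) = x, ((G.coeff μ : ℤ) : ℂ) *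
      Complex.exp ((π * (μ 0 * p.lo - μ 2 * p.hi) : ℝ) * Complex.I)‖ ≤
      |β| ^ V * (C * |β| ^ (p.n + p.m) + G.absSum * |β| ^ (δ * p.m)) := by
    rw [← h1, eq_sub_of_add_eq hsum.symm, mul_add]
    refine (norm_sub_le _ _).trans (add_le_add (hC.trans ?_) h2)
    have hC0 : 0 ≤ C := nonneg_of_mul_nonneg_left ((norm_nonneg _).trans hC) (by positivity)
    rw [add_mul, one_mul, pow_add, mul_left_comm]
    have h4 : |β| ^ (W * (p.n + p.m)) ≤ |β| ^ V := pow_le_pow_of_le_one hb0.le hβ.le hW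
    gcongr
  exact le_of_mul_le_mul_left h3 (by positivity)

end FareyPair

theorem eventually_mul_lt_iff {κ₀ : ℝ} (hκ₀ : Irrational κ₀) (r : ℕ) :
    ∀ᶠ κ in nhds κ₀, ∀ i < r, ∀ j < r, 1 ≤ j → ((j : ℝ) * κ < i ↔ (j : ℝ) * κ₀ < i) := by
  have : ∀ᶠ κ in nhds κ₀, ∀ i ∈ Finset.range r, ∀ j ∈ Finset.range r,
      1 ≤ j → ((j : ℝ) * κ < i ↔ (j : ℝ) * κ₀ < i) := by
    rw [eventually_all_finset]
    intro i _
    rw [eventually_all_finset]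
    intro j _
    by_cases hj : 1 ≤ j
    · have hc1 : ContinuousAt (fun κ : ℝ => (j : ℝ) * κ) κ₀ := by fun_prop
      have hc2 : ContinuousAt (fun _ : ℝ => (i : ℝ)) κ₀ := by fun_prop
      rcases lt_or_gt_of_ne ((hκ₀.natCast_mul (by omega : j ≠ 0)).ne_nat i) with hlt | hlt
      · filter_upwards [hc1.eventually_lt hc2 hlt] with κ hκ _
        exact iff_of_true hκ hlt
      · filter_upwards [hc2.eventually_lt hc1 hlt] with κ hκ _
        exact iff_of_false hκ.not_gt hlt.not_gt
    · exact Eventually.of_forall fun _ h => absurd h hj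
  simpa only [Finset.mem_range] using this

theorem odd_combination_iff {c d c' d' : ℕ} (hc : Odd c ↔ Odd c') (hd : Odd d ↔ Odd d') (i j : ℕ) :
    Odd (i * c + j * d) ↔ Odd (i * c' + j * d') := by
  simp only [Nat.odd_add, Nat.odd_mul, ← Nat.not_odd_iff_even, hc, hd]

theorem FareyPair.matches_slopeCoeff {ω : ℝ} (p : FareyPair ω) {κ₀ : ℝ} {c' d' : ℕ} {r : ℕ}
    (h : ∀ i < r, ∀ j < r, 1 ≤ j → ((j : ℝ) * p.slope < i ↔ (j : ℝ) * κ₀ < i))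
    (hc : Odd p.c ↔ Odd c') (hd : Odd p.d ↔ Odd d') : p.Matches (slopeCoeff κ₀ c' d') r := by
  intro i hi j hj
  rw [slopeCoeff, pattern]
  by_cases h1 : 1 ≤ j
  · simp only [h i hi j hj h1, odd_combination_iff hc hd]
    split_ifs <;> simp
  · simp [h1]

/-- Near a datum with irrational entries, an exponential polynomial with integer coefficients is
exponentially small at the Farey pairs. -/
theorem BadlyApprox.exists_local_estimate {ω c₀ β : ℝ} (hbad : BadlyApprox ω c₀) (hβ0 : β ≠ 0)
    (hβ : |β| < 1)
    (hvan : ∃ N r : ℕ, ∀ a : ℕ → ℕ → ℤ, ∃ c : (Fin 4 → Fin (N + 1)) × Fin (N + 1) → ℤ, c ≠ 0 ∧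
      ∃ n₀, ∀ p : FareyPair ω, n₀ ≤ p.n + p.m → p.Matches a r →
        auxSum c (p.point β) (p.value β) = 0)
    {κ₀ τ₀ : ℝ} (hκ₀ : 0 < κ₀) (hκ : Irrational κ₀) (hτ : Irrational τ₀) {c' d' : ℕ}
    (hcd : Odd c' ∨ Odd d') :
    ∃ S : Finset (ℕ × ℕ), S.Nonempty ∧ ∃ q : ℕ × ℕ → ℤ, (∀ x ∈ S, q x ≠ 0) ∧
      ∃ C ρ : ℝ, 0 ≤ ρ ∧ ρ < 1 ∧ ∃ U ∈ nhds (κ₀, τ₀), ∃ n₀, ∀ p : FareyPair ω,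
        (p.slope, (p.n : ℝ) / p.m) ∈ U → (Odd p.c ↔ Odd c') → (Odd p.d ↔ Odd d') →
        n₀ ≤ p.n + p.m →
        ‖∑ x ∈ S, (q x : ℂ) * Complex.exp ((π * (x.1 * p.lo - x.2 * p.hi) : ℝ) * Complex.I)‖ ≤
          C * ρ ^ (p.n + p.m) := by
  have hb0 : 0 < |β| := abs_pos.mpr hβ0
  obtain ⟨N, r, hvan⟩ := hvan
  set a := slopeCoeff κ₀ c' d' with ha
  obtain ⟨c, hc0, n₀, hc⟩ := hvan a
  obtain ⟨R, hR⟩ := exists_not_orderGE hc0 hκ₀ hκ hcd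
  simp only [OrderGE, not_forall] at hR
  obtain ⟨μ₀, hμ₀, hμ₀'⟩ := hR
  obtain ⟨L, n₁, hL0, hL⟩ := hbad.exists_ratio_bound hβ
  obtain ⟨L₂, hL₂0, hL₂⟩ := hbad.exists_mul_ge
  set W := μ₀.degree with hW
  set r' := max (max R r) (L * (W + 1)) with hr'
  have hRr : R ≤ r' := (le_max_left _ _).trans (le_max_left _ _)
  have hrr : r ≤ r' := (le_max_right _ _).trans (le_max_left _ _)
  have hLr : L * (W + 1) ≤ r' := le_max_right _ _
  set G := auxPoly c a r' with hG
  have hμG : μ₀ ∈ G.support := by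
    have := orderGE_auxPoly_sub c a hRr μ₀ hμ₀
    rw [coeff_sub, sub_eq_zero] at this
    rw [mem_support_iff, hG, this]
    exact hμ₀'
  let w : (Fin 4 →₀ ℕ) → ℕ × ℕ := fun μ => (μ 0 + μ 1, μ 2 + μ 3)
  obtain ⟨x, hx, δ, hδ, hmin⟩ := exists_min_weight (s := G.support.image w)
    ⟨_, Finset.mem_image_of_mem w hμG⟩ hτ
  obtain ⟨μ₁, hμ₁, hμ₁x⟩ := Finset.mem_image.mp hx
  set T := G.support.filter fun μ => (μ 0 + μ 1, μ 2 + μ 3) = x with hT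
  let v : ℕ × ℕ → (Fin 4 →₀ ℕ) := fun z =>
    Finsupp.equivFunOnFinite.symm ![z.1, x.1 - z.1, z.2, x.2 - z.2]
  have hv : ∀ μ ∈ T, v (μ 0, μ 2) = μ := by
    intro μ hμ
    have h1 := (Finset.mem_filter.mp hμ).2
    have h2 : x.1 = μ 0 + μ 1 := by rw [← h1]
    have h3 : x.2 = μ 2 + μ 3 := by rw [← h1]
    ext k
    fin_cases k <;> simp [v, h2, h3]
  have hinj : Set.InjOn (fun μ : Fin 4 →₀ ℕ => (μ 0, μ 2)) T := by
    intro μ hμ ν hν h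
    rw [← hv μ hμ, ← hv ν hν]
    exact congrArg v h
  have hδL : 0 < δ / L₂ := by positivity
  set ρ := max |β| (|β| ^ (δ / L₂)) with hρ
  have hρ0 : 0 ≤ ρ := hb0.le.trans (le_max_left _ _)
  have hρ1 : ρ < 1 := max_lt hβ (rpow_lt_one hb0.le hβ hδL)
  set C₁ : ℝ := coeffSum c * (N * 16 ^ N) * 8 * 2 ^ r' with hC₁
  have hC₁0 : 0 ≤ C₁ := by
    have := coeffSum_nonneg c
    positivity
  refine ⟨T.image fun μ => (μ 0, μ 2), ⟨_, Finset.mem_image_of_mem _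
    (Finset.mem_filter.mpr ⟨hμ₁, hμ₁x⟩)⟩, fun z => G.coeff (v z), ?_, C₁ + G.absSum, ρ, hρ0, hρ1,
    {z | (∀ i < r', ∀ j < r', 1 ≤ j → ((j : ℝ) * z.1 < i ↔ (j : ℝ) * κ₀ < i)) ∧
      ∀ y ∈ G.support.image w, y ≠ x → (x.1 : ℝ) * z.2 + x.2 + δ ≤ y.1 * z.2 + y.2}, ?_,
    max n₀ n₁, fun p hpU hpc hpd hp => ?_⟩
  · intro z hz
    obtain ⟨μ, hμ, rfl⟩ := Finset.mem_image.mp hz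
    simp only
    rw [hv μ hμ]
    exact mem_support_iff.mp (Finset.mem_filter.mp hμ).1
  · rw [nhds_prod_eq]
    exact (eventually_mul_lt_iff hκ r').prod_mk hmin
  · obtain ⟨hp1, hp2⟩ := hpU
    simp only at hp1 hp2
    have hmat : p.Matches a r' := p.matches_slopeCoeff hp1 hpc hpd
    have h0 := hc p ((le_max_left _ _).trans hp)
      fun i hi j hj => hmat i (hi.trans_le hrr) j (hj.trans_le hrr)
    obtain ⟨t, ht0, ht1, ht2, ht3, ht4⟩ := hL p ((le_max_right _ _).trans hp)
    have h1 := p.norm_auxSum_sub_le hβ ht1 ht2 ht3 hmat c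
    rw [h0, zero_sub, norm_neg] at h1
    have h2 : (2 * t) ^ r' ≤ 2 ^ r' * |β| ^ ((W + 1) * (p.n + p.m)) := by
      rw [mul_pow]
      gcongr
      calc t ^ r' ≤ t ^ (L * (W + 1)) := pow_le_pow_of_le_one ht0 (by linarith) hLr
        _ = (t ^ L) ^ (W + 1) := pow_mul _ _ _
        _ ≤ (|β| ^ (p.n + p.m)) ^ (W + 1) := by gcongr
        _ = _ := by rw [← pow_mul, mul_comm]
    have h3 : ‖eval₂Hom (Int.castRingHom ℂ) (p.point β) G‖ ≤
        C₁ * |β| ^ ((W + 1) * (p.n + p.m)) := by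
      refine h1.trans ?_
      have := coeffSum_nonneg c
      calc _ ≤ coeffSum c * (N * 16 ^ N) * 8 * (2 ^ r' * |β| ^ ((W + 1) * (p.n + p.m))) := by
            gcongr
        _ = _ := by rw [hC₁]; ring
    have hm : (0 : ℝ) < p.m := by exact_mod_cast p.m_pos
    have hn : (0 : ℝ) < p.n := by exact_mod_cast p.n_pos
    have h4 : ∀ μ ∈ G.support, (μ 0 + μ 1, μ 2 + μ 3) ≠ x →
        (x.1 : ℝ) * (p.n / p.m) + x.2 + δ ≤ (μ 0 + μ 1 : ℕ) * (p.n / p.m) + (μ 2 + μ 3 : ℕ) :=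
      fun μ hμ hne => hp2 (w μ) (Finset.mem_image_of_mem w hμ) hne
    have h5 : x.1 * p.n + x.2 * p.m ≤ W * (p.n + p.m) := by
      have hWe : W = μ₀ 0 + μ₀ 1 + (μ₀ 2 + μ₀ 3) := by
        rw [hW, Finsupp.degree_eq_sum, Fin.sum_univ_four]
        ring
      have h6 : x.1 * p.n + x.2 * p.m ≤ (μ₀ 0 + μ₀ 1) * p.n + (μ₀ 2 + μ₀ 3) * p.m := by
        by_cases hne : (μ₀ 0 + μ₀ 1, μ₀ 2 + μ₀ 3) = x
        · rw [← hne]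
        · have h7 := h4 μ₀ hμG hne
          have h8 : (x.1 : ℝ) * (p.n / p.m) + x.2 ≤
            (μ₀ 0 + μ₀ 1 : ℕ) * (p.n / p.m) + (μ₀ 2 + μ₀ 3 : ℕ) := by linarith
          have h9 := mul_le_mul_of_nonneg_right h8 hm.le
          have e3 : ∀ a b : ℝ, (a * (p.n / p.m) + b) * p.m = a * p.n + b * p.m := by
            intro a b
            field_simp
          rw [e3, e3] at h9
          exact_mod_cast h9
      refine h6.trans ?_
      rw [hWe]
      nlinarith [Nat.zero_le ((μ₀ 0 + μ₀ 1) * p.m), Nat.zero_le ((μ₀ 2 + μ₀ 3) * p.n)]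
    have h6 := p.norm_leading_sum_le hβ0 hβ G h4 h5 h3
    rw [Finset.sum_image hinj]
    have e1 : ∑ μ ∈ T, ((G.coeff (v (μ 0, μ 2)) : ℤ) : ℂ) *
        Complex.exp ((π * ((μ 0, μ 2).1 * p.lo - (μ 0, μ 2).2 * p.hi) : ℝ) * Complex.I) =
        ∑ μ ∈ T, ((G.coeff μ : ℤ) : ℂ) *
        Complex.exp ((π * (μ 0 * p.lo - μ 2 * p.hi) : ℝ) * Complex.I) :=
      Finset.sum_congr rfl fun μ hμ => by rw [hv μ hμ]
    rw [e1]
    refine h6.trans ?_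
    rw [add_mul]
    have h7 : |β| ^ (p.n + p.m) ≤ ρ ^ (p.n + p.m) := by
      have : |β| ≤ ρ := le_max_left _ _
      gcongr
    have h8 : |β| ^ (δ * p.m) ≤ ρ ^ (p.n + p.m) := by
      have h9 : |β| ^ (δ / L₂) ≤ ρ := le_max_right _ _
      refine le_trans ?_ (pow_le_pow_left₀ (by positivity) h9 _)
      rw [← rpow_natCast, ← rpow_mul hb0.le]
      refine rpow_le_rpow_of_exponent_ge hb0 hβ.le ?_
      have h10 : ((p.n + p.m : ℕ) : ℝ) ≤ L₂ * p.m := by exact_mod_cast (hL₂ p).2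
      have h11 : (0 : ℝ) < L₂ := by exact_mod_cast hL₂0
      calc δ / L₂ * (p.n + p.m : ℕ) ≤ δ / L₂ * (L₂ * p.m) := by gcongr
        _ = δ * p.m := by field_simp
    have h9 := G.absSum_nonneg
    gcongr

/-- The moments of the frequencies of an exponential polynomial, as polynomials in the slope. -/
noncomputable def momentPoly (S : Finset (ℕ × ℕ)) (q : ℕ × ℕ → ℤ) (D : ℕ) : Polynomial ℝ :=
  ∑ x ∈ S, Polynomial.C (q x : ℝ) *
    (Polynomial.C (x.1 : ℝ) - Polynomial.C (x.2 : ℝ) * Polynomial.X) ^ D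

theorem eval_momentPoly (S : Finset (ℕ × ℕ)) (q : ℕ × ℕ → ℤ) (D : ℕ) (κ : ℝ) :
    (momentPoly S q D).eval κ = ∑ x ∈ S, (q x : ℝ) * ((x.1 : ℝ) - x.2 * κ) ^ D := by
  simp [momentPoly, Polynomial.eval_finsetSum]

theorem exists_eval_momentPoly_ne_zero {S : Finset (ℕ × ℕ)} (hS : S.Nonempty) {q : ℕ × ℕ → ℤ}
    (hq : ∀ x ∈ S, q x ≠ 0) {κ : ℝ} (hκ : Irrational κ) :
    ∃ D, (momentPoly S q D).eval κ ≠ 0 := by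
  by_contra! h
  have hinj : Function.Injective fun x : S => ((x.1.1 : ℝ) - x.1.2 * κ) := by
    intro x y hxy
    simp only at hxy
    have h2 : x.1.2 = y.1.2 := by
      by_contra hne
      have h3 : ((x.1.2 : ℤ) - y.1.2) ≠ 0 := by omega
      refine (hκ.intCast_mul h3).ne_int ((x.1.1 : ℤ) - y.1.1) ?_
      push_cast
      linarith
    rw [h2] at hxy
    exact Subtype.ext (Prod.ext (by exact_mod_cast sub_left_injective hxy) h2)
  have := eq_zero_of_forall_sum_mul_pow_eq_zero hinj (q := fun x : S => (q x.1 : ℝ)) fun k => by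
    rw [← h k, eval_momentPoly]
    exact Finset.sum_coe_sort S fun x => (q x : ℝ) * ((x.1 : ℝ) - x.2 * κ) ^ k
  obtain ⟨x, hx⟩ := hS
  have := congrFun this ⟨x, hx⟩
  simp only [Pi.zero_apply, Int.cast_eq_zero] at this
  exact hq x hx this

/-- The first nonvanishing moment of an exponential polynomial is controlled by its values. -/
theorem abs_eval_momentPoly_mul_le (S : Finset (ℕ × ℕ)) (q : ℕ × ℕ → ℤ) {D : ℕ} {κ Y s : ℝ}
    (hs0 : 0 ≤ s) (hY : ∀ x ∈ S, |(x.1 : ℝ) - x.2 * κ| ≤ Y)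
    (h : ∀ d < D, (momentPoly S q d).eval κ = 0) :
    |(momentPoly S q D).eval κ| * s ^ D ≤ (D.factorial : ℝ) *
      (‖∑ x ∈ S, (q x : ℂ) * Complex.exp ((s * (x.1 - x.2 * κ) : ℝ) * Complex.I)‖ +
        (∑ x ∈ S, |(q x : ℝ)|) * ((s * Y) ^ (D + 1) * exp (s * Y))) := by
  set z : ℕ × ℕ → ℂ := fun x => (s * (x.1 - x.2 * κ) : ℝ) * Complex.I with hz
  have hmom : ∀ d, ∑ x ∈ S, (q x : ℂ) * (z x ^ d / d.factorial) =
      ((momentPoly S q d).eval κ : ℝ) * ((s * Complex.I) ^ d / d.factorial) := by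
    intro d
    rw [eval_momentPoly, Complex.ofReal_sum, Finset.sum_mul]
    refine Finset.sum_congr rfl fun x _ => ?_
    simp only [hz]
    push_cast
    rw [mul_right_comm, mul_pow]
    ring
  have hfact : (0 : ℝ) < D.factorial := by exact_mod_cast D.factorial_pos
  have h1 : (∑ x ∈ S, (q x : ℂ) * Complex.exp (z x)) - ∑ x ∈ S, (q x : ℂ) *
      (Complex.exp (z x) - ∑ d ∈ Finset.range (D + 1), z x ^ d / d.factorial) =
      ((momentPoly S q D).eval κ : ℝ) * ((s * Complex.I) ^ D / D.factorial) := by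
    rw [← Finset.sum_sub_distrib, ← hmom]
    have : ∀ d ∈ Finset.range D, ∑ x ∈ S, (q x : ℂ) * (z x ^ d / d.factorial) = 0 := by
      intro d hd
      rw [hmom, h d (Finset.mem_range.mp hd)]
      simp
    have h2 := Finset.sum_eq_zero this
    rw [Finset.sum_comm] at h2
    rw [← zero_add (∑ x ∈ S, (q x : ℂ) * (z x ^ D / D.factorial)), ← h2,
      ← Finset.sum_add_distrib]
    refine Finset.sum_congr rfl fun x _ => ?_
    rw [Finset.sum_range_succ, ← Finset.mul_sum]
    ring
  have h2 : ∀ x ∈ S, ‖(q x : ℂ) * (Complex.exp (z x) -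
      ∑ d ∈ Finset.range (D + 1), z x ^ d / d.factorial)‖ ≤
      |(q x : ℝ)| * ((s * Y) ^ (D + 1) * exp (s * Y)) := by
    intro x hx
    have hzn : ‖z x‖ ≤ s * Y := by
      simp only [hz]
      rw [norm_mul, Complex.norm_I, mul_one, Complex.norm_real, norm_eq_abs, abs_mul,
        abs_of_nonneg hs0]
      exact mul_le_mul_of_nonneg_left (hY x hx) hs0
    have hsY : 0 ≤ s * Y := (norm_nonneg _).trans hzn
    rw [norm_mul, Complex.norm_intCast]
    refine mul_le_mul_of_nonneg_left ?_ (abs_nonneg _)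
    refine (Complex.norm_exp_sub_sum_le_norm_mul_exp _ _).trans ?_
    gcongr
  have h3 : |(momentPoly S q D).eval κ| * s ^ D = (D.factorial : ℝ) *
      ‖(((momentPoly S q D).eval κ : ℝ) : ℂ) * ((s * Complex.I) ^ D / D.factorial)‖ := by
    rw [norm_mul, norm_div, norm_pow, norm_mul, Complex.norm_I, Complex.norm_real, norm_eq_abs,
      Complex.norm_real, norm_eq_abs, abs_of_nonneg hs0, Complex.norm_natCast, mul_one]
    field_simp
  rw [h3, ← h1]
  refine mul_le_mul_of_nonneg_left ((norm_sub_le _ _).trans (add_le_add le_rfl ?_)) hfact.le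
  rw [Finset.sum_mul]
  exact norm_sum_le_of_le _ h2

namespace BadlyApprox

variable {ω c₀ : ℝ} (hbad : BadlyApprox ω c₀)
include hbad

/-- The first nonvanishing moment is small at Farey pairs where the exponential polynomial is
exponentially small. -/
theorem exists_abs_eval_momentPoly_lt (S : Finset (ℕ × ℕ)) (q : ℕ × ℕ → ℤ) {C ρ : ℝ} (hρ0 : 0 ≤ ρ)
    (hρ : ρ < 1) (D : ℕ) {ε : ℝ} (hε : 0 < ε) :
    ∃ n₀, ∀ p : FareyPair ω, n₀ ≤ p.n + p.m →
      ‖∑ x ∈ S, (q x : ℂ) * Complex.exp ((π * (x.1 * p.lo - x.2 * p.hi) : ℝ) * Complex.I)‖ ≤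
          C * ρ ^ (p.n + p.m) →
      (∀ d < D, (momentPoly S q d).eval p.slope = 0) → |(momentPoly S q D).eval p.slope| < ε := by
  obtain ⟨L, hL0, hL⟩ := hbad.exists_mul_ge
  have hc0 := hbad.1
  have hL0' : (0 : ℝ) < L := by exact_mod_cast hL0
  set Y : ℝ := ∑ x ∈ S, ((x.1 : ℝ) + x.2 * c₀⁻¹) with hY
  have hY0 : 0 ≤ Y := Finset.sum_nonneg fun x _ => by positivity
  set Q : ℝ := ∑ x ∈ S, |(q x : ℝ)| with hQ
  have hQ0 : 0 ≤ Q := Finset.sum_nonneg fun x _ => abs_nonneg _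
  set A : ℝ := (D.factorial : ℝ) * |C| / (π * c₀) ^ D with hA
  set E : ℝ := (D.factorial : ℝ) * (Q * (Y ^ (D + 1) * exp (π * Y))) * (π * L) with hE
  have ht : Tendsto (fun k : ℕ => A * ((k : ℝ) ^ D * ρ ^ k) + E / k) atTop (nhds 0) := by
    have h1 := (tendsto_pow_const_mul_const_pow_of_abs_lt_one D
      (by rwa [abs_of_nonneg hρ0] : |ρ| < 1)).const_mul A
    have h2 := tendsto_const_div_atTop_nhds_zero_nat E
    simpa using h1.add h2
  obtain ⟨n₀, hn₀⟩ := eventually_atTop.mp (ht.eventually_lt_const hε)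
  refine ⟨n₀, fun p hp hest hzero => ?_⟩
  have hm : (0 : ℝ) < p.m := by exact_mod_cast p.m_pos
  have hn : (0 : ℝ) < p.n := by exact_mod_cast p.n_pos
  have hlo := p.lo_pos
  have hmlo : p.m * p.lo ≤ 1 := by nlinarith [p.n_mul_hi_add, p.hi_pos]
  set k : ℕ := p.n + p.m with hk
  have hkpos : (0 : ℝ) < k := by rw [hk]; push_cast; positivity
  set s : ℝ := π * p.lo with hs
  have hs0 : 0 < s := by positivity
  have hslow : π * c₀ / k ≤ s := by
    rw [div_le_iff₀ hkpos, hs, mul_assoc]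
    refine mul_le_mul_of_nonneg_left ?_ pi_pos.le
    have := hbad.le_n_mul_lo p
    rw [hk]
    push_cast
    nlinarith [mul_pos hm hlo]
  have hsup : s ≤ π * L / k := by
    rw [le_div_iff₀ hkpos, hs, mul_assoc]
    refine mul_le_mul_of_nonneg_left ?_ pi_pos.le
    have h1 : (k : ℝ) ≤ L * p.m := by exact_mod_cast (hL p).2
    nlinarith [mul_le_mul_of_nonneg_left h1 hlo.le, mul_le_mul_of_nonneg_left hmlo hL0'.le]
  have hspi : s ≤ π := by
    have : (1 : ℝ) ≤ p.m := by exact_mod_cast p.m_pos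
    have : p.lo ≤ 1 := by nlinarith
    rw [hs]
    nlinarith [pi_pos]
  have hYb : ∀ x ∈ S, |(x.1 : ℝ) - x.2 * p.slope| ≤ Y := by
    intro x hx
    have h1 := p.slope_pos
    have h2 := hbad.slope_le p
    refine le_trans ?_ (Finset.single_le_sum (f := fun x : ℕ × ℕ => (x.1 : ℝ) + x.2 * c₀⁻¹)
      (fun x _ => by positivity) hx)
    have h3 : (0 : ℝ) ≤ x.1 := by positivity
    have h4 : (0 : ℝ) ≤ x.2 := by positivity
    have h5 := mul_le_mul_of_nonneg_left h2 h4
    have h6 := mul_nonneg h4 h1.le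
    rw [abs_le]
    constructor <;> linarith
  have key := abs_eval_momentPoly_mul_le S q hs0.le hYb hzero
  have e1 : ∀ x : ℕ × ℕ, π * (x.1 * p.lo - x.2 * p.hi) = s * (x.1 - x.2 * p.slope) := by
    intro x
    rw [hs, ← p.slope_mul_lo]
    ring
  simp_rw [e1] at hest
  refine lt_of_le_of_lt ?_ (hn₀ k hp)
  have h1 : |(momentPoly S q D).eval p.slope| * s ^ D ≤
      (D.factorial : ℝ) * (|C| * ρ ^ k + Q * ((s * Y) ^ (D + 1) * exp (π * Y))) := by
    refine key.trans ?_
    have h2 : C * ρ ^ k ≤ |C| * ρ ^ k := by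
      gcongr
      exact le_abs_self _
    have h3 : exp (s * Y) ≤ exp (π * Y) := by gcongr
    gcongr
    exact hest.trans h2
  rw [← le_div_iff₀ (by positivity)] at h1
  refine h1.trans ?_
  have e2 : (D.factorial : ℝ) * (|C| * ρ ^ k + Q * ((s * Y) ^ (D + 1) * exp (π * Y))) / s ^ D =
      (D.factorial : ℝ) * |C| * ρ ^ k / s ^ D +
      (D.factorial : ℝ) * (Q * (Y ^ (D + 1) * exp (π * Y))) * s := by
    field_simp
    ring
  rw [e2]
  refine add_le_add ?_ ?_
  · have : (D.factorial : ℝ) * |C| * ρ ^ k / s ^ D ≤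
        (D.factorial : ℝ) * |C| * ρ ^ k / (π * c₀ / k) ^ D := by
      gcongr
    refine this.trans (le_of_eq ?_)
    rw [hA, div_pow]
    field_simp
  · have : (D.factorial : ℝ) * (Q * (Y ^ (D + 1) * exp (π * Y))) * s ≤
        (D.factorial : ℝ) * (Q * (Y ^ (D + 1) * exp (π * Y))) * (π * L / k) := by
      gcongr
    refine this.trans (le_of_eq ?_)
    rw [hE]
    ring

omit hbad in
/-- On the Farey pairs with property `P`, the slopes are asymptotically roots of a polynomial, and
every slope occurs finitely often. -/
def SlopesAreSpecial (P : FareyPair ω → Prop) : Prop :=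
  (∃ ℓ : Polynomial ℝ, ℓ ≠ 0 ∧ ∀ ε > 0, ∃ n₀, ∀ p : FareyPair ω, P p → n₀ ≤ p.n + p.m →
    |ℓ.eval p.slope| < ε) ∧
  ∀ s : ℝ, ∃ n₀, ∀ p : FareyPair ω, P p → n₀ ≤ p.n + p.m → p.slope ≠ s

omit hbad in
theorem SlopesAreSpecial.of_bounded {P : FareyPair ω → Prop} {n₀ : ℕ}
    (h : ∀ p, P p → p.n + p.m < n₀) : SlopesAreSpecial P :=
  ⟨⟨1, one_ne_zero, fun _ _ => ⟨n₀, fun p hp hn => absurd (h p hp) (not_lt.mpr hn)⟩⟩,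
    fun _ => ⟨n₀, fun p hp hn => absurd (h p hp) (not_lt.mpr hn)⟩⟩

omit hbad in
theorem SlopesAreSpecial.mono {P Q : FareyPair ω → Prop} (h : SlopesAreSpecial Q)
    (hPQ : ∀ p, P p → Q p) : SlopesAreSpecial P := by
  obtain ⟨⟨ℓ, hℓ, h1⟩, h2⟩ := h
  refine ⟨⟨ℓ, hℓ, fun ε hε => ?_⟩, fun s => ?_⟩
  · obtain ⟨n₀, hn₀⟩ := h1 ε hε
    exact ⟨n₀, fun p hp => hn₀ p (hPQ p hp)⟩
  · obtain ⟨n₀, hn₀⟩ := h2 s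
    exact ⟨n₀, fun p hp => hn₀ p (hPQ p hp)⟩

theorem exists_abs_eval_slope_le (ℓ : Polynomial ℝ) :
    ∃ B : ℝ, 0 < B ∧ ∀ p : FareyPair ω, |ℓ.eval p.slope| ≤ B := by
  obtain ⟨B, hB⟩ := (isCompact_Icc (a := c₀) (b := c₀⁻¹)).exists_bound_of_continuousOn
    ℓ.continuous.continuousOn
  exact ⟨max B 1, by positivity, fun p =>
    (hB _ ⟨hbad.le_slope p, hbad.slope_le p⟩).trans (le_max_left _ _)⟩

theorem slopesAreSpecial_or {P Q : FareyPair ω → Prop} (hP : SlopesAreSpecial P)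
    (hQ : SlopesAreSpecial Q) : SlopesAreSpecial fun p => P p ∨ Q p := by
  obtain ⟨⟨ℓ, hℓ, h1⟩, h2⟩ := hP
  obtain ⟨⟨ℓ', hℓ', h1'⟩, h2'⟩ := hQ
  obtain ⟨B, hB0, hB⟩ := hbad.exists_abs_eval_slope_le ℓ
  obtain ⟨B', hB0', hB'⟩ := hbad.exists_abs_eval_slope_le ℓ'
  refine ⟨⟨ℓ * ℓ', mul_ne_zero hℓ hℓ', fun ε hε => ?_⟩, fun s => ?_⟩
  · obtain ⟨n₀, hn₀⟩ := h1 (ε / B') (by positivity)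
    obtain ⟨n₁, hn₁⟩ := h1' (ε / B) (by positivity)
    refine ⟨max n₀ n₁, fun p hp hn => ?_⟩
    rw [Polynomial.eval_mul, abs_mul]
    rcases hp with hp | hp
    · have := hn₀ p hp ((le_max_left _ _).trans hn)
      rw [lt_div_iff₀ hB0'] at this
      exact (mul_le_mul_of_nonneg_left (hB' p) (abs_nonneg _)).trans_lt this
    · have := hn₁ p hp ((le_max_right _ _).trans hn)
      rw [lt_div_iff₀ hB0, mul_comm] at this
      exact (mul_le_mul_of_nonneg_right (hB p) (abs_nonneg _)).trans_lt this
  · obtain ⟨n₀, hn₀⟩ := h2 s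
    obtain ⟨n₁, hn₁⟩ := h2' s
    refine ⟨max n₀ n₁, fun p hp hn => ?_⟩
    rcases hp with hp | hp
    · exact hn₀ p hp ((le_max_left _ _).trans hn)
    · exact hn₁ p hp ((le_max_right _ _).trans hn)

theorem irrational_slope (p : FareyPair ω) : Irrational p.slope := by
  rintro ⟨r, hr⟩
  have hr0 : 0 < r := by
    have := p.slope_pos
    rw [← hr] at this
    exact_mod_cast this
  obtain ⟨a, ha⟩ := Int.eq_ofNat_of_zero_le (Rat.num_pos.mpr hr0).le
  have h1 : (a : ℝ) = r.den * p.slope := by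
    rw [← hr]
    have := Rat.mul_den_eq_num r
    rw [ha] at this
    have h2 : (r : ℝ) * r.den = a := by exact_mod_cast this
    linarith
  have h2 : (a : ℝ) * p.lo = r.den * p.hi := by
    rw [h1, mul_assoc, p.slope_mul_lo]
  refine hbad.irrational_like (a * p.n + r.den * p.m)
    (Nat.add_pos_right _ (Nat.mul_pos r.den_pos p.m_pos)) ((a * p.c + r.den * p.d : ℕ) : ℤ) ?_
  have h3 := p.lattice_mul_sub a r.den
  rw [Int.cast_natCast]
  linarith

theorem slopesAreSpecial_of_estimate {S : Finset (ℕ × ℕ)} (hS : S.Nonempty) {q : ℕ × ℕ → ℤ}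
    (hq : ∀ x ∈ S, q x ≠ 0) {C ρ : ℝ} (hρ0 : 0 ≤ ρ) (hρ : ρ < 1) {P : FareyPair ω → Prop} {n₀ : ℕ}
    (hP : ∀ p, P p → n₀ ≤ p.n + p.m →
      ‖∑ x ∈ S, (q x : ℂ) * Complex.exp ((π * (x.1 * p.lo - x.2 * p.hi) : ℝ) * Complex.I)‖ ≤
          C * ρ ^ (p.n + p.m)) : SlopesAreSpecial P := by
  classical
  refine ⟨?_, fun s => ?_⟩
  · have hex : ∃ D, momentPoly S q D ≠ 0 := by
      obtain ⟨D, hD⟩ := exists_eval_momentPoly_ne_zero hS hq irrational_sqrt_two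
      exact ⟨D, fun h => hD (by rw [h, Polynomial.eval_zero])⟩
    refine ⟨momentPoly S q (Nat.find hex), Nat.find_spec hex, fun ε hε => ?_⟩
    obtain ⟨n₁, hn₁⟩ := hbad.exists_abs_eval_momentPoly_lt S q (C := C) hρ0 hρ (Nat.find hex) hε
    refine ⟨max n₀ n₁, fun p hp hn => hn₁ p ((le_max_right _ _).trans hn)
      (hP p hp ((le_max_left _ _).trans hn)) fun d hd => ?_⟩
    rw [not_not.mp (Nat.find_min hex hd), Polynomial.eval_zero]
  · by_cases hs : Irrational s
    · have hex := exists_eval_momentPoly_ne_zero hS hq hs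
      obtain ⟨n₁, hn₁⟩ := hbad.exists_abs_eval_momentPoly_lt S q (C := C) hρ0 hρ (Nat.find hex)
        (abs_pos.mpr (Nat.find_spec hex))
      refine ⟨max n₀ n₁, fun p hp hn hps => ?_⟩
      have := hn₁ p ((le_max_right _ _).trans hn) (hP p hp ((le_max_left _ _).trans hn))
        fun d hd => by rw [hps]; exact not_not.mp (Nat.find_min hex hd)
      rw [hps] at this
      exact lt_irrefl _ this
    · exact ⟨0, fun p _ _ hps => hs (hps ▸ hbad.irrational_slope p)⟩

end BadlyApprox

theorem FareyPair.m_mul_lo_le {ω : ℝ} (p : FareyPair ω) : p.m * p.lo ≤ 1 := by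
  have hn : (0 : ℝ) < p.n := by exact_mod_cast p.n_pos
  nlinarith [p.n_mul_hi_add, p.hi_pos]

namespace BadlyApprox

variable {ω c₀ : ℝ} (h : BadlyApprox ω c₀)
include h

theorem n_mul_lo_le (p : FareyPair ω) : p.n * p.lo ≤ c₀⁻¹ := by
  have hn : (0 : ℝ) < p.n := by exact_mod_cast p.n_pos
  have hm : (0 : ℝ) < p.m := by exact_mod_cast p.m_pos
  have h1 := h.le_slope p
  have h2 := p.n_mul_hi_add
  rw [← p.slope_mul_lo] at h2
  rw [inv_eq_one_div, le_div_iff₀ h.1]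
  have h3 := mul_le_mul_of_nonneg_right h1 (mul_pos hn p.lo_pos).le
  nlinarith [mul_pos hm p.lo_pos]

theorem m_mul_hi_le (p : FareyPair ω) : p.m * p.hi ≤ c₀⁻¹ := by
  have hm : (0 : ℝ) < p.m := by exact_mod_cast p.m_pos
  have h1 := mul_le_mul (h.slope_le p) (p.m_mul_lo_le) (mul_pos hm p.lo_pos).le
    (inv_pos.mpr h.1).le
  rw [← p.slope_mul_lo]
  linarith

theorem exists_le_abs_slope_sub (a b : ℕ) (hb : 0 < b) :
    ∃ δ > 0, ∀ p : FareyPair ω, δ ≤ |a - b * p.slope| := by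
  have hc := h.1
  have hci : 0 < c₀⁻¹ := inv_pos.mpr hc
  have hb' : (0 : ℝ) < b := by exact_mod_cast hb
  refine ⟨c₀ / (a * c₀⁻¹ + b), by positivity, fun p => ?_⟩
  rw [div_le_iff₀ (by positivity)]
  have h1 := h.2 (a * p.n + b * p.m) ((a * p.c + b * p.d : ℕ) : ℤ)
    (Nat.add_pos_right _ (Nat.mul_pos hb p.m_pos))
  rw [Int.cast_natCast, p.lattice_mul_sub, ← p.slope_mul_lo] at h1
  have e : (a : ℝ) * p.lo - b * (p.slope * p.lo) = (a - b * p.slope) * p.lo := by ring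
  rw [e, abs_mul, abs_of_pos p.lo_pos] at h1
  refine h1.trans ?_
  have h2 : (a * p.n + b * p.m : ℝ) * p.lo ≤ a * c₀⁻¹ + b := by
    have := mul_le_mul_of_nonneg_left (h.n_mul_lo_le p) (Nat.cast_nonneg (α := ℝ) a)
    have := mul_le_mul_of_nonneg_left (p.m_mul_lo_le) hb'.le
    linarith
  have := mul_le_mul_of_nonneg_left h2 (abs_nonneg (a - b * p.slope))
  push_cast
  linarith

theorem exists_le_abs_ratio_sub (a b : ℕ) (hb : 0 < b) :
    ∃ δ > 0, ∀ p : FareyPair ω, a + b < p.n + p.m → δ ≤ |a - b * (p.n / p.m : ℝ)| := by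
  have hc := h.1
  have hci : 0 < c₀⁻¹ := inv_pos.mpr hc
  have hb' : (0 : ℝ) < b := by exact_mod_cast hb
  refine ⟨c₀ / (b + a * c₀⁻¹), by positivity, fun p hp => ?_⟩
  rw [div_le_iff₀ (by positivity)]
  have hm : (0 : ℝ) < p.m := by exact_mod_cast p.m_pos
  have hlohi : 0 < p.lo ∧ 0 < p.hi := ⟨p.lo_pos, p.hi_pos⟩
  have hcop : Nat.Coprime p.n p.m := by
    have h1 : p.n.gcd p.m ∣ p.n * p.d := (Nat.gcd_dvd_left _ _).mul_right _
    rw [p.det] at h1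
    exact Nat.dvd_one.mp ((Nat.dvd_add_right ((Nat.gcd_dvd_right _ _).mul_right _)).mp h1)
  have hne : b * p.n ≠ a * p.m := by
    intro he
    have h1 : p.m ∣ b := hcop.symm.dvd_of_dvd_mul_right (Dvd.intro_left a he.symm)
    have h2 := Nat.le_of_dvd hb h1
    have ha : 0 < a := by
      rcases Nat.eq_zero_or_pos a with rfl | ha
      · rw [zero_mul] at he
        exact absurd he (Nat.mul_pos hb p.n_pos).ne'
      · exact ha
    have h3 : p.n ∣ a := hcop.dvd_of_dvd_mul_right (Dvd.intro_left b he)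
    have h4 := Nat.le_of_dvd ha h3
    omega
  have key : c₀ ≤ |(a : ℝ) * p.m - b * p.n| * (b * p.lo + a * p.hi) := by
    rcases lt_or_gt_of_ne hne with hlt | hlt
    · have h1 := h.2 (a * p.m - b * p.n) ((a * p.d : ℤ) - b * p.c) (by omega)
      rw [Nat.cast_sub hlt.le] at h1
      have e : ((a * p.m : ℕ) - (b * p.n : ℕ) : ℝ) * ω - ((a * p.d : ℤ) - b * p.c : ℤ) =
          -(b * p.lo + a * p.hi) := by
        simp only [FareyPair.lo, FareyPair.hi]
        push_cast
        ring
      rw [e, abs_neg, abs_of_nonneg (by nlinarith [mul_pos hb' hlohi.1, mul_nonneg (Nat.cast_nonneg (α := ℝ) a) hlohi.2.le])] at h1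
      refine h1.trans (mul_le_mul_of_nonneg_right ?_ (by nlinarith [mul_pos hb' hlohi.1, mul_nonneg (Nat.cast_nonneg (α := ℝ) a) hlohi.2.le]))
      push_cast
      exact le_abs_self _
    · have h1 := h.2 (b * p.n - a * p.m) ((b * p.c : ℤ) - a * p.d) (by omega)
      rw [Nat.cast_sub hlt.le] at h1
      have e : ((b * p.n : ℕ) - (a * p.m : ℕ) : ℝ) * ω - ((b * p.c : ℤ) - a * p.d : ℤ) =
          (b * p.lo + a * p.hi) := by
        simp only [FareyPair.lo, FareyPair.hi]
        push_cast
        ring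
      rw [e, abs_of_nonneg (by nlinarith [mul_pos hb' hlohi.1, mul_nonneg (Nat.cast_nonneg (α := ℝ) a) hlohi.2.le])] at h1
      refine h1.trans (mul_le_mul_of_nonneg_right ?_ (by nlinarith [mul_pos hb' hlohi.1, mul_nonneg (Nat.cast_nonneg (α := ℝ) a) hlohi.2.le]))
      push_cast
      rw [abs_sub_comm]
      exact le_abs_self _
  have e : (a : ℝ) * p.m - b * p.n = (a - b * (p.n / p.m : ℝ)) * p.m := by
    field_simp
  rw [e, abs_mul, abs_of_pos hm, mul_assoc] at key
  refine key.trans (mul_le_mul_of_nonneg_left ?_ (abs_nonneg _))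
  have := mul_le_mul_of_nonneg_left (p.m_mul_lo_le) hb'.le
  have := mul_le_mul_of_nonneg_left (h.m_mul_hi_le p) (Nat.cast_nonneg (α := ℝ) a)
  linarith

/-- Every datum has a neighbourhood in which the slopes of the Farey pairs are special. -/
theorem exists_nhds_slopesAreSpecial {β : ℝ} (hβ0 : β ≠ 0) (hβ : |β| < 1)
    (hvan : ∃ N r : ℕ, ∀ a : ℕ → ℕ → ℤ, ∃ c : (Fin 4 → Fin (N + 1)) × Fin (N + 1) → ℤ, c ≠ 0 ∧
      ∃ n₀, ∀ p : FareyPair ω, n₀ ≤ p.n + p.m → p.Matches a r →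
        auxSum c (p.point β) (p.value β) = 0)
    (c' d' : ℕ) {z : ℝ × ℝ} (hz : 0 < z.1 ∧ 0 < z.2) :
    ∃ U ∈ nhds z, SlopesAreSpecial fun p : FareyPair ω =>
      (Odd p.c ↔ Odd c') ∧ (Odd p.d ↔ Odd d') ∧ (p.slope, (p.n : ℝ) / p.m) ∈ U := by
  have hrat : ∀ x : ℝ, 0 < x → ¬ Irrational x → ∃ a b : ℕ, 0 < b ∧ (a : ℝ) - b * x = 0 := by
    intro x hx hirr
    obtain ⟨r, rfl⟩ := not_not.mp hirr
    have hr0 : 0 < r := by exact_mod_cast hx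
    obtain ⟨a, ha⟩ := Int.eq_ofNat_of_zero_le (Rat.num_pos.mpr hr0).le
    refine ⟨a, r.den, r.den_pos, ?_⟩
    have := Rat.mul_den_eq_num r
    rw [ha] at this
    have h2 : (r : ℝ) * r.den = a := by exact_mod_cast this
    linarith
  have hfar : ∀ (a b : ℕ) (x δ : ℝ), (a : ℝ) - b * x = 0 → 0 < δ →
      ∀ᶠ y in nhds x, |(a : ℝ) - b * y| < δ := by
    intro a b x δ hx hδ
    have hc : ContinuousAt (fun y : ℝ => |(a : ℝ) - b * y|) x := by fun_prop
    refine hc.eventually_lt_const ?_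
    simp only [hx, abs_zero]
    exact hδ
  by_cases hκ : Irrational z.1
  · by_cases hτ : Irrational z.2
    · by_cases hcd : Odd c' ∨ Odd d'
      · obtain ⟨S, hS, q, hq, C, ρ, hρ0, hρ, U, hU, n₀, hest⟩ :=
          h.exists_local_estimate hβ0 hβ hvan hz.1 hκ hτ hcd
        exact ⟨U, hU, h.slopesAreSpecial_of_estimate hS hq hρ0 hρ
          fun p hp hn => hest p hp.2.2 hp.1 hp.2.1 hn⟩
      · refine ⟨Set.univ, univ_mem, SlopesAreSpecial.of_bounded (n₀ := 0) fun p hp => ?_⟩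
        push Not at hcd
        have h1 : Even p.c := Nat.not_odd_iff_even.mp fun ho => hcd.1 (hp.1.mp ho)
        have h2 : Even p.d := Nat.not_odd_iff_even.mp fun ho => hcd.2 (hp.2.1.mp ho)
        obtain ⟨u, hu⟩ := h1.mul_left p.m
        obtain ⟨v, hv⟩ := h2.mul_left p.n
        have := p.det
        omega
    · obtain ⟨a, b, hb, hab⟩ := hrat _ hz.2 hτ
      obtain ⟨δ, hδ, hfarp⟩ := h.exists_le_abs_ratio_sub a b hb
      refine ⟨{y | |(a : ℝ) - b * y.2| < δ}, ?_, SlopesAreSpecial.of_bounded (n₀ := a + b + 1)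
        fun p hp => ?_⟩
      · exact continuous_snd.continuousAt.eventually (hfar a b _ δ hab hδ)
      · by_contra! hlt
        exact absurd hp.2.2 (not_lt.mpr (hfarp p (by omega)))
  · obtain ⟨a, b, hb, hab⟩ := hrat _ hz.1 hκ
    obtain ⟨δ, hδ, hfarp⟩ := h.exists_le_abs_slope_sub a b hb
    refine ⟨{y | |(a : ℝ) - b * y.1| < δ}, ?_, SlopesAreSpecial.of_bounded (n₀ := 0)
      fun p hp => ?_⟩
    · exact continuous_fst.continuousAt.eventually (hfar a b _ δ hab hδ)
    · exact absurd hp.2.2 (not_lt.mpr (hfarp p))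

/-- The auxiliary relations cannot hold at all large Farey pairs. -/
theorem false_of_vanishing (hω : 0 < ω) {β : ℝ} (hβ0 : β ≠ 0) (hβ : |β| < 1)
    (hvan : ∃ N r : ℕ, ∀ a : ℕ → ℕ → ℤ, ∃ c : (Fin 4 → Fin (N + 1)) × Fin (N + 1) → ℤ, c ≠ 0 ∧
      ∃ n₀, ∀ p : FareyPair ω, n₀ ≤ p.n + p.m → p.Matches a r →
        auxSum c (p.point β) (p.value β) = 0) : False := by
  have hc := h.1
  have hci : 0 < c₀⁻¹ := inv_pos.mpr hc
  let box : Set (ℝ × ℝ) := Set.Icc c₀ c₀⁻¹ ×ˢ Set.Icc c₀ c₀⁻¹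
  have hbox : IsCompact box := isCompact_Icc.prod isCompact_Icc
  have hmem : ∀ p : FareyPair ω, (p.slope, (p.n : ℝ) / p.m) ∈ box := by
    intro p
    have hm : (0 : ℝ) < p.m := by exact_mod_cast p.m_pos
    refine ⟨⟨h.le_slope p, h.slope_le p⟩, ?_, ?_⟩
    · rw [le_div_iff₀ hm]
      exact h.mul_m_le_n p
    · rw [div_le_iff₀ hm, inv_mul_eq_div, le_div_iff₀ hc, mul_comm]
      exact h.mul_n_le_m p
  have hclass : ∀ c' d' : ℕ, SlopesAreSpecial fun p : FareyPair ω =>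
      (Odd p.c ↔ Odd c') ∧ (Odd p.d ↔ Odd d') ∧ (p.slope, (p.n : ℝ) / p.m) ∈ box := by
    intro c' d'
    refine hbox.induction_on (p := fun T => SlopesAreSpecial fun p : FareyPair ω =>
      (Odd p.c ↔ Odd c') ∧ (Odd p.d ↔ Odd d') ∧ (p.slope, (p.n : ℝ) / p.m) ∈ T) ?_ ?_ ?_ ?_
    · exact SlopesAreSpecial.of_bounded (n₀ := 0) fun p hp => absurd hp.2.2 (Set.notMem_empty _)
    · exact fun s t hst ht => ht.mono fun p hp => ⟨hp.1, hp.2.1, hst hp.2.2⟩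
    · exact fun s t hs ht => (h.slopesAreSpecial_or hs ht).mono fun p hp =>
        hp.2.2.imp (fun h' => ⟨hp.1, hp.2.1, h'⟩) fun h' => ⟨hp.1, hp.2.1, h'⟩
    · intro z hz
      obtain ⟨U, hU, hUs⟩ := h.exists_nhds_slopesAreSpecial hβ0 hβ hvan c' d'
        ⟨hc.trans_le hz.1.1, hc.trans_le hz.2.1⟩
      exact ⟨U, mem_nhdsWithin_of_mem_nhds hU, hUs⟩
  have hall : SlopesAreSpecial fun _ : FareyPair ω => True := by
    refine (h.slopesAreSpecial_or (h.slopesAreSpecial_or (hclass 0 0) (hclass 0 1))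
      (h.slopesAreSpecial_or (hclass 1 0) (hclass 1 1))).mono fun p _ => ?_
    have := hmem p
    have h0 : ¬ Odd 0 := Nat.not_odd_zero
    by_cases h1 : Odd p.c <;> by_cases h2 : Odd p.d <;> simp [h1, h2, this]
  obtain ⟨⟨ℓ, hℓ, h1⟩, h2⟩ := hall
  refine h.false_of_slopes hω hℓ (fun ε hε => ?_) fun s => ?_
  · obtain ⟨n₀, hn₀⟩ := h1 ε hε
    exact ⟨n₀, fun p => hn₀ p trivial⟩
  · obtain ⟨n₀, hn₀⟩ := h2 s
    exact ⟨n₀, fun p => hn₀ p trivial⟩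

end BadlyApprox

end

section

open Real Filter

/-- The generating function of the positive part of a cosine takes transcendental values. -/
theorem transcendental_tsum_max_cos {ω β : ℝ} (hω : 0 < ω)
    (hirr : ∀ n : ℕ, 0 < n → ∀ c : ℤ, (n : ℝ) * ω ≠ c) (hβ0 : β ≠ 0) (hβ : |β| < 1)
    (hβalg : IsAlgebraic ℚ β)
    (halg : IsAlgebraic ℚ (Complex.exp ((π * ω / 2 : ℝ) * Complex.I))) :
    Transcendental ℚ (∑' k : ℕ, max (cos (π * (k * ω) / 2)) 0 * β ^ k) := by
  intro hg
  have hreal : ∀ x : ℝ, IsAlgebraic ℚ x → IsAlgebraic ℚ (x : ℂ) := fun x hx =>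
    hx.algebraMap (A := ℂ)
  have hI : IsAlgebraic ℚ Complex.I :=
    ⟨Polynomial.X ^ 2 + 1, fun h0 => by
      have := congrArg (Polynomial.eval (0 : ℚ)) h0
      simp at this, by simp⟩
  set α := Complex.exp ((π * ω / 2 : ℝ) * Complex.I) with hα
  set g := ∑' k : ℕ, max (cos (π * (k * ω) / 2)) 0 * β ^ k with hgdef
  classical
  obtain ⟨K, hK, q, H, hq, hH, hs⟩ := exists_sizeLE_of_isAlgebraic
    {α, α⁻¹, (β : ℂ), (g : ℂ), Complex.I} (by
      intro x hx
      simp only [Finset.mem_insert, Finset.mem_singleton] at hx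
      rcases hx with rfl | rfl | rfl | rfl | rfl
      · exact halg
      · exact halg.inv
      · exact hreal _ hβalg
      · exact hreal _ hg
      · exact hI)
  have h1 := hs α (by simp)
  have h2 := hs α⁻¹ (by simp)
  have h3 := hs β (by simp)
  have h4 := hs g (by simp)
  have h5 := hs Complex.I (by simp)
  by_cases happ : ∀ ε > 0, ∃ (k : ℕ) (l : ℤ), 0 < k ∧ 0 < k * (k * ω - l) ∧ k * (k * ω - l) < ε
  · exact false_of_well_approximable hq hH hω hβ0 hβ hα h1 h2 h3 h4 h5 hirr happ
  obtain ⟨N, hN⟩ := exists_nat_gt ω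
  have hcast : ((4 * N : ℤ) : ℝ) = 4 * N := by push_cast; ring
  by_cases happ' : ∀ ε > 0, ∃ (k : ℕ) (l : ℤ), 0 < k ∧ 0 < k * (k * ((4 * N : ℤ) - ω) - l) ∧
      k * (k * ((4 * N : ℤ) - ω) - l) < ε
  · have hα' : α⁻¹ = Complex.exp ((π * ((4 * N : ℤ) - ω) / 2 : ℝ) * Complex.I) := by
      rw [hα, ← Complex.exp_neg, Complex.exp_eq_exp_iff_exists_int]
      refine ⟨-N, ?_⟩
      push_cast
      ring
    have hg' : g = ∑' k : ℕ, max (cos (π * (k * ((4 * N : ℤ) - ω)) / 2)) 0 * β ^ k := by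
      refine tsum_congr fun k => ?_
      have e : π * (k * ((4 * N : ℤ) - ω)) / 2 =
          ((k * N : ℕ) : ℝ) * (2 * π) - π * (k * ω) / 2 := by
        push_cast
        ring
      rw [e, cos_nat_mul_two_pi_sub]
    rw [hg'] at h4
    refine false_of_well_approximable hq hH ?_ hβ0 hβ hα' h2 ?_ h3 h4 h5 ?_ happ'
    · rw [hcast]
      linarith
    · rwa [inv_inv]
    · intro n hn c hc
      refine hirr n hn (n * (4 * N) - c) ?_
      push_cast at hc ⊢
      linarith
  obtain ⟨c₀, hbad⟩ := exists_badlyApprox hirr (4 * N) happ happ'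
  exact hbad.false_of_vanishing hω hβ0 hβ
    (BadlyApprox.exists_auxSum_eq_zero hq hH hω hβ hα h1 h2 h3 h4 h5 hbad)

theorem stmt4
    (θ : ℝ) (b : ℝ)
    (halg : IsAlgebraic ℚ (Complex.exp (θ * Complex.I)))
    (hnru : ∀ m : ℕ, 0 < m → Complex.exp (θ * Complex.I) ^ m ≠ 1)
    (hbalg : IsAlgebraic ℚ b) (hb : 1 < |b|) :
    Transcendental ℚ
      (∑' n : ℕ, if 1 ≤ n ∧ 0 < Real.cos ((n : ℝ) * θ)
        then Real.cos ((n : ℝ) * θ) / b ^ n else 0) := by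
  have hb0 : b ≠ 0 := by
    rintro rfl
    norm_num at hb
  have hβ : |b⁻¹| < 1 := by
    rw [abs_inv]
    exact inv_lt_one_of_one_lt₀ hb
  have hθ0 : θ ≠ 0 := by
    rintro rfl
    exact hnru 1 one_pos (by simp)
  have hω : 0 < 2 * |θ| / π := by positivity
  have hang : π * (2 * |θ| / π) / 2 = |θ| := by field_simp
  have hangk : ∀ k : ℕ, cos (π * (k * (2 * |θ| / π)) / 2) = cos (k * θ) := by
    intro k
    have e : π * (k * (2 * |θ| / π)) / 2 = |k * θ| := by
      rw [abs_mul, Nat.abs_cast]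
      field_simp
    rw [e, cos_abs]
  have hirr : ∀ n : ℕ, 0 < n → ∀ c : ℤ, (n : ℝ) * (2 * |θ| / π) ≠ c := by
    intro n hn c hc
    refine hnru (4 * n) (by positivity) ?_
    have h1 : 2 * (n * |θ|) = c * π := by
      field_simp at hc
      linarith
    obtain ⟨d, hd⟩ : ∃ d : ℤ, 2 * (n * θ) = d * π := by
      rcases abs_choice θ with h | h
      · exact ⟨c, by rw [← h1, h]⟩
      · refine ⟨-c, ?_⟩
        push_cast
        rw [neg_mul, ← h1, h]
        ring
    rw [← Complex.exp_nat_mul, Complex.exp_eq_one_iff]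
    refine ⟨d, ?_⟩
    have hd' : (2 * (n * θ) : ℂ) = d * π := by exact_mod_cast hd
    push_cast
    linear_combination 2 * Complex.I * hd'
  have halg' : IsAlgebraic ℚ (Complex.exp ((π * (2 * |θ| / π) / 2 : ℝ) * Complex.I)) := by
    rw [hang]
    rcases abs_choice θ with h | h <;> rw [h]
    · exact halg
    · rw [Complex.ofReal_neg, neg_mul, Complex.exp_neg]
      exact halg.inv
  have htr := transcendental_tsum_max_cos hω hirr (inv_ne_zero hb0) hβ hbalg.inv halg'
  simp only [hangk] at htr
  have hsum : Summable fun k : ℕ => max (cos (k * θ)) 0 * b⁻¹ ^ k := by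
    refine Summable.of_norm_bounded (summable_geometric_of_lt_one (abs_nonneg _) hβ) fun k => ?_
    rw [norm_mul, norm_pow, Real.norm_eq_abs, Real.norm_eq_abs, abs_of_nonneg (le_max_right _ _)]
    exact mul_le_of_le_one_left (by positivity) (max_le (cos_le_one _) zero_le_one)
  have hterm : ∀ k : ℕ, (if 1 ≤ k ∧ 0 < cos (k * θ) then cos (k * θ) / b ^ k else 0) =
      if k = 0 then 0 else max (cos (k * θ)) 0 * b⁻¹ ^ k := by
    intro k
    rcases Nat.eq_zero_or_pos k with rfl | hk
    · simp
    rw [if_neg hk.ne']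
    split_ifs with h
    · rw [max_eq_left h.2.le, inv_pow, div_eq_mul_inv]
    · rw [max_eq_right (not_lt.mp fun hc => h ⟨hk, hc⟩), zero_mul]
  intro hf
  refine htr ?_
  rw [hsum.tsum_eq_add_tsum_ite 0]
  simp only [hterm] at hf
  refine IsAlgebraic.add ?_ hf
  simpa using isAlgebraic_one

end
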